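/- arXiv:math/0606151 — 3 statements merged into one kernel-verified Lean document; each statement's English description precedes it below -/
import Mathlib

section
/- Let α > 0, N ≥ 2, and let Ω ⊂ ℝ^N be a smooth bounded domain. Then there exist δ₀ > 0 and C = C(α, δ₀) > 0 such that for every v ∈ C₀^∞(Ω) and every 0 < δ ≤ δ₀, ∫_Ω d(x)^α · |∇v(x)| dx + ∫_{Ω \ Ω_δ} d(x)^{α−1} · |v(x)| dx ≥ C · ( ∫_Ω d(x)^{αN/(N−1)} · |v(x)|^{N/(N−1)} dx )^{(N−1)/N}. -/
open MeasureTheory Real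

noncomputable section

/-- A set `Ω ⊆ ℝ^N` is a C² domain: it is the sublevel set of a C² function whose
differential does not vanish on the boundary. -/
def IsC2Domain {N : ℕ} (Ω : Set (EuclideanSpace ℝ (Fin N))) : Prop :=
  ∃ φ : EuclideanSpace ℝ (Fin N) → ℝ,
    ContDiff ℝ 2 φ ∧ Ω = {x | φ x < 0} ∧ ∀ x ∈ frontier Ω, fderiv ℝ φ x ≠ 0

/-- Distance to the boundary of `Ω`. -/
def bdist {N : ℕ} (Ω : Set (EuclideanSpace ℝ (Fin N))) (x : EuclideanSpace ℝ (Fin N)) : ℝ :=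
  Metric.infDist x (frontier Ω)


theorem hs_cont_aux {N : ℕ} {Ω : Set (EuclideanSpace ℝ (Fin N))} (hΩ : IsOpen Ω)
    {g u : EuclideanSpace ℝ (Fin N) → ℝ} (hg : ContinuousOn g Ω) (hu : Continuous u)
    (hs : tsupport u ⊆ Ω) : Continuous (fun x => g x * u x) := by
  apply ContinuousOn.continuous_of_tsupport_subset (s := Ω) (hg.mul hu.continuousOn) hΩ
  exact (tsupport_mul_subset_right (f := g) (g := u)).trans hs

theorem hs_int_aux {N : ℕ} {Ω : Set (EuclideanSpace ℝ (Fin N))} (hΩ : IsOpen Ω)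
    {g u : EuclideanSpace ℝ (Fin N) → ℝ} (hg : ContinuousOn g Ω) (hu : Continuous u)
    (hc : HasCompactSupport u)
    (hs : tsupport u ⊆ Ω) : Integrable (fun x => g x * u x) :=
  (hs_cont_aux hΩ hg hu hs).integrable_of_hasCompactSupport hc.mul_left

theorem hs_sum_aux {N : ℕ} (A B : EuclideanSpace ℝ (Fin N) →L[ℝ] ℝ) :
    ∑ i, A (EuclideanSpace.basisFun (Fin N) ℝ i) * B (EuclideanSpace.basisFun (Fin N) ℝ i)
      = inner ℝ ((InnerProductSpace.toDual ℝ _).symm A) ((InnerProductSpace.toDual ℝ _).symm B) := by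
  rw [← (EuclideanSpace.basisFun (Fin N) ℝ).sum_inner_mul_inner]
  refine Finset.sum_congr rfl fun i _ => ?_
  rw [real_inner_comm ((InnerProductSpace.toDual ℝ _).symm B),
    InnerProductSpace.toDual_symm_apply, InnerProductSpace.toDual_symm_apply]

theorem hs_sum_sq {N : ℕ} (A : EuclideanSpace ℝ (Fin N) →L[ℝ] ℝ) :
    ∑ i, A (EuclideanSpace.basisFun (Fin N) ℝ i) * A (EuclideanSpace.basisFun (Fin N) ℝ i)
      = ‖A‖ ^ 2 := by
  rw [hs_sum_aux, real_inner_self_eq_norm_sq, LinearIsometryEquiv.norm_map]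

theorem hs_sum_abs {N : ℕ} (A B : EuclideanSpace ℝ (Fin N) →L[ℝ] ℝ) :
    |∑ i, A (EuclideanSpace.basisFun (Fin N) ℝ i) * B (EuclideanSpace.basisFun (Fin N) ℝ i)|
      ≤ ‖A‖ * ‖B‖ := by
  rw [hs_sum_aux]
  simpa using abs_real_inner_le_norm ((InnerProductSpace.toDual ℝ _).symm A)
    ((InnerProductSpace.toDual ℝ _).symm B)

/-- Laplacian-type expression. -/
def hsLap {N : ℕ} (r : EuclideanSpace ℝ (Fin N) → ℝ) (x : EuclideanSpace ℝ (Fin N)) : ℝ :=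
  ∑ i, fderiv ℝ (fun y => fderiv ℝ r y (EuclideanSpace.basisFun (Fin N) ℝ i)) x
    (EuclideanSpace.basisFun (Fin N) ℝ i)

theorem hs_hardy {N : ℕ} {Ω : Set (EuclideanSpace ℝ (Fin N))} (hΩ : IsOpen Ω) {α : ℝ} (hα : 0 < α)
    {r : EuclideanSpace ℝ (Fin N) → ℝ} (hr : ContDiff ℝ 2 r) (hpos : ∀ x ∈ Ω, 0 < r x)
    {L M m : ℝ} (hL : ∀ x ∈ Ω, ‖fderiv ℝ r x‖ ≤ L) (hM : ∀ x ∈ Ω, |hsLap r x| ≤ M)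
    (hm : ∀ x ∈ Ω, m ≤ r x + ‖fderiv ℝ r x‖ ^ 2)
    {f : EuclideanSpace ℝ (Fin N) → ℝ} (hf : ContDiff ℝ 1 f) (hc : HasCompactSupport f)
    (hs : tsupport f ⊆ Ω) (hf0 : ∀ x, 0 ≤ f x) :
    α * m * ∫ x, r x ^ (α - 1) * f x ≤
      L * (∫ x, r x ^ α * ‖fderiv ℝ f x‖) + (α + M) * ∫ x, r x ^ α * f x := by
  set e := EuclideanSpace.basisFun (Fin N) ℝ with he
  have hrc : Continuous r := hr.continuous
  have hrp : ∀ β : ℝ, ContinuousOn (fun x => r x ^ β) Ω := fun β =>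
    hrc.continuousOn.rpow_const fun x hx => Or.inl (hpos x hx).ne'
  have hdr : ∀ i, ContDiff ℝ 1 (fun y => fderiv ℝ r y (e i)) := fun i =>
    (hr.fderiv_right (m := 1) (by norm_num)).clm_apply contDiff_const
  have hdrc : ∀ i, Continuous (fun y => fderiv ℝ r y (e i)) := fun i => (hdr i).continuous
  have hddrc : ∀ i, Continuous (fun x => fderiv ℝ (fun y => fderiv ℝ r y (e i)) x (e i)) :=
    fun i => ((hdr i).continuous_fderiv (by norm_num)).clm_apply continuous_const
  have hfc : Continuous f := hf.continuous
  have hdfc : Continuous (fderiv ℝ f) := hf.continuous_fderiv (by norm_num)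
  have hsdf : tsupport (fderiv ℝ f) ⊆ Ω := (tsupport_fderiv_subset ℝ).trans hs
  have hcdf : HasCompactSupport (fderiv ℝ f) := hc.fderiv ℝ
  -- derivative of the vector field components
  have hG : ∀ i, ∀ x ∈ Ω, HasFDerivAt (fun y => r y ^ α * fderiv ℝ r y (e i))
      (r x ^ α • fderiv ℝ (fun y => fderiv ℝ r y (e i)) x +
        (fderiv ℝ r x (e i)) • ((α * r x ^ (α - 1)) • fderiv ℝ r x)) x := by
    intro i x hx
    have h1 : HasFDerivAt r (fderiv ℝ r x) x := (hr.differentiable (by norm_num) x).hasFDerivAt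
    have h2 := h1.rpow_const (p := α) (Or.inl (hpos x hx).ne')
    have h3 : HasFDerivAt (fun y => fderiv ℝ r y (e i)) _ x :=
      ((hdr i).differentiable (by norm_num) x).hasFDerivAt
    exact h2.mul h3
  -- integrability
  have I1 : ∀ i, Integrable (fun x => (r x ^ α * fderiv ℝ r x (e i)) * fderiv ℝ f x (e i)) := by
    intro i
    refine hs_int_aux hΩ ((hrp α).mul (hdrc i).continuousOn) (hdfc.clm_apply continuous_const)
      (hc.fderiv_apply ℝ _) ?_
    exact (tsupport_fderiv_apply_subset ℝ _).trans hs
  have I2 : ∀ i, Integrable (fun x => (r x ^ α * fderiv ℝ (fun y => fderiv ℝ r y (e i)) x (e i) +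
      fderiv ℝ r x (e i) * ((α * r x ^ (α - 1)) * fderiv ℝ r x (e i))) * f x) := by
    intro i
    refine hs_int_aux hΩ (ContinuousOn.add ((hrp α).mul (hddrc i).continuousOn) 
      ((hdrc i).continuousOn.mul ((continuousOn_const.mul (hrp _)).mul (hdrc i).continuousOn))) hfc hc hs
  have I3 : ∀ i, Integrable (fun x => (r x ^ α * fderiv ℝ r x (e i)) * f x) := fun i =>
    hs_int_aux hΩ ((hrp α).mul (hdrc i).continuousOn) hfc hc hs
  have E : ∀ i, (fun x => f x * fderiv ℝ (fun y => r y ^ α * fderiv ℝ r y (e i)) x (e i)) =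
      fun x => (r x ^ α * fderiv ℝ (fun y => fderiv ℝ r y (e i)) x (e i) +
      fderiv ℝ r x (e i) * ((α * r x ^ (α - 1)) * fderiv ℝ r x (e i))) * f x := by
    intro i; funext x
    by_cases hx : x ∈ Ω
    · rw [(hG i x hx).fderiv]; simp; ring
    · have : f x = 0 := image_eq_zero_of_notMem_tsupport fun h => hx (hs h)
      simp [this]
  have ibp : ∀ i, ∫ x, ((r x ^ α * fderiv ℝ (fun y => fderiv ℝ r y (e i)) x (e i) +
      fderiv ℝ r x (e i) * ((α * r x ^ (α - 1)) * fderiv ℝ r x (e i))) * f x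
      + (r x ^ α * fderiv ℝ r x (e i)) * fderiv ℝ f x (e i)) = 0 := by
    intro i
    have := integral_mul_fderiv_eq_neg_fderiv_mul_of_integrable (μ := volume) (f := f)
      (g := fun y => r y ^ α * fderiv ℝ r y (e i)) (v := e i)
      (by simpa only [mul_comm] using I1 i) (by rw [E i]; exact I2 i)
      (by simpa only [mul_comm] using I3 i)
      (fun x _ => hf.differentiable (by norm_num) x)
      (fun x hx => (hG i x (hs hx)).differentiableAt)
    rw [E i] at this
    rw [integral_add (I2 i) (I1 i), this]
    simp only [mul_comm (fderiv ℝ f _ (e i))]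
    simp
  have tot : ∫ x, ∑ i, ((r x ^ α * fderiv ℝ (fun y => fderiv ℝ r y (e i)) x (e i) +
      fderiv ℝ r x (e i) * ((α * r x ^ (α - 1)) * fderiv ℝ r x (e i))) * f x
      + (r x ^ α * fderiv ℝ r x (e i)) * fderiv ℝ f x (e i)) = 0 := by
    have h := integral_finsetSum (μ := volume) Finset.univ (f := fun i x =>
      ((r x ^ α * fderiv ℝ (fun y => fderiv ℝ r y (e i)) x (e i) +
      fderiv ℝ r x (e i) * ((α * r x ^ (α - 1)) * fderiv ℝ r x (e i))) * f x
      + (r x ^ α * fderiv ℝ r x (e i)) * fderiv ℝ f x (e i))) fun i _ => (I2 i).add (I1 i)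
    rw [h]
    exact Finset.sum_eq_zero fun i _ => ibp i
  have J1 : Integrable (fun x => r x ^ (α - 1) * f x) := hs_int_aux hΩ (hrp _) hfc hc hs
  have J2 : Integrable (fun x => r x ^ α * ‖fderiv ℝ f x‖) :=
    hs_int_aux hΩ (hrp _) hdfc.norm hcdf.norm
      ((closure_mono (by intro x; simp)).trans hsdf)
  have J3 : Integrable (fun x => r x ^ α * f x) := hs_int_aux hΩ (hrp _) hfc hc hs
  have key : ∫ x, (α * m * (r x ^ (α - 1) * f x) - L * (r x ^ α * ‖fderiv ℝ f x‖)
      - (α + M) * (r x ^ α * f x)) ≤ 0 := by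
    rw [← tot]
    refine integral_mono (((J1.const_mul _).sub (J2.const_mul _)).sub (J3.const_mul _))
      (integrable_finsetSum _ fun i _ => (I2 i).add (I1 i)) fun x => ?_
    by_cases hx : x ∈ Ω
    · have hx0 := hpos x hx
      have e1 : ∑ i, ((r x ^ α * fderiv ℝ (fun y => fderiv ℝ r y (e i)) x (e i) +
        fderiv ℝ r x (e i) * ((α * r x ^ (α - 1)) * fderiv ℝ r x (e i))) * f x
        + (r x ^ α * fderiv ℝ r x (e i)) * fderiv ℝ f x (e i)) =
        r x ^ α * f x * hsLap r x + α * r x ^ (α - 1) * f x * ‖fderiv ℝ r x‖ ^ 2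
          + r x ^ α * ∑ i, fderiv ℝ r x (e i) * fderiv ℝ f x (e i) := by
        rw [← hs_sum_sq, hsLap, Finset.mul_sum, Finset.mul_sum, Finset.mul_sum,
          ← Finset.sum_add_distrib, ← Finset.sum_add_distrib]
        refine Finset.sum_congr rfl fun i _ => ?_
        ring
      simp only [e1]
      have h1 := hs_sum_abs (fderiv ℝ r x) (fderiv ℝ f x)
      rw [← he] at h1
      have h2 := (abs_le.1 (hM x hx)).1
      have h3 := hm x hx
      have h4 : (∑ i, fderiv ℝ r x (e i) * fderiv ℝ f x (e i)) ≥ - (L * ‖fderiv ℝ f x‖) := by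
        have := (abs_le.1 h1).1
        have := mul_le_mul_of_nonneg_right (hL x hx) (norm_nonneg (fderiv ℝ f x))
        linarith
      have p1 : 0 < r x ^ α := rpow_pos_of_pos hx0 _
      have p2 : 0 < r x ^ (α - 1) := rpow_pos_of_pos hx0 _
      have p3 : r x ^ α = r x ^ (α - 1) * r x := by
        rw [← rpow_add_one hx0.ne']; ring_nf
      have q1 := mul_le_mul_of_nonneg_left h2 (mul_nonneg p1.le (hf0 x))
      have q2 := mul_le_mul_of_nonneg_left h3 (mul_nonneg (mul_nonneg hα.le p2.le) (hf0 x))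
      have q3 := mul_le_mul_of_nonneg_left h4 p1.le
      have q4 : α * r x ^ (α - 1) * f x * (r x + ‖fderiv ℝ r x‖ ^ 2) =
        α * (r x ^ α * f x) + α * r x ^ (α - 1) * f x * ‖fderiv ℝ r x‖ ^ 2 := by
        rw [p3]; ring
      rw [q4] at q2
      nlinarith
    · have h1 : f x = 0 := image_eq_zero_of_notMem_tsupport fun h => hx (hs h)
      have h2 : fderiv ℝ f x = 0 := image_eq_zero_of_notMem_tsupport fun h => hx (hsdf h)
      simp [h1, h2]
  have J12 : Integrable (fun x => α * m * (r x ^ (α - 1) * f x) -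
      L * (r x ^ α * ‖fderiv ℝ f x‖)) := (J1.const_mul _).sub (J2.const_mul _)
  rw [integral_sub J12 (J3.const_mul _),
    integral_sub (J1.const_mul _) (J2.const_mul _), integral_const_mul, integral_const_mul,
    integral_const_mul] at key
  linarith

theorem hs_geom {N : ℕ} (hN : 2 ≤ N) {Ω : Set (EuclideanSpace ℝ (Fin N))} (hΩo : IsOpen Ω)
    (hne : Ω.Nonempty) (hΩb : Bornology.IsBounded Ω)
    {φ : EuclideanSpace ℝ (Fin N) → ℝ} (hφ : ContDiff ℝ 2 φ) (hΩ : Ω = {x | φ x < 0})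
    (hd : ∀ x ∈ frontier Ω, fderiv ℝ φ x ≠ 0) :
    ∃ L m C D : ℝ, 0 < L ∧ 0 < m ∧ 0 < C ∧ 0 < D ∧
      (∀ x ∈ Ω, ‖fderiv ℝ φ x‖ ≤ L) ∧
      (∀ x ∈ Ω, m ≤ - φ x + ‖fderiv ℝ φ x‖ ^ 2) ∧
      (∀ x ∈ Ω, - φ x ≤ L * Metric.infDist x (frontier Ω)) ∧
      (∀ x ∈ Ω, Metric.infDist x (frontier Ω) ≤ C * (- φ x)) ∧
      (∀ x ∈ Ω, Metric.infDist x (frontier Ω) ≤ D) ∧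
      (∀ x ∈ Ω, 0 < Metric.infDist x (frontier Ω)) := by
  have hφc := hφ.continuous
  have hdc : Continuous (fderiv ℝ φ) := hφ.continuous_fderiv (by norm_num)
  have hK : IsCompact (closure Ω) := hΩb.isCompact_closure
  have hF : IsClosed (frontier Ω) := isClosed_frontier
  have hFK : IsCompact (frontier Ω) := hK.of_isClosed_subset hF frontier_subset_closure
  have : Nonempty (Fin N) := ⟨⟨0, by omega⟩⟩
  have hFne : (frontier Ω).Nonempty := by
    rw [nonempty_frontier_iff]
    refine ⟨hne, fun h => ?_⟩
    rw [h] at hΩb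
    exact NormedSpace.unbounded_univ ℝ (EuclideanSpace ℝ (Fin N)) hΩb
  have hneg : ∀ x ∈ Ω, φ x < 0 := fun x hx => by rw [hΩ] at hx; exact hx
  have hnn : ∀ x, x ∉ Ω → 0 ≤ φ x := fun x hx => by rw [hΩ] at hx; simpa using hx
  have hF0 : ∀ x ∈ frontier Ω, φ x = 0 := by
    intro x hx
    rw [hΩ] at hx
    exact frontier_lt_subset_eq hφc continuous_const hx
  obtain ⟨R, hR⟩ := hΩb.closure.subset_closedBall (0 : EuclideanSpace ℝ (Fin N))
  have hB : IsCompact (Metric.closedBall (0 : EuclideanSpace ℝ (Fin N)) R) :=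
    isCompact_closedBall _ _
  obtain ⟨L0, hL0⟩ := hB.exists_bound_of_continuousOn hdc.continuousOn
  set L := max L0 1 with hLdef
  have hL : ∀ x ∈ Metric.closedBall (0 : EuclideanSpace ℝ (Fin N)) R, ‖fderiv ℝ φ x‖ ≤ L :=
    fun x hx => (hL0 x hx).trans (le_max_left _ _)
  have hLpos : 0 < L := lt_of_lt_of_le one_pos (le_max_right _ _)
  have hΩB : ∀ x ∈ Ω, x ∈ Metric.closedBall (0 : EuclideanSpace ℝ (Fin N)) R :=
    fun x hx => hR (subset_closure hx)
  -- lower bound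
  obtain ⟨x0, hx0, hmin⟩ := hK.exists_isMinOn hne.closure
    (f := fun x => - φ x + ‖fderiv ℝ φ x‖ ^ 2) (by fun_prop)
  have hclos : ∀ x ∈ closure Ω, x ∈ Ω ∨ x ∈ frontier Ω := fun x hx => by
    by_cases h : x ∈ Ω
    · exact Or.inl h
    · right; rw [hΩo.frontier_eq]; exact ⟨hx, h⟩
  have hm0 : 0 < - φ x0 + ‖fderiv ℝ φ x0‖ ^ 2 := by
    rcases hclos x0 hx0 with h | h
    · have := hneg x0 h
      have := sq_nonneg ‖fderiv ℝ φ x0‖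
      linarith
    · rw [hF0 x0 h]
      have := norm_pos_iff.2 (hd x0 h)
      simp; positivity
  obtain ⟨D0, hD0⟩ := hK.exists_bound_of_continuousOn
    (f := fun x => Metric.infDist x (frontier Ω)) (Metric.continuous_infDist_pt _).continuousOn
  -- d ≤ C ρ
  have hC : ∃ C : ℝ, 0 < C ∧ ∀ x ∈ closure Ω, x ∈ Ω →
      Metric.infDist x (frontier Ω) ≤ C * (- φ x) := by
    refine hK.induction_on (p := fun s => ∃ C : ℝ, 0 < C ∧ ∀ x ∈ s, x ∈ Ω →
      Metric.infDist x (frontier Ω) ≤ C * (- φ x)) ⟨1, one_pos, by simp⟩ ?_ ?_ ?_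
    · rintro s t hst ⟨C, hC, h⟩
      exact ⟨C, hC, fun x hx => h x (hst hx)⟩
    · rintro s t ⟨C, hC, h⟩ ⟨C', hC', h'⟩
      refine ⟨max C C', lt_max_of_lt_left hC, ?_⟩
      rintro x (hx | hx) hxΩ
      · refine (h x hx hxΩ).trans (mul_le_mul_of_nonneg_right (le_max_left _ _) ?_)
        linarith [hneg x hxΩ]
      · refine (h' x hx hxΩ).trans (mul_le_mul_of_nonneg_right (le_max_right _ _) ?_)
        linarith [hneg x hxΩ]
    · intro x hx
      rcases hclos x hx with h | h
      · -- interior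
        have hx1 := hneg x h
        refine ⟨{y | φ y < φ x / 2}, mem_nhdsWithin_of_mem_nhds
          ((isOpen_lt hφc continuous_const).mem_nhds (by simp; linarith)), 
          (max D0 1) * (2 / (- φ x)), ?_, ?_⟩
        · have : 0 < max D0 1 := lt_max_of_lt_right one_pos
          have : 0 < - φ x := by linarith
          positivity
        · intro y hy hyΩ
          have h1 := hD0 y (subset_closure hyΩ)
          rw [Real.norm_eq_abs] at h1
          have h2 := (le_abs_self _).trans h1
          have h3 : 0 < - φ x := by linarith
          have h4 : 1 ≤ 2 / (- φ x) * (- φ y) := by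
            rw [div_mul_eq_mul_div, le_div_iff₀ h3]
            have : φ y < φ x / 2 := hy
            linarith
          have h5 : 0 < max D0 1 := lt_max_of_lt_right one_pos
          calc _ ≤ max D0 1 * 1 := by rw [mul_one]; exact h2.trans (le_max_left _ _)
            _ ≤ max D0 1 * (2 / (- φ x) * (- φ y)) := mul_le_mul_of_nonneg_left h4 h5.le
            _ = _ := by ring
      · -- boundary
        set A := fderiv ℝ φ x with hA
        set g := (InnerProductSpace.toDual ℝ (EuclideanSpace ℝ (Fin N))).symm A with hg
        have hAg : ∀ y, A y = inner ℝ g y := fun y => by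
          rw [hg, InnerProductSpace.toDual_symm_apply]
        have hgn : ‖g‖ = ‖A‖ := by simp [hg]
        have hgpos : 0 < ‖g‖ := by rw [hgn]; exact norm_pos_iff.2 (hd x h)
        have hst : HasStrictFDerivAt φ A x :=
          hφ.contDiffAt.hasStrictFDerivAt (by norm_num)
        have hst' := hst.isLittleO.def (c := ‖g‖ / 2) (by positivity)
        rw [nhds_prod_eq, Filter.eventually_prod_self_iff'] at hst'
        obtain ⟨t, ht, hpt⟩ := hst'
        obtain ⟨ε, hε, hball⟩ := Metric.mem_nhds_iff.1 ht
        refine ⟨Metric.ball x (ε / 4), mem_nhdsWithin_of_mem_nhds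
          (Metric.ball_mem_nhds _ (by positivity)), 2 / ‖g‖, by positivity, ?_⟩
        intro y hy hyΩ
        have hyneg := hneg y hyΩ
        set s := 2 / ‖g‖ * (- φ y) with hs
        have hspos : 0 < s := mul_pos (by positivity) (by linarith)
        by_contra hcon
        push Not at hcon
        have hdx : Metric.infDist y (frontier Ω) ≤ dist y x := Metric.infDist_le_dist_of_mem h
        have hyx : dist y x < ε / 4 := hy
        have hsε : s < ε / 4 := by linarith
        set z := y + (s / ‖g‖) • g with hz
        have hzy : ‖z - y‖ = s := by
          rw [hz, add_sub_cancel_left, norm_smul, Real.norm_eq_abs, abs_of_pos (by positivity)]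
          field_simp
        have hzt : z ∈ Metric.ball x ε := by
          rw [Metric.mem_ball]
          have := dist_triangle z y x
          rw [dist_eq_norm z y, hzy] at this
          linarith
        have hyt : y ∈ Metric.ball x ε := by rw [Metric.mem_ball]; linarith
        have hest := hpt z (hball hzt) y (hball hyt)
        simp only [hzy] at hest
        have hAz : A (z - y) = s * ‖g‖ := by
          rw [hAg, hz, add_sub_cancel_left, inner_smul_right, real_inner_self_eq_norm_sq]
          field_simp
        rw [hAz, Real.norm_eq_abs] at hest
        have h1 := (abs_le.1 hest).1
        have h2 : s * ‖g‖ = 2 * (- φ y) := by rw [hs]; field_simp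
        have hz0 : 0 ≤ φ z := by nlinarith
        have hzΩ : z ∉ Ω := fun hzΩ => by linarith [hneg z hzΩ]
        -- segment meets frontier
        have hseg : (segment ℝ y z ∩ frontier Ω).Nonempty := by
          have hpc : IsPreconnected (segment ℝ y z) := (convex_segment y z).isPreconnected
          by_contra hemp
          rw [Set.not_nonempty_iff_eq_empty] at hemp
          obtain ⟨u, -, hu1, hu2⟩ := hpc Ω (closure Ω)ᶜ hΩo isClosed_closure.isOpen_compl
            (fun u hu => by
              by_cases huc : u ∈ closure Ω
              · rcases hclos u huc with h | h
                · exact Or.inl h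
                · have : u ∈ segment ℝ y z ∩ frontier Ω := ⟨hu, h⟩
                  rw [hemp] at this
                  exact this.elim
              · exact Or.inr huc)
            ⟨y, left_mem_segment ℝ y z, hyΩ⟩
            ⟨z, right_mem_segment ℝ y z, fun hzc => by
              rcases hclos z hzc with h | h
              · exact hzΩ h
              · have : z ∈ segment ℝ y z ∩ frontier Ω := ⟨right_mem_segment ℝ y z, h⟩
                rw [hemp] at this
                exact this.elim⟩
          exact hu2 (subset_closure hu1)
        obtain ⟨w, hw, hwF⟩ := hseg
        have h3 : Metric.infDist y (frontier Ω) ≤ dist y w := Metric.infDist_le_dist_of_mem hwF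
        have h4 : dist y w ≤ s := by
          rw [← hzy, ← dist_eq_norm, dist_comm z y]
          have := dist_add_dist_of_mem_segment hw
          linarith [dist_nonneg (x := w) (y := z)]
        linarith
  obtain ⟨C, hC0, hC⟩ := hC
  refine ⟨L, _, C, max D0 1, hLpos, hm0, hC0, lt_max_of_lt_right one_pos,
    fun x hx => hL x (hΩB x hx), fun x hx => hmin (subset_closure hx), ?_,
    fun x hx => hC x (subset_closure hx) hx, ?_, ?_⟩
  · intro x hx
    obtain ⟨y, hy, hxy⟩ := hFK.exists_infDist_eq_dist hFne x
    have := (convex_closedBall (0 : EuclideanSpace ℝ (Fin N)) R).norm_image_sub_le_of_norm_fderiv_le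
      (f := φ) (𝕜 := ℝ) (fun z _ => hφ.differentiable (by norm_num) z) hL (hΩB x hx)
      (hR (frontier_subset_closure hy))
    rw [hF0 y hy, Real.norm_eq_abs, ← dist_eq_norm, dist_comm, ← hxy] at this
    linarith [le_abs_self (0 - φ x)]
  · intro x hx
    have h1 := hD0 x (subset_closure hx)
    rw [Real.norm_eq_abs] at h1
    exact ((le_abs_self _).trans h1).trans (le_max_left _ _)
  · intro x hx
    refine (hF.notMem_iff_infDist_pos hFne).1 fun h => ?_
    linarith [hneg x hx, hF0 x h]

theorem hs_sobolev (N : ℕ) (hN : 2 ≤ N) : ∃ K : ℝ, 0 < K ∧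
    ∀ w : EuclideanSpace ℝ (Fin N) → ℝ, ContDiff ℝ 1 w → HasCompactSupport w →
      (∫ x, |w x| ^ ((N : ℝ) / ((N : ℝ) - 1))) ^ (((N : ℝ) - 1) / (N : ℝ)) ≤
        K * ∫ x, ‖fderiv ℝ w x‖ := by
  have hN' : (2 : ℝ) ≤ N := by exact_mod_cast hN
  set p : ℝ := (N : ℝ) / ((N : ℝ) - 1) with hp
  have hp0 : 0 < p := div_pos (by linarith) (by linarith)
  have hpi : ((N : ℝ) - 1) / (N : ℝ) = p⁻¹ := by rw [hp, inv_div]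
  have hH : Real.HolderConjugate (Module.finrank ℝ (EuclideanSpace ℝ (Fin N))) p := by
    rw [finrank_euclideanSpace_fin]
    exact Real.HolderConjugate.conjExponent (by linarith)
  set c : NNReal := lintegralPowLePowLIntegralFDerivConst
    (volume : Measure (EuclideanSpace ℝ (Fin N))) p with hc
  refine ⟨(c : ℝ) ^ p⁻¹ + 1, by positivity, fun w hw hws => ?_⟩
  have h := lintegral_pow_le_pow_lintegral_fderiv (volume) hw hws hH
  rw [← hc] at h
  have hwc := hw.continuous
  have hdc := hw.continuous_fderiv (by norm_num)
  have hi : Integrable (fderiv ℝ w) := hdc.integrable_of_hasCompactSupport (hws.fderiv ℝ)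
  have e1 : ∫ x, |w x| ^ p = (∫⁻ x, ‖w x‖ₑ ^ p).toReal := by
    rw [integral_eq_lintegral_of_nonneg_ae (Filter.Eventually.of_forall fun x => by positivity)
      ((hwc.abs.rpow_const fun x => Or.inr hp0.le).aestronglyMeasurable)]
    congr 2
    funext x
    rw [← ofReal_norm, ENNReal.ofReal_rpow_of_nonneg (norm_nonneg _) hp0.le,
      Real.norm_eq_abs]
  have e2 : ∫ x, ‖fderiv ℝ w x‖ = (∫⁻ x, ‖fderiv ℝ w x‖ₑ).toReal :=
    integral_norm_eq_lintegral_enorm hi.1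
  have hfin : (∫⁻ x, ‖fderiv ℝ w x‖ₑ) ≠ ⊤ := hi.2.ne
  have hI0 : 0 ≤ ∫ x, ‖fderiv ℝ w x‖ := integral_nonneg fun _ => norm_nonneg _
  have h2 : ∫ x, |w x| ^ p ≤ c * (∫ x, ‖fderiv ℝ w x‖) ^ p := by
    rw [e1, e2]
    have := ENNReal.toReal_mono (ENNReal.mul_ne_top ENNReal.coe_ne_top
      (ENNReal.rpow_ne_top_of_nonneg hp0.le hfin)) h
    rwa [ENNReal.toReal_mul, ← ENNReal.toReal_rpow, ENNReal.coe_toReal] at this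
  rw [hpi]
  calc (∫ x, |w x| ^ p) ^ p⁻¹ ≤ (c * (∫ x, ‖fderiv ℝ w x‖) ^ p) ^ p⁻¹ :=
        rpow_le_rpow (integral_nonneg fun x => by positivity) h2 (by positivity)
    _ = (c : ℝ) ^ p⁻¹ * ∫ x, ‖fderiv ℝ w x‖ := by
        rw [mul_rpow (NNReal.coe_nonneg c) (by positivity), rpow_rpow_inv hI0 hp0.ne']
    _ ≤ _ := by nlinarith

theorem hs_hardy_abs {N : ℕ} {Ω : Set (EuclideanSpace ℝ (Fin N))} (hΩ : IsOpen Ω)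
    {α : ℝ} (hα : 0 < α)
    {r : EuclideanSpace ℝ (Fin N) → ℝ} (hr : ContDiff ℝ 2 r) (hpos : ∀ x ∈ Ω, 0 < r x)
    {L M m : ℝ} (hL0 : 0 < L) (hM0 : 0 ≤ M) (hm0 : 0 < m)
    (hL : ∀ x ∈ Ω, ‖fderiv ℝ r x‖ ≤ L) (hM : ∀ x ∈ Ω, |hsLap r x| ≤ M)
    (hm : ∀ x ∈ Ω, m ≤ r x + ‖fderiv ℝ r x‖ ^ 2)
    {v : EuclideanSpace ℝ (Fin N) → ℝ} (hv : ContDiff ℝ 1 v) (hc : HasCompactSupport v)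
    (hs : tsupport v ⊆ Ω) :
    α * m * ∫ x, r x ^ (α - 1) * |v x| ≤
      L * (∫ x, r x ^ α * ‖fderiv ℝ v x‖) + (α + M) * ∫ x, r x ^ α * |v x| := by
  have hrc : Continuous r := hr.continuous
  have hrp : ∀ β : ℝ, ContinuousOn (fun x => r x ^ β) Ω := fun β =>
    hrc.continuousOn.rpow_const fun x hx => Or.inl (hpos x hx).ne'
  have hvc : Continuous v := hv.continuous
  have hdvc : Continuous (fderiv ℝ v) := hv.continuous_fderiv (by norm_num)
  have hsdv : tsupport (fderiv ℝ v) ⊆ Ω := (tsupport_fderiv_subset ℝ).trans hs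
  have hcdv : HasCompactSupport (fderiv ℝ v) := hc.fderiv ℝ
  have hv0 : ∀ x, x ∉ Ω → v x = 0 := fun x hx =>
    image_eq_zero_of_notMem_tsupport fun h => hx (hs h)
  have hdv0 : ∀ x, x ∉ Ω → fderiv ℝ v x = 0 := fun x hx =>
    image_eq_zero_of_notMem_tsupport fun h => hx (hsdv h)
  have hsa : tsupport (fun x => |v x|) ⊆ Ω := (closure_mono (by intro x; simp)).trans hs
  have J1 : ∀ β : ℝ, Integrable (fun x => r x ^ β * |v x|) := fun β =>
    hs_int_aux hΩ (hrp _) hvc.abs hc.norm hsa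
  have J2 : Integrable (fun x => r x ^ α * ‖fderiv ℝ v x‖) :=
    hs_int_aux hΩ (hrp _) hdvc.norm hcdv.norm
      ((closure_mono (by intro x; simp)).trans hsdv)
  have hT : IsCompact (tsupport v) := hc
  have JT : IntegrableOn (fun x => r x ^ (α - 1)) (tsupport v) :=
    ((hrp _).mono hs).integrableOn_compact hT
  set Z := ∫ x in tsupport v, r x ^ (α - 1) with hZ
  have hZ0 : 0 ≤ Z := setIntegral_nonneg (isClosed_tsupport v).measurableSet fun x hx =>
    (rpow_pos_of_pos (hpos x (hs hx)) _).le
  have main : ∀ ε : ℝ, 0 < ε → α * m * ∫ x, r x ^ (α - 1) * |v x| ≤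
      L * (∫ x, r x ^ α * ‖fderiv ℝ v x‖) + (α + M) * (∫ x, r x ^ α * |v x|)
        + α * m * (ε * Z) := by
    intro ε hε
    set f : EuclideanSpace ℝ (Fin N) → ℝ := fun x => √(v x ^ 2 + ε ^ 2) - ε with hf
    have hq : ∀ x, 0 < v x ^ 2 + ε ^ 2 := fun x => by positivity
    have hfC : ContDiff ℝ 1 f :=
      ((hv.pow 2).add contDiff_const).sqrt (fun x => (hq x).ne') |>.sub contDiff_const
    have hf00 : ∀ x, v x = 0 → f x = 0 := fun x hx => by
      simp [hf, hx, Real.sqrt_sq hε.le]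
    have hsf : tsupport f ⊆ tsupport v := closure_mono fun x hx h => hx (hf00 x h)
    have hcf : HasCompactSupport f := hT.of_isClosed_subset (isClosed_tsupport f) hsf
    have hfle : ∀ x, f x ≤ |v x| := fun x => by
      have : √(v x ^ 2 + ε ^ 2) ≤ |v x| + ε := by
        apply Real.sqrt_le_iff.2 ⟨by positivity, ?_⟩
        nlinarith [sq_abs (v x), abs_nonneg (v x)]
      simp only [hf]; linarith
    have hf0 : ∀ x, 0 ≤ f x := fun x => by
      have : ε ≤ √(v x ^ 2 + ε ^ 2) := Real.le_sqrt_of_sq_le (by nlinarith [sq_nonneg (v x)])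
      simp only [hf]; linarith
    have hfge : ∀ x, |v x| ≤ f x + ε := fun x => by
      have : |v x| ≤ √(v x ^ 2 + ε ^ 2) := Real.abs_le_sqrt (by nlinarith)
      simp only [hf]; linarith
    have hdf : ∀ x, ‖fderiv ℝ f x‖ ≤ ‖fderiv ℝ v x‖ := fun x => by
      have h1 : HasFDerivAt v (fderiv ℝ v x) x :=
        (hv.differentiable (by norm_num) x).hasFDerivAt
      have h2 := (((h1.pow 2).add_const (ε ^ 2)).sqrt (hq x).ne').sub_const ε
      have h3 : fderiv ℝ f x = (v x / √(v x ^ 2 + ε ^ 2)) • fderiv ℝ v x := by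
        rw [HasFDerivAt.fderiv h2]
        ext y
        simp
        field_simp
      rw [h3, norm_smul, norm_div, Real.norm_eq_abs, Real.norm_eq_abs,
        abs_of_nonneg (Real.sqrt_nonneg _)]
      refine mul_le_of_le_one_left (norm_nonneg _) ?_
      rw [div_le_one (Real.sqrt_pos.2 (hq x))]
      exact Real.abs_le_sqrt (by nlinarith)
    have H := hs_hardy hΩ hα hr hpos hL hM hm hfC hcf (hsf.trans hs) hf0
    have F1 : ∀ β : ℝ, Integrable (fun x => r x ^ β * f x) := fun β =>
      hs_int_aux hΩ (hrp _) hfC.continuous hcf (hsf.trans hs)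
    have a1 : ∫ x, r x ^ α * ‖fderiv ℝ f x‖ ≤ ∫ x, r x ^ α * ‖fderiv ℝ v x‖ := by
      have hsdf : tsupport (fderiv ℝ f) ⊆ Ω := (tsupport_fderiv_subset ℝ).trans (hsf.trans hs)
      refine integral_mono (hs_int_aux hΩ (hrp _) (hfC.continuous_fderiv (by norm_num)).norm
        (hcf.fderiv ℝ).norm ((closure_mono (by intro x; simp)).trans hsdf)) J2 fun x => ?_
      by_cases hx : x ∈ Ω
      · exact mul_le_mul_of_nonneg_left (hdf x) (rpow_pos_of_pos (hpos x hx) _).le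
      · have : fderiv ℝ f x = 0 := image_eq_zero_of_notMem_tsupport fun h => hx (hsdf h)
        simp [this, hdv0 x hx]
    have a2 : ∫ x, r x ^ α * f x ≤ ∫ x, r x ^ α * |v x| := by
      refine integral_mono (F1 α) (J1 α) fun x => ?_
      by_cases hx : x ∈ Ω
      · exact mul_le_mul_of_nonneg_left (hfle x) (rpow_pos_of_pos (hpos x hx) _).le
      · simp [hv0 x hx, hf00 x (hv0 x hx)]
    have a3 : ∫ x, r x ^ (α - 1) * |v x| ≤ (∫ x, r x ^ (α - 1) * f x) + ε * Z := by
      have hTm : MeasurableSet (tsupport v) := (isClosed_tsupport v).measurableSet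
      rw [hZ, ← integral_indicator hTm, ← integral_const_mul,
        ← integral_add (F1 _) ((JT.integrable_indicator hTm).const_mul _)]
      refine integral_mono (J1 _) ((F1 _).add ((JT.integrable_indicator hTm).const_mul _))
        fun x => ?_
      by_cases hx : x ∈ tsupport v
      · simp only [Set.indicator_of_mem hx]
        have := mul_le_mul_of_nonneg_left (hfge x) (rpow_pos_of_pos (hpos x (hs hx)) (α - 1)).le
        linarith
      · have h0 : v x = 0 := image_eq_zero_of_notMem_tsupport hx
        simp [Set.indicator_of_notMem hx, h0, hf00 x h0]
    have b1 := mul_le_mul_of_nonneg_left a1 hL0.le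
    have b2 := mul_le_mul_of_nonneg_left a2 (by linarith : 0 ≤ α + M)
    have b3 := mul_le_mul_of_nonneg_left a3 (by positivity : 0 ≤ α * m)
    rw [mul_add] at b3
    linarith
  refine le_of_forall_pos_le_add fun ε hε => ?_
  refine (main (ε / (α * m * (Z + 1))) (by positivity)).trans ?_
  have : α * m * (ε / (α * m * (Z + 1)) * Z) ≤ ε := by
    have e1 : α * m * (ε / (α * m * (Z + 1)) * Z) = ε * Z / (Z + 1) := by field_simp
    rw [e1, div_le_iff₀ (by positivity)]
    nlinarith
  linarith

theorem hs_core {N : ℕ} (hN : 2 ≤ N) {α : ℝ} (hα : 0 < α)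
    {Ω : Set (EuclideanSpace ℝ (Fin N))} (hΩ : IsOpen Ω)
    {r d : EuclideanSpace ℝ (Fin N) → ℝ} (hr : ContDiff ℝ 2 r) (hpos : ∀ x ∈ Ω, 0 < r x)
    (hdc : Continuous d) (hdpos : ∀ x ∈ Ω, 0 < d x)
    {L M m C D : ℝ} (hL0 : 0 < L) (hM0 : 0 ≤ M) (hm0 : 0 < m) (hC0 : 0 < C) (hD0 : 0 < D)
    (hL : ∀ x ∈ Ω, ‖fderiv ℝ r x‖ ≤ L) (hM : ∀ x ∈ Ω, |hsLap r x| ≤ M)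
    (hm : ∀ x ∈ Ω, m ≤ r x + ‖fderiv ℝ r x‖ ^ 2)
    (hrd : ∀ x ∈ Ω, r x ≤ L * d x) (hdr : ∀ x ∈ Ω, d x ≤ C * r x) (hdD : ∀ x ∈ Ω, d x ≤ D) :
    ∃ δ₀ C : ℝ, 0 < δ₀ ∧ 0 < C ∧
      ∀ v : EuclideanSpace ℝ (Fin N) → ℝ,
        ContDiff ℝ (⊤ : ℕ∞) v → HasCompactSupport v → tsupport v ⊆ Ω →
        ∀ δ : ℝ, 0 < δ → δ ≤ δ₀ →
        C * (∫ x in Ω, d x ^ (α * (N : ℝ) / ((N : ℝ) - 1)) *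
              |v x| ^ ((N : ℝ) / ((N : ℝ) - 1))) ^ (((N : ℝ) - 1) / (N : ℝ)) ≤
          (∫ x in Ω, d x ^ α * ‖gradient v x‖) +
            ∫ x in {x | x ∈ Ω ∧ δ < d x}, d x ^ (α - 1) * |v x| := by
  obtain ⟨K, hK0, hK⟩ := hs_sobolev N hN
  have hN' : (2 : ℝ) ≤ N := by exact_mod_cast hN
  set p : ℝ := (N : ℝ) / ((N : ℝ) - 1) with hp
  have hp0 : 0 < p := div_pos (by linarith) (by linarith)
  have hpi : ((N : ℝ) - 1) / (N : ℝ) = p⁻¹ := by rw [hp, inv_div]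
  have hap : α * (N : ℝ) / ((N : ℝ) - 1) = α * p := by rw [hp, mul_div_assoc]
  rw [hap]
  rw [hpi] at hK ⊢
  set LA : ℝ := L ^ α with hLA
  have hLA0 : 0 < LA := rpow_pos_of_pos hL0 _
  -- constants
  set k1 : ℝ := L * LA + (α + M) * (LA * D) with hk1
  have hk10 : 0 < k1 := by positivity
  set k2 : ℝ := LA + α * L * (2 / (α * m) * k1) with hk2
  have hk20 : 0 < k2 := by positivity
  set k3 : ℝ := C ^ α * (K * k2) with hk3
  have hk30 : 0 < k3 := mul_pos (rpow_pos_of_pos hC0 _) (by positivity)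
  refine ⟨α * m / (2 * ((α + M) * L)), k3⁻¹, by positivity, by positivity, ?_⟩
  intro v hvS hc hs δ hδ hδ0
  have hv : ContDiff ℝ 1 v := hvS.of_le (by exact_mod_cast le_top)
  have hrc : Continuous r := hr.continuous
  have hrp : ∀ β : ℝ, ContinuousOn (fun x => r x ^ β) Ω := fun β =>
    hrc.continuousOn.rpow_const fun x hx => Or.inl (hpos x hx).ne'
  have hdp : ∀ β : ℝ, ContinuousOn (fun x => d x ^ β) Ω := fun β =>
    hdc.continuousOn.rpow_const fun x hx => Or.inl (hdpos x hx).ne'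
  have hvc : Continuous v := hv.continuous
  have hdvc : Continuous (fderiv ℝ v) := hv.continuous_fderiv (by norm_num)
  have hsdv : tsupport (fderiv ℝ v) ⊆ Ω := (tsupport_fderiv_subset ℝ).trans hs
  have hcdv : HasCompactSupport (fderiv ℝ v) := hc.fderiv ℝ
  have hv0 : ∀ x, x ∉ Ω → v x = 0 := fun x hx =>
    image_eq_zero_of_notMem_tsupport fun h => hx (hs h)
  have hdv0 : ∀ x, x ∉ Ω → fderiv ℝ v x = 0 := fun x hx =>
    image_eq_zero_of_notMem_tsupport fun h => hx (hsdv h)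
  have hsa : tsupport (fun x => |v x|) ⊆ Ω := (closure_mono (by intro x; simp)).trans hs
  have hsn : tsupport (fun x => ‖fderiv ℝ v x‖) ⊆ Ω :=
    (closure_mono (by intro x; simp)).trans hsdv
  have J1 : ∀ β : ℝ, Integrable (fun x => r x ^ β * |v x|) := fun β =>
    hs_int_aux hΩ (hrp _) hvc.abs hc.norm hsa
  have J2 : Integrable (fun x => r x ^ α * ‖fderiv ℝ v x‖) :=
    hs_int_aux hΩ (hrp _) hdvc.norm hcdv.norm hsn
  have D1 : Integrable (fun x => d x ^ (α - 1) * |v x|) :=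
    hs_int_aux hΩ (hdp _) hvc.abs hc.norm hsa
  have D2 : Integrable (fun x => d x ^ α * ‖fderiv ℝ v x‖) :=
    hs_int_aux hΩ (hdp _) hdvc.norm hcdv.norm hsn
  set S : Set (EuclideanSpace ℝ (Fin N)) := {x | x ∈ Ω ∧ δ < d x} with hS
  have hSm : MeasurableSet S := (hΩ.inter (isOpen_lt continuous_const hdc)).measurableSet
  have hgrad : ∀ x, ‖gradient v x‖ = ‖fderiv ℝ v x‖ := fun x => by simp [gradient]
  have eA : ∫ x in Ω, d x ^ α * ‖gradient v x‖ = ∫ x, d x ^ α * ‖fderiv ℝ v x‖ := by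
    simp only [hgrad]
    exact setIntegral_eq_integral_of_forall_compl_eq_zero fun x hx => by simp [hdv0 x hx]
  rw [eA]
  set A := ∫ x, d x ^ α * ‖fderiv ℝ v x‖ with hA
  set B := ∫ x in S, d x ^ (α - 1) * |v x| with hB
  have hA0 : 0 ≤ A := integral_nonneg fun x => by
    by_cases hx : x ∈ Ω
    · have := hdpos x hx
      positivity
    · simp [hdv0 x hx]
  have hB0 : 0 ≤ B := setIntegral_nonneg hSm fun x hx => by
    have := hdpos x hx.1
    positivity
  have hrdα : ∀ x ∈ Ω, r x ^ α ≤ LA * d x ^ α := fun x hx => by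
    rw [hLA, ← mul_rpow hL0.le (hdpos x hx).le]
    exact rpow_le_rpow (hpos x hx).le (hrd x hx) hα.le
  -- first estimate
  have s1 : ∫ x, r x ^ α * ‖fderiv ℝ v x‖ ≤ LA * A := by
    rw [hA, ← integral_const_mul]
    refine integral_mono J2 (D2.const_mul _) fun x => ?_
    by_cases hx : x ∈ Ω
    · have := mul_le_mul_of_nonneg_right (hrdα x hx) (norm_nonneg (fderiv ℝ v x))
      simp only; linarith
    · simp [hdv0 x hx]
  set X := ∫ x, r x ^ (α - 1) * |v x| with hX
  set q := α * m / (2 * (α + M)) with hq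
  have s2 : ∫ x, r x ^ α * |v x| ≤ LA * D * B + q * X := by
    rw [hB, ← integral_indicator hSm, hX, ← integral_const_mul, ← integral_const_mul,
      ← integral_add ((D1.indicator hSm).const_mul _) ((J1 _).const_mul _)]
    refine integral_mono (J1 _) (((D1.indicator hSm).const_mul _).add ((J1 _).const_mul _))
      fun x => ?_
    by_cases hx : x ∈ Ω
    · have hx0 := hpos x hx
      have hd0 := hdpos x hx
      have hr1 : r x ^ α = r x ^ (α - 1) * r x := by
        rw [← rpow_add_one hx0.ne']; ring_nf
      have hd1 : d x ^ α = d x ^ (α - 1) * d x := by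
        rw [← rpow_add_one hd0.ne']; ring_nf
      have hpr : 0 < r x ^ (α - 1) := rpow_pos_of_pos hx0 _
      have hpd : 0 < d x ^ (α - 1) := rpow_pos_of_pos hd0 _
      have hq0 : 0 < q := by positivity
      by_cases hxS : x ∈ S
      · simp only [Set.indicator_of_mem hxS]
        have h1 : r x ^ α ≤ LA * (d x ^ (α - 1) * D) := by
          refine (hrdα x hx).trans (mul_le_mul_of_nonneg_left ?_ hLA0.le)
          rw [hd1]
          exact mul_le_mul_of_nonneg_left (hdD x hx) hpd.le
        have h2 := mul_le_mul_of_nonneg_right h1 (abs_nonneg (v x))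
        have h3 : 0 ≤ q * (r x ^ (α - 1) * |v x|) := by positivity
        linarith
      · simp only [Set.indicator_of_notMem hxS]
        have hdx : d x ≤ δ := by
          by_contra h
          exact hxS ⟨hx, not_le.1 h⟩
        have h1 : r x ≤ q := by
          calc r x ≤ L * d x := hrd x hx
            _ ≤ L * (α * m / (2 * ((α + M) * L))) :=
              mul_le_mul_of_nonneg_left (hdx.trans hδ0) hL0.le
            _ = q := by rw [hq]; field_simp
        rw [hr1]
        have h2 := mul_le_mul_of_nonneg_left h1 (mul_nonneg hpr.le (abs_nonneg (v x)))
        linarith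
    · have hxS : x ∉ S := fun h => hx h.1
      simp [Set.indicator_of_notMem hxS, hv0 x hx]
  have H := hs_hardy_abs hΩ hα hr hpos hL0 hM0 hm0 hL hM hm hv hc hs
  have s3 : X ≤ 2 / (α * m) * k1 * (A + B) := by
    have h1 := mul_le_mul_of_nonneg_left s1 hL0.le
    have h2 := mul_le_mul_of_nonneg_left s2 (by linarith : 0 ≤ α + M)
    have h3 : (α + M) * (LA * D * B + q * X) = (α + M) * (LA * D) * B + α * m / 2 * X := by
      rw [hq]; field_simp
    have h4 : α * m / 2 * X ≤ k1 * (A + B) := by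
      have e1 : 0 ≤ L * LA * B := by positivity
      have e2 : 0 ≤ (α + M) * (LA * D) * A := by positivity
      rw [hk1]
      linarith
    have h5 := mul_le_mul_of_nonneg_left h4 (by positivity : 0 ≤ 2 / (α * m))
    have h6 : 2 / (α * m) * (α * m / 2 * X) = X := by field_simp
    linarith
  -- the Sobolev function
  set w : EuclideanSpace ℝ (Fin N) → ℝ := fun x => r x ^ α * v x with hw
  have hwC : ContDiff ℝ 1 w := by
    rw [contDiff_iff_contDiffAt]
    intro x
    by_cases hx : x ∈ Ω
    · exact ((hr.of_le (by norm_num)).contDiffAt.rpow_const_of_ne (hpos x hx).ne').mul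
        hv.contDiffAt
    · have h1 : x ∉ tsupport v := fun h => hx (hs h)
      have h2 : w =ᶠ[nhds x] fun _ => 0 := by
        filter_upwards [notMem_tsupport_iff_eventuallyEq.1 h1] with y hy
        simp [hw, hy]
      exact contDiffAt_const.congr_of_eventuallyEq h2
  have hwc : HasCompactSupport w := hc.mul_left
  have hdw : ∀ x, ‖fderiv ℝ w x‖ ≤
      r x ^ α * ‖fderiv ℝ v x‖ + α * L * (r x ^ (α - 1) * |v x|) := by
    intro x
    by_cases hx : x ∈ Ω
    · have h1 : HasFDerivAt r (fderiv ℝ r x) x := (hr.differentiable (by norm_num) x).hasFDerivAt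
      have h2 := h1.rpow_const (p := α) (Or.inl (hpos x hx).ne')
      have h3 : HasFDerivAt v (fderiv ℝ v x) x :=
        (hv.differentiable (by norm_num) x).hasFDerivAt
      have h4 : HasFDerivAt w (r x ^ α • fderiv ℝ v x +
          v x • ((α * r x ^ (α - 1)) • fderiv ℝ r x)) x := h2.mul h3
      rw [HasFDerivAt.fderiv h4]
      have p1 : 0 < r x ^ α := rpow_pos_of_pos (hpos x hx) _
      have p2 : 0 < r x ^ (α - 1) := rpow_pos_of_pos (hpos x hx) _
      refine (norm_add_le _ _).trans (add_le_add ?_ ?_)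
      · rw [norm_smul, Real.norm_eq_abs, abs_of_pos p1]
      · rw [norm_smul, norm_smul, Real.norm_eq_abs, Real.norm_eq_abs,
          abs_of_pos (mul_pos hα p2)]
        have := mul_le_mul_of_nonneg_left (hL x hx)
          (by positivity : 0 ≤ |v x| * (α * r x ^ (α - 1)))
        linarith
    · have h1 : x ∉ tsupport w := fun h =>
        hx (hs (tsupport_mul_subset_right (f := fun x => r x ^ α) (g := v) h))
      have h2 : fderiv ℝ w x = 0 :=
        image_eq_zero_of_notMem_tsupport fun h => h1 (tsupport_fderiv_subset ℝ h)
      simp [h2, hv0 x hx, hdv0 x hx]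
  have s4 : ∫ x, ‖fderiv ℝ w x‖ ≤ k2 * (A + B) := by
    have h1 : ∫ x, ‖fderiv ℝ w x‖ ≤
        ∫ x, (r x ^ α * ‖fderiv ℝ v x‖ + α * L * (r x ^ (α - 1) * |v x|)) :=
      integral_mono ((hwC.continuous_fderiv (by norm_num)).norm.integrable_of_hasCompactSupport
        (hwc.fderiv ℝ).norm) (J2.add ((J1 _).const_mul _)) hdw
    rw [integral_add J2 ((J1 _).const_mul _), integral_const_mul] at h1
    have h2 := mul_le_mul_of_nonneg_left s3 (by positivity : 0 ≤ α * L)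
    have h3 : 0 ≤ LA * B := by positivity
    rw [hk2]
    linarith
  have s5 := hK w hwC hwc
  have hIw : Integrable (fun x => |w x| ^ p) := by
    refine (hwC.continuous.abs.rpow_const fun x => Or.inr hp0.le).integrable_of_hasCompactSupport ?_
    refine hwc.of_isClosed_subset (isClosed_tsupport _) (closure_mono fun x hx h => hx ?_)
    simp [h, Real.zero_rpow hp0.ne']
  have s6 : ∫ x in Ω, d x ^ (α * p) * |v x| ^ p ≤ (C ^ α) ^ p * ∫ x, |w x| ^ p := by
    rw [setIntegral_eq_integral_of_forall_compl_eq_zero fun x hx => by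
      simp [hv0 x hx, Real.zero_rpow hp0.ne'], ← integral_const_mul]
    refine integral_mono_of_nonneg (Filter.Eventually.of_forall fun x => ?_)
      (hIw.const_mul _) (Filter.Eventually.of_forall fun x => ?_)
    · by_cases hx : x ∈ Ω
      · have := hdpos x hx
        simp only [Pi.zero_apply]
        positivity
      · simp [hv0 x hx, Real.zero_rpow hp0.ne']
    · by_cases hx : x ∈ Ω
      · have hd0 := hdpos x hx
        have hx0 := hpos x hx
        simp only [hw]
        rw [rpow_mul hd0.le, ← mul_rpow (by positivity) (by positivity),
          ← mul_rpow (by positivity) (by positivity)]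
        refine rpow_le_rpow (by positivity) ?_ hp0.le
        rw [abs_mul, abs_of_pos (rpow_pos_of_pos hx0 α), ← mul_assoc,
          ← mul_rpow hC0.le hx0.le]
        exact mul_le_mul_of_nonneg_right (rpow_le_rpow hd0.le (hdr x hx) hα.le) (abs_nonneg _)
      · simp [hw, hv0 x hx, Real.zero_rpow hp0.ne']
  have hl0 : 0 ≤ ∫ x in Ω, d x ^ (α * p) * |v x| ^ p :=
    setIntegral_nonneg hΩ.measurableSet fun x hx => by
      have := hdpos x hx
      positivity
  have s7 : (∫ x in Ω, d x ^ (α * p) * |v x| ^ p) ^ p⁻¹ ≤ k3 * (A + B) := by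
    calc _ ≤ ((C ^ α) ^ p * ∫ x, |w x| ^ p) ^ p⁻¹ := rpow_le_rpow hl0 s6 (by positivity)
      _ = C ^ α * (∫ x, |w x| ^ p) ^ p⁻¹ := by
        rw [mul_rpow (by positivity) (integral_nonneg fun x => by positivity),
          rpow_rpow_inv (by positivity) hp0.ne']
      _ ≤ C ^ α * (K * (k2 * (A + B))) := by
        refine mul_le_mul_of_nonneg_left (s5.trans ?_) (by positivity)
        exact mul_le_mul_of_nonneg_left s4 hK0.le
      _ = _ := by rw [hk3]; ring
  rw [inv_mul_le_iff₀ hk30]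
  exact s7

/-- Auxiliary L¹ Hardy–Sobolev inequality with weight `d^α`. -/
theorem L1_hardy_sobolev_weighted
    (α : ℝ) (hα : 0 < α) (N : ℕ) (hN : 2 ≤ N)
    (Ω : Set (EuclideanSpace ℝ (Fin N))) (hΩo : IsOpen Ω) (hΩconn : IsConnected Ω)
    (hΩb : Bornology.IsBounded Ω) (hΩsm : IsC2Domain Ω) :
    ∃ δ₀ C : ℝ, 0 < δ₀ ∧ 0 < C ∧
      ∀ v : EuclideanSpace ℝ (Fin N) → ℝ,
        ContDiff ℝ (⊤ : ℕ∞) v → HasCompactSupport v → tsupport v ⊆ Ω →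
        ∀ δ : ℝ, 0 < δ → δ ≤ δ₀ →
        C * (∫ x in Ω, bdist Ω x ^ (α * (N : ℝ) / ((N : ℝ) - 1)) *
              |v x| ^ ((N : ℝ) / ((N : ℝ) - 1))) ^ (((N : ℝ) - 1) / (N : ℝ)) ≤
          (∫ x in Ω, bdist Ω x ^ α * ‖gradient v x‖) +
            ∫ x in {x | x ∈ Ω ∧ δ < bdist Ω x}, bdist Ω x ^ (α - 1) * |v x| := by
  obtain ⟨φ, hφ, hΩφ, hd⟩ := hΩsm
  obtain ⟨L, m, C, D, hL0, hm0, hC0, hD0, hL, hm, hrd, hdr, hdD, hdpos⟩ :=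
    hs_geom hN hΩo hΩconn.nonempty hΩb hφ hΩφ hd
  have hr : ContDiff ℝ 2 (fun x => - φ x) := hφ.neg
  have hlap : Continuous (hsLap (fun x => - φ x)) := by
    unfold hsLap
    refine continuous_finsetSum _ fun i _ => ?_
    have h1 : ContDiff ℝ 1 (fun y => fderiv ℝ (fun x => - φ x) y
        (EuclideanSpace.basisFun (Fin N) ℝ i)) :=
      (hr.fderiv_right (m := 1) (by norm_num)).clm_apply contDiff_const
    exact (h1.continuous_fderiv (by norm_num)).clm_apply continuous_const
  obtain ⟨M, hM⟩ := hΩb.isCompact_closure.exists_bound_of_continuousOn hlap.continuousOn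
  have hn : ∀ x, ‖fderiv ℝ (fun x => - φ x) x‖ = ‖fderiv ℝ φ x‖ := fun x => by
    rw [fderiv_fun_neg, norm_neg]
  refine hs_core hN hα hΩo hr (fun x hx => ?_) (Metric.continuous_infDist_pt _) hdpos
    hL0 (le_max_right M 0) hm0 hC0 hD0 (fun x hx => by rw [hn]; exact hL x hx)
    (fun x hx => (hM x (subset_closure hx)).trans (le_max_left _ _))
    (fun x hx => by rw [hn]; exact hm x hx) hrd hdr hdD
  rw [hΩφ] at hx
  have : φ x < 0 := hx
  linarith
end
end

section
/- Let N ≥ 2 and let Ω ⊂ ℝ^N be a smooth bounded convex domain. Then there exists a positive constant C such that for every u ∈ C₀^∞(Ω), ( ∫_Ω ( |∇u(x)|² − u(x)²/(4 d(x)²) ) dx ) · ( ∫_Ω u(x)² dx )^{2/N} ≥ C · ∫_Ω |u(x)|^{2(1 + 2/N)} dx. -/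
open MeasureTheory Real

noncomputable section

lemma oneD_zero_deriv {f f' : ℝ → ℝ} (hf : ∀ t, HasDerivAt f (f' t) t) {a1 b1 : ℝ}
    (h0 : ∀ t, t ∉ Set.Ioo a1 b1 → f t = 0) (t : ℝ) (ht : t ∉ Set.Icc a1 b1) : f' t = 0 := by
  have h1 : f =ᶠ[nhds t] fun _ => (0:ℝ) := by
    filter_upwards [isClosed_Icc.isOpen_compl.mem_nhds ht] with s hs
    exact h0 s (fun h => hs (Set.Ioo_subset_Icc_self h))
  exact (hf t).unique ((hasDerivAt_const t (0:ℝ)).congr_of_eventuallyEq h1)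

lemma oneD_hardy {f f' : ℝ → ℝ} (hf : ∀ t, HasDerivAt f (f' t) t) (hf' : Continuous f')
    {a a1 b1 b : ℝ} (h1 : a < a1) (h2 : a1 < b1) (h3 : b1 < b)
    (h0 : ∀ t, t ∉ Set.Ioo a1 b1 → f t = 0) :
    ∫⁻ t, ENNReal.ofReal ((f' t - (1/(t-a) - 1/(b-t))/2 * f t)^2
        + f t ^ 2 * (1/(t-a) + 1/(b-t))^2/4) ≤ ∫⁻ t, ENNReal.ofReal (f' t ^ 2) := by
  have hfc : Continuous f := continuous_iff_continuousAt.2 fun t => (hf t).continuousAt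
  set F : ℝ → ℝ := fun t => (f' t - (1/(t-a) - 1/(b-t))/2 * f t)^2
        + f t ^ 2 * (1/(t-a) + 1/(b-t))^2/4 with hF
  have hFs : ∫⁻ t, ENNReal.ofReal (F t) = ∫⁻ t in Set.Icc a1 b1, ENNReal.ofReal (F t) := by
    rw [← lintegral_indicator measurableSet_Icc]
    congr 1; ext t
    by_cases ht : t ∈ Set.Icc a1 b1
    · simp [ht]
    · have e1 := oneD_zero_deriv hf h0 t ht
      have e2 := h0 t (fun h => ht (Set.Ioo_subset_Icc_self h))
      simp [ht, hF, e1, e2]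
  have ca : ∀ t ∈ Set.Icc a1 b1, t - a ≠ 0 := fun t ht => by have := ht.1; linarith
  have cb : ∀ t ∈ Set.Icc a1 b1, b - t ≠ 0 := fun t ht => by have := ht.2; linarith
  have c1 : ContinuousOn (fun t => 1/(t-a)) (Set.Icc a1 b1) :=
    continuousOn_const.div (by fun_prop) ca
  have c2 : ContinuousOn (fun t => 1/(b-t)) (Set.Icc a1 b1) :=
    continuousOn_const.div (by fun_prop) cb
  have cF : ContinuousOn F (Set.Icc a1 b1) := by
    rw [hF]
    exact (((hf'.continuousOn).sub (((c1.sub c2).div_const 2).mul hfc.continuousOn)).pow 2).add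
      ((((hfc.continuousOn).pow 2).mul ((c1.add c2).pow 2)).div_const 4)
  set P : ℝ → ℝ := fun t => (1/(t-a) - 1/(b-t))/2 * f t ^2 with hP
  have hPd : ∀ t ∈ Set.uIcc a1 b1, HasDerivAt P (f' t ^ 2 - F t) t := by
    intro t ht
    rw [Set.uIcc_of_le h2.le] at ht
    have ha := ca t ht
    have hb := cb t ht
    have d1 : HasDerivAt (fun t => 1/(t-a)) (-1/(t-a)^2) t := by
      have := ((hasDerivAt_id t).sub_const a).fun_inv ha
      simpa [one_div] using this
    have d2 : HasDerivAt (fun t => 1/(b-t)) (1/(b-t)^2) t := by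
      have := ((hasDerivAt_id t).const_sub b).fun_inv hb
      simpa [one_div] using this
    have d3 := ((d1.fun_sub d2).div_const 2).fun_mul ((hf t).fun_pow 2)
    refine d3.congr_deriv ?_
    change _ = f' t ^ 2 - ((f' t - (1/(t-a) - 1/(b-t))/2 * f t)^2
        + f t ^ 2 * (1/(t-a) + 1/(b-t))^2/4)
    norm_num
    field_simp
    ring
  have iF : IntervalIntegrable F volume a1 b1 := by
    apply ContinuousOn.intervalIntegrable; rwa [Set.uIcc_of_le h2.le]
  have if' : IntervalIntegrable (fun t => f' t ^2) volume a1 b1 :=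
    (hf'.pow 2).intervalIntegrable _ _
  have hint := intervalIntegral.integral_eq_sub_of_hasDerivAt hPd (if'.sub iF)
  have z1 : f a1 = 0 := h0 a1 (by simp)
  have z2 : f b1 = 0 := h0 b1 (by simp)
  rw [intervalIntegral.integral_sub if' iF] at hint
  simp only [hP, z1, z2] at hint
  have hF0 : ∀ t, 0 ≤ F t := fun t => by simp only [hF]; positivity
  rw [hFs]
  refine le_trans ?_ (setLIntegral_le_lintegral (Set.Icc a1 b1) _)
  rw [← ofReal_integral_eq_lintegral_ofReal, ← ofReal_integral_eq_lintegral_ofReal]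
  · apply ENNReal.ofReal_le_ofReal
    rw [integral_Icc_eq_integral_Ioc, integral_Icc_eq_integral_Ioc,
      ← intervalIntegral.integral_of_le h2.le, ← intervalIntegral.integral_of_le h2.le]
    linarith
  · exact (hf'.pow 2).continuousOn.integrableOn_Icc
  · exact ae_of_all _ fun t => sq_nonneg _
  · exact cF.integrableOn_Icc
  · exact ae_of_all _ hF0

set_option maxHeartbeats 800000 in
lemma oneD_sup {f f' : ℝ → ℝ} (hf : ∀ t, HasDerivAt f (f' t) t) (hf' : Continuous f')
    {a a1 b1 b : ℝ} (h1 : a < a1) (h2 : a1 < b1) (h3 : b1 < b)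
    (h0 : ∀ t, t ∉ Set.Ioo a1 b1 → f t = 0) {p : ℝ} (hp2 : 2 ≤ p) (t0 : ℝ) :
    ENNReal.ofReal (|f t0| ^ p) ≤
    ∫⁻ t, ENNReal.ofReal (p * |f t|^(p-1) * |f' t - (1/(t-a) - 1/(b-t))/2 * f t|
        + (2+p)/(b-a) * |f t| ^ p) := by
  have hfc : Continuous f := continuous_iff_continuousAt.2 fun t => (hf t).continuousAt
  have hp : 1 < p := by linarith
  by_cases ht0 : t0 ∉ Set.Ioo a1 b1
  · simp [h0 t0 ht0, Real.zero_rpow (by linarith : p ≠ 0)]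
  push Not at ht0
  set R : ℝ → ℝ := fun t => p * |f t|^(p-1) * |f' t - (1/(t-a) - 1/(b-t))/2 * f t|
        + (2+p)/(b-a) * |f t| ^ p with hR
  have hR0 : ∀ t, 0 ≤ R t := fun t => by
    have : 0 < b - a := by linarith
    simp only [hR]; positivity
  have ca : ∀ t ∈ Set.Icc a1 b1, t - a > 0 := fun t ht => by have := ht.1; linarith
  have cb : ∀ t ∈ Set.Icc a1 b1, b - t > 0 := fun t ht => by have := ht.2; linarith
  have c1 : ContinuousOn (fun t => 1/(t-a)) (Set.Icc a1 b1) :=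
    continuousOn_const.div (by fun_prop) fun t ht => (ca t ht).ne'
  have c2 : ContinuousOn (fun t => 1/(b-t)) (Set.Icc a1 b1) :=
    continuousOn_const.div (by fun_prop) fun t ht => (cb t ht).ne'
  have cR : ContinuousOn R (Set.Icc a1 b1) := by
    rw [hR]
    have e1 : Continuous fun t => |f t|^(p-1) := hfc.abs.rpow_const fun _ => Or.inr (by linarith)
    have e2 : Continuous fun t => |f t|^p := hfc.abs.rpow_const fun _ => Or.inr (by linarith)
    exact ((continuousOn_const.mul e1.continuousOn).mul
      ((hf'.continuousOn).sub (((c1.sub c2).div_const 2).mul hfc.continuousOn)).abs).add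
      (continuousOn_const.mul e2.continuousOn)
  have z1 : f a1 = 0 := h0 a1 (by simp)
  have z2 : f b1 = 0 := h0 b1 (by simp)
  have hdF : ∀ t, HasDerivAt (fun t => |f t|^p) (p * |f t|^(p-2) * f t * f' t) t := fun t => by
    exact (hasDerivAt_abs_rpow (f t) hp).comp t (hf t)
  have cD : Continuous fun t => p * |f t|^(p-2) * f t := by
    exact (continuous_const.mul (hfc.abs.rpow_const fun _ => Or.inr (by linarith))).mul hfc
  have hpp : ∀ x : ℝ, |x|^(p-2) * x * x = |x|^p := fun x => by
    rcases eq_or_ne x 0 with rfl | hx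
    · simp [Real.zero_rpow (by linarith : p ≠ 0)]
    · have : 0 < |x| := abs_pos.2 hx
      rw [mul_assoc, ← abs_mul_abs_self x, ← mul_assoc, ← Real.rpow_add_one this.ne',
        ← Real.rpow_add_one this.ne']
      congr 1; ring
  have hpp1 : ∀ x : ℝ, |(|x|^(p-2) * x)| = |x|^(p-1) := fun x => by
    rcases eq_or_ne x 0 with rfl | hx
    · simp [Real.zero_rpow (by linarith : p-1 ≠ 0)]
    · have : 0 < |x| := abs_pos.2 hx
      rw [abs_mul, abs_of_nonneg (by positivity), ← Real.rpow_add_one this.ne']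
      congr 1; ring
  -- main real inequality
  have main : |f t0|^p ≤ ∫ t in Set.Icc a1 b1, R t := by
    rw [integral_Icc_eq_integral_Ioc, ← intervalIntegral.integral_of_le h2.le]
    have iR : ∀ c d, c ∈ Set.Icc a1 b1 → d ∈ Set.Icc a1 b1 → IntervalIntegrable R volume c d := by
      intro c d hc hd
      exact (cR.mono (Set.uIcc_subset_Icc hc hd)).intervalIntegrable
    have ma1 : a1 ∈ Set.Icc a1 b1 := ⟨le_rfl, h2.le⟩
    have mb1 : b1 ∈ Set.Icc a1 b1 := ⟨h2.le, le_rfl⟩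
    have mt0 : t0 ∈ Set.Icc a1 b1 := ⟨ht0.1.le, ht0.2.le⟩
    have hsplit : (∫ t in a1..t0, R t) + (∫ t in t0..b1, R t) = ∫ t in a1..b1, R t :=
      intervalIntegral.integral_add_adjacent_intervals (iR _ _ ma1 mt0) (iR _ _ mt0 mb1)
    have n1 : 0 ≤ ∫ t in a1..t0, R t :=
      intervalIntegral.integral_nonneg ht0.1.le fun t _ => hR0 t
    have n2 : 0 ≤ ∫ t in t0..b1, R t :=
      intervalIntegral.integral_nonneg ht0.2.le fun t _ => hR0 t
    have hba : 0 < b - a := by linarith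
    rcases le_total t0 ((a+b)/2) with hm | hm
    · have hbt0 : 0 < b - t0 := cb t0 mt0
      have hd : ∀ t ∈ Set.uIcc t0 b1, HasDerivAt (fun t => (b-t)/(b-t0) * |f t|^p)
          (-1/(b-t0) * |f t|^p + (b-t)/(b-t0) * (p * |f t|^(p-2) * f t * f' t)) t := by
        intro t _
        have := (((hasDerivAt_id t).const_sub b).div_const (b-t0)).fun_mul (hdF t)
        simpa using this
      have ci : Continuous fun t => (-1/(b-t0) * |f t|^p
          + (b-t)/(b-t0) * (p * |f t|^(p-2) * f t * f' t)) := by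
        have e2 : Continuous fun t => |f t|^p := hfc.abs.rpow_const fun _ => Or.inr (by linarith)
        have e3 := cD.mul hf'
        exact (continuous_const.mul e2).add ((by fun_prop : Continuous fun t => (b-t)/(b-t0)).mul e3)
      have hint := intervalIntegral.integral_eq_sub_of_hasDerivAt hd (ci.intervalIntegrable _ _)
      simp only [z2, abs_zero, Real.zero_rpow (by linarith : p ≠ 0), mul_zero, zero_sub,
        div_self hbt0.ne', one_mul] at hint
      have hle : (∫ t in t0..b1, -(-1/(b-t0) * |f t|^p
          + (b-t)/(b-t0) * (p * |f t|^(p-2) * f t * f' t))) ≤ ∫ t in t0..b1, R t := by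
        apply intervalIntegral.integral_mono_on ht0.2.le (ci.fun_neg.intervalIntegrable _ _)
          (iR _ _ mt0 mb1)
        intro t ht
        have mt : t ∈ Set.Icc a1 b1 := ⟨ht0.1.le.trans ht.1, ht.2⟩
        have A := ca t mt
        have B := cb t mt
        simp only [hR]
        set h := f' t - (1/(t-a) - 1/(b-t))/2 * f t with hh
        have ef : f' t = h + (1/(t-a) - 1/(b-t))/2 * f t := by rw [hh]; ring
        rw [ef]
        set X := |f t|^(p-2) * f t with hX
        have eX : X * f t = |f t|^p := hpp (f t)
        have eX1 : |X| = |f t|^(p-1) := hpp1 (f t)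
        rw [← eX1]
        have hq : 0 ≤ |f t|^p := by positivity
        have e : -(-1/(b-t0) * |f t|^p + (b-t)/(b-t0) * (p * |f t|^(p-2) * f t * (h + (1/(t-a) - 1/(b-t))/2 * f t)))
          = 1/(b-t0) * |f t|^p - p * ((b-t)/(b-t0)) * (X * h)
            - p * ((b-t)/(b-t0) * (1/(t-a) - 1/(b-t))/2) * |f t|^p := by
          rw [← eX, hX]; ring
        rw [e]
        have s1 : 1/(b-t0) ≤ 2/(b-a) := by
          rw [div_le_div_iff₀ hbt0 hba]; linarith
        have s2 : -(X * h) ≤ |X| * |h| := by rw [← abs_mul]; exact neg_le_abs _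
        have s3 : (b-t)/(b-t0) ≤ 1 := by rw [div_le_one hbt0]; linarith [ht.1]
        have s3' : 0 ≤ (b-t)/(b-t0) := by positivity
        have s4 : -((b-t)/(b-t0) * (1/(t-a) - 1/(b-t))/2) ≤ 1/(b-a) := by
          have : -((b-t)/(b-t0) * (1/(t-a) - 1/(b-t))/2) ≤ 1/(2 * (b-t0)) := by
            have e5 : -((b-t)/(b-t0) * (1/(t-a) - 1/(b-t))/2)
              = 1/(2*(b-t0)) - (b-t)/(2 * (b-t0) * (t-a)) := by field_simp; ring
            rw [e5]
            have : 0 ≤ (b-t)/(2 * (b-t0) * (t-a)) := by positivity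
            linarith
          refine this.trans ?_
          rw [div_le_div_iff₀ (by positivity) hba]; linarith
        have t1 : -((b-t)/(b-t0) * (X*h)) ≤ |X| * |h| := by
          have : (b-t)/(b-t0) * (-(X*h)) ≤ 1 * (|X| * |h|) :=
            (mul_le_mul_of_nonneg_left s2 s3').trans (mul_le_mul_of_nonneg_right s3 (by positivity))
          linarith
        have t2 := mul_le_mul_of_nonneg_right s1 hq
        have t3 := mul_le_mul_of_nonneg_right s4 hq
        have p0 : 0 ≤ p := by linarith
        have t4 := mul_le_mul_of_nonneg_left t1 p0
        have t5 := mul_le_mul_of_nonneg_left t3 p0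
        have e6 : (2+p)/(b-a) = 2/(b-a) + p * (1/(b-a)) := by ring
        rw [e6]
        linarith
      rw [intervalIntegral.integral_neg, hint] at hle
      linarith
    · have hbt0 : 0 < t0 - a := ca t0 mt0
      have hd : ∀ t ∈ Set.uIcc a1 t0, HasDerivAt (fun t => (t-a)/(t0-a) * |f t|^p)
          (1/(t0-a) * |f t|^p + (t-a)/(t0-a) * (p * |f t|^(p-2) * f t * f' t)) t := by
        intro t _
        have := (((hasDerivAt_id t).sub_const a).div_const (t0-a)).fun_mul (hdF t)
        simpa using this
      have ci : Continuous fun t => (1/(t0-a) * |f t|^p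
          + (t-a)/(t0-a) * (p * |f t|^(p-2) * f t * f' t)) := by
        have e2 : Continuous fun t => |f t|^p := hfc.abs.rpow_const fun _ => Or.inr (by linarith)
        have e3 := cD.mul hf'
        exact (continuous_const.mul e2).add ((by fun_prop : Continuous fun t => (t-a)/(t0-a)).mul e3)
      have hint := intervalIntegral.integral_eq_sub_of_hasDerivAt hd (ci.intervalIntegrable _ _)
      simp only [z1, abs_zero, Real.zero_rpow (by linarith : p ≠ 0), mul_zero, sub_zero,
        div_self hbt0.ne', one_mul] at hint
      have hle : (∫ t in a1..t0, (1/(t0-a) * |f t|^p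
          + (t-a)/(t0-a) * (p * |f t|^(p-2) * f t * f' t))) ≤ ∫ t in a1..t0, R t := by
        apply intervalIntegral.integral_mono_on ht0.1.le (ci.intervalIntegrable _ _)
          (iR _ _ ma1 mt0)
        intro t ht
        have mt : t ∈ Set.Icc a1 b1 := ⟨ht.1, ht.2.trans ht0.2.le⟩
        have A := ca t mt
        have B := cb t mt
        simp only [hR]
        set h := f' t - (1/(t-a) - 1/(b-t))/2 * f t with hh
        have ef : f' t = h + (1/(t-a) - 1/(b-t))/2 * f t := by rw [hh]; ring
        rw [ef]
        set X := |f t|^(p-2) * f t with hX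
        have eX : X * f t = |f t|^p := hpp (f t)
        have eX1 : |X| = |f t|^(p-1) := hpp1 (f t)
        rw [← eX1]
        have hq : 0 ≤ |f t|^p := by positivity
        have e : (1/(t0-a) * |f t|^p + (t-a)/(t0-a) * (p * |f t|^(p-2) * f t * (h + (1/(t-a) - 1/(b-t))/2 * f t)))
          = 1/(t0-a) * |f t|^p + p * ((t-a)/(t0-a)) * (X * h)
            + p * ((t-a)/(t0-a) * (1/(t-a) - 1/(b-t))/2) * |f t|^p := by
          rw [← eX, hX]; ring
        rw [e]
        have s1 : 1/(t0-a) ≤ 2/(b-a) := by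
          rw [div_le_div_iff₀ hbt0 hba]; linarith
        have s2 : (X * h) ≤ |X| * |h| := by rw [← abs_mul]; exact le_abs_self _
        have s3 : (t-a)/(t0-a) ≤ 1 := by rw [div_le_one hbt0]; linarith [ht.2]
        have s3' : 0 ≤ (t-a)/(t0-a) := by positivity
        have s4 : ((t-a)/(t0-a) * (1/(t-a) - 1/(b-t))/2) ≤ 1/(b-a) := by
          have : ((t-a)/(t0-a) * (1/(t-a) - 1/(b-t))/2) ≤ 1/(2 * (t0-a)) := by
            have e5 : ((t-a)/(t0-a) * (1/(t-a) - 1/(b-t))/2)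
              = 1/(2*(t0-a)) - (t-a)/(2 * (t0-a) * (b-t)) := by field_simp
            rw [e5]
            have : 0 ≤ (t-a)/(2 * (t0-a) * (b-t)) := by positivity
            linarith
          refine this.trans ?_
          rw [div_le_div_iff₀ (by positivity) hba]; linarith
        have t1 : ((t-a)/(t0-a) * (X*h)) ≤ |X| * |h| := by
          have : (t-a)/(t0-a) * (X*h) ≤ 1 * (|X| * |h|) :=
            (mul_le_mul_of_nonneg_left s2 s3').trans (mul_le_mul_of_nonneg_right s3 (by positivity))
          linarith
        have t2 := mul_le_mul_of_nonneg_right s1 hq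
        have t3 := mul_le_mul_of_nonneg_right s4 hq
        have p0 : 0 ≤ p := by linarith
        have t4 := mul_le_mul_of_nonneg_left t1 p0
        have t5 := mul_le_mul_of_nonneg_left t3 p0
        have e6 : (2+p)/(b-a) = 2/(b-a) + p * (1/(b-a)) := by ring
        rw [e6]
        linarith
      rw [hint] at hle
      linarith
  refine le_trans ?_ (setLIntegral_le_lintegral (Set.Icc a1 b1) _)
  rw [← ofReal_integral_eq_lintegral_ofReal cR.integrableOn_Icc (ae_of_all _ hR0)]
  exact ENNReal.ofReal_le_ofReal main

/-- Lower endpoint of the slice of `S` in direction `i` through `x`. -/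
def loEnd {N : ℕ} (S : Set (Fin N → ℝ)) (i : Fin N) (x : Fin N → ℝ) : ℝ :=
  sInf {s | Function.update x i s ∈ S}

/-- Upper endpoint of the slice of `S` in direction `i` through `x`. -/
def hiEnd {N : ℕ} (S : Set (Fin N → ℝ)) (i : Fin N) (x : Fin N → ℝ) : ℝ :=
  sSup {s | Function.update x i s ∈ S}

lemma loEnd_update {N : ℕ} (S : Set (Fin N → ℝ)) (i : Fin N) (x : Fin N → ℝ) (t : ℝ) :
    loEnd S i (Function.update x i t) = loEnd S i x := by
  simp [loEnd]

lemma hiEnd_update {N : ℕ} (S : Set (Fin N → ℝ)) (i : Fin N) (x : Fin N → ℝ) (t : ℝ) :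
    hiEnd S i (Function.update x i t) = hiEnd S i x := by
  simp [hiEnd]

lemma slice_isOpen {N : ℕ} {S : Set (Fin N → ℝ)} (hS : IsOpen S) (i : Fin N) (x : Fin N → ℝ) :
    IsOpen {s : ℝ | Function.update x i s ∈ S} :=
  hS.preimage (by fun_prop : Continuous fun s : ℝ => Function.update x i s)

lemma slice_bdd {N : ℕ} {S : Set (Fin N → ℝ)} (hS : Bornology.IsBounded S) (i : Fin N)
    (x : Fin N → ℝ) : Bornology.IsBounded {s : ℝ | Function.update x i s ∈ S} := by
  obtain ⟨R, hR⟩ := hS.exists_norm_le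
  refine isBounded_iff_forall_norm_le.2 ⟨R, fun s hs => ?_⟩
  have := (norm_le_pi_norm (Function.update x i s) i).trans (hR _ hs)
  simpa using this

lemma slice_eq {N : ℕ} {S : Set (Fin N → ℝ)} (hS : IsOpen S) (hb : Bornology.IsBounded S)
    (hc : Convex ℝ S) (i : Fin N) (x : Fin N → ℝ)
    (hne : {s : ℝ | Function.update x i s ∈ S}.Nonempty) :
    {s : ℝ | Function.update x i s ∈ S} = Set.Ioo (loEnd S i x) (hiEnd S i x) := by
  have ho := slice_isOpen hS i x
  have hbd := slice_bdd hb i x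
  have hcv : Set.OrdConnected {s : ℝ | Function.update x i s ∈ S} := by
    rw [← convex_iff_ordConnected (𝕜 := ℝ)]
    intro s hs t ht α β hα hβ hαβ
    have := hc hs ht hα hβ hαβ
    have e : Function.update x i (α • s + β • t)
        = α • Function.update x i s + β • Function.update x i t := by
      ext j
      by_cases h : j = i
      · subst h; simp
      · simp [h, ← add_mul, hαβ]
    change Function.update x i (α • s + β • t) ∈ S
    rw [e]; exact this
  have hlow : BddBelow {s : ℝ | Function.update x i s ∈ S} := hbd.bddBelow
  have hup : BddAbove {s : ℝ | Function.update x i s ∈ S} := hbd.bddAbove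
  apply Set.Subset.antisymm
  · intro s hs
    constructor
    · obtain ⟨ε, hε, h⟩ := Metric.isOpen_iff.1 ho s hs
      have : s - ε/2 ∈ {s : ℝ | Function.update x i s ∈ S} := h (by
        simp [abs_of_pos hε]; exact hε)
      have := csInf_le hlow this
      unfold loEnd; linarith
    · obtain ⟨ε, hε, h⟩ := Metric.isOpen_iff.1 ho s hs
      have : s + ε/2 ∈ {s : ℝ | Function.update x i s ∈ S} := h (by
        simp [abs_of_pos hε]; exact hε)
      have := le_csSup hup this
      unfold hiEnd; linarith
  · intro s hs
    obtain ⟨a, ha, h1⟩ := exists_lt_of_csInf_lt hne hs.1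
    obtain ⟨b, hb, h2⟩ := exists_lt_of_lt_csSup hne hs.2
    exact hcv.out ha hb ⟨h1.le, h2.le⟩

lemma measurable_hiEnd {N : ℕ} {S : Set (Fin N → ℝ)} (hS : IsOpen S)
    (hb : Bornology.IsBounded S) (i : Fin N) : Measurable (hiEnd S i) := by
  apply measurable_of_Ioi
  intro c
  have hpre : ∀ s : ℝ, IsOpen {x : Fin N → ℝ | Function.update x i s ∈ S} := fun s =>
    hS.preimage (by fun_prop)
  have e : hiEnd S i ⁻¹' Set.Ioi c = (⋃ s : ℝ, ⋃ _ : c < s, {x | Function.update x i s ∈ S}) ∪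
      ((⋃ s : ℝ, {x | Function.update x i s ∈ S})ᶜ ∩ {_x | c < 0}) := by
    ext x
    simp only [Set.mem_preimage, Set.mem_Ioi, Set.mem_union, Set.mem_iUnion, Set.mem_ofPred_eq,
      Set.mem_inter_iff, Set.mem_compl_iff, not_exists]
    by_cases hne : {s : ℝ | Function.update x i s ∈ S}.Nonempty
    · constructor
      · intro h
        obtain ⟨b, hb, h2⟩ := exists_lt_of_lt_csSup hne h
        exact Or.inl ⟨b, h2, hb⟩
      · rintro (⟨s, h1, h2⟩ | ⟨h1, _⟩)
        · exact h1.trans_le (le_csSup (slice_bdd hb i x).bddAbove h2)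
        · exact absurd hne.some_mem (h1 _)
    · rw [Set.not_nonempty_iff_eq_empty] at hne
      have h' : ∀ s, Function.update x i s ∉ S := fun s hs => by
        have : s ∈ {s : ℝ | Function.update x i s ∈ S} := hs
        rw [hne] at this; exact this
      simp [hiEnd, h']
  rw [e]
  refine MeasurableSet.union ?_ (MeasurableSet.inter ?_ (MeasurableSet.const _))
  · exact (isOpen_iUnion fun s => isOpen_iUnion fun _ => hpre s).measurableSet
  · exact (isOpen_iUnion fun s => hpre s).measurableSet.compl

lemma measurable_loEnd {N : ℕ} {S : Set (Fin N → ℝ)} (hS : IsOpen S)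
    (hb : Bornology.IsBounded S) (i : Fin N) : Measurable (loEnd S i) := by
  apply measurable_of_Iio
  intro c
  have hpre : ∀ s : ℝ, IsOpen {x : Fin N → ℝ | Function.update x i s ∈ S} := fun s =>
    hS.preimage (by fun_prop)
  have e : loEnd S i ⁻¹' Set.Iio c = (⋃ s : ℝ, ⋃ _ : s < c, {x | Function.update x i s ∈ S}) ∪
      ((⋃ s : ℝ, {x | Function.update x i s ∈ S})ᶜ ∩ {_x | 0 < c}) := by
    ext x
    simp only [Set.mem_preimage, Set.mem_Iio, Set.mem_union, Set.mem_iUnion, Set.mem_ofPred_eq,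
      Set.mem_inter_iff, Set.mem_compl_iff, not_exists]
    by_cases hne : {s : ℝ | Function.update x i s ∈ S}.Nonempty
    · constructor
      · intro h
        obtain ⟨b, hb, h2⟩ := exists_lt_of_csInf_lt hne h
        exact Or.inl ⟨b, h2, hb⟩
      · rintro (⟨s, h1, h2⟩ | ⟨h1, _⟩)
        · exact (csInf_le (slice_bdd hb i x).bddBelow h2).trans_lt h1
        · exact absurd hne.some_mem (h1 _)
    · rw [Set.not_nonempty_iff_eq_empty] at hne
      have h' : ∀ s, Function.update x i s ∉ S := fun s hs => by
        have : s ∈ {s : ℝ | Function.update x i s ∈ S} := hs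
        rw [hne] at this; exact this
      simp [loEnd, h']
  rw [e]
  refine MeasurableSet.union ?_ (MeasurableSet.inter ?_ (MeasurableSet.const _))
  · exact (isOpen_iUnion fun s => isOpen_iUnion fun _ => hpre s).measurableSet
  · exact (isOpen_iUnion fun s => hpre s).measurableSet.compl

/-- The ground-state-transformed derivative in direction `i`. -/
def hDer {N : ℕ} (S : Set (Fin N → ℝ)) (U : (Fin N → ℝ) → ℝ) (dU : Fin N → (Fin N → ℝ) → ℝ)
    (i : Fin N) (x : Fin N → ℝ) : ℝ :=
  dU i x - (1/(x i - loEnd S i x) - 1/(hiEnd S i x - x i))/2 * U x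

/-- The quadratic remainder. -/
def Qrem {N : ℕ} (S : Set (Fin N → ℝ)) (U : (Fin N → ℝ) → ℝ) (dU : Fin N → (Fin N → ℝ) → ℝ)
    (x : Fin N → ℝ) : ℝ :=
  ∑ i, (hDer S U dU i x ^ 2 + 2 * U x ^ 2 / (hiEnd S i x - loEnd S i x) ^ 2)

lemma line_dichotomy {N : ℕ} {S K : Set (Fin N → ℝ)} (hS : IsOpen S)
    (hb : Bornology.IsBounded S) (hc : Convex ℝ S) (hK : IsCompact K) (hKS : K ⊆ S)
    {U : (Fin N → ℝ) → ℝ} (hU : ∀ x, x ∉ K → U x = 0) (i : Fin N) (x : Fin N → ℝ) :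
    (∀ t, U (Function.update x i t) = 0) ∨
    ∃ a1 b1, loEnd S i x < a1 ∧ a1 < b1 ∧ b1 < hiEnd S i x ∧
      ∀ t, t ∉ Set.Ioo a1 b1 → U (Function.update x i t) = 0 := by
  set T := {s : ℝ | Function.update x i s ∈ K} with hT
  by_cases hne : T.Nonempty
  · right
    have hTc : IsCompact T := by
      rw [Metric.isCompact_iff_isClosed_bounded]
      exact ⟨hK.isClosed.preimage (by fun_prop : Continuous fun s : ℝ => Function.update x i s),
        (slice_bdd hb i x).subset fun s hs => hKS hs⟩
    have hsl := slice_eq hS hb hc i x ⟨hne.some, hKS hne.some_mem⟩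
    have hsub : T ⊆ Set.Ioo (loEnd S i x) (hiEnd S i x) := fun s hs => by
      rw [← hsl]; exact hKS hs
    obtain ⟨m, hm, hm'⟩ := hTc.exists_isLeast hne
    obtain ⟨M, hM, hM'⟩ := hTc.exists_isGreatest hne
    have i1 := hsub hm
    have i2 := hsub hM
    have i3 := hm' hM
    refine ⟨(loEnd S i x + m)/2, (M + hiEnd S i x)/2, by linarith [i1.1], by linarith [i1.1, i2.2],
      by linarith [i2.2], fun t ht => hU _ fun htK => ht ?_⟩
    have j1 := hm' htK
    have j2 := hM' htK
    exact ⟨by linarith [i1.1], by linarith [i2.2]⟩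
  · left
    intro t
    exact hU _ fun h => hne ⟨t, h⟩


lemma line_hardy {N : ℕ} {S K : Set (Fin N → ℝ)}
    {U : (Fin N → ℝ) → ℝ} {dU : Fin N → (Fin N → ℝ) → ℝ}
    (hS : IsOpen S)
    (hb : Bornology.IsBounded S)
    (hc : Convex ℝ S)
    (hK : IsCompact K)
    (hKS : K ⊆ S)
    (hU : ∀ x, x ∉ K → U x = 0)
    (hd : ∀ i x t, HasDerivAt (fun s => U (Function.update x i s)) (dU i (Function.update x i t)) t)
    (hdc : ∀ i, Continuous (dU i))
    (i : Fin N) (x : Fin N → ℝ) :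
    ∫⁻ t : ℝ, (fun y => ENNReal.ofReal (hDer S U dU i y ^ 2
        + U y ^ 2 * (1/(y i - loEnd S i y) + 1/(hiEnd S i y - y i))^2/4)) (Function.update x i t) ≤
      ∫⁻ t : ℝ, (fun y => ENNReal.ofReal (dU i y ^ 2)) (Function.update x i t) := by
  simp only [hDer, loEnd_update, hiEnd_update, Function.update_self]
  have hdc' : Continuous fun t => dU i (Function.update x i t) :=
    (hdc i).comp (by fun_prop)
  rcases line_dichotomy hS hb hc hK hKS hU i x with h | ⟨a1, b1, h1, h2, h3, h0⟩
  · have : ∀ t, dU i (Function.update x i t) = 0 := fun t => by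
      have h2 := hd i x t
      simp only [h] at h2
      exact h2.unique (hasDerivAt_const t 0)
    simp [h, this]
  · exact oneD_hardy (hd i x) hdc' h1 h2 h3 h0

lemma line_sup {N : ℕ} {S K : Set (Fin N → ℝ)}
    {U : (Fin N → ℝ) → ℝ} {dU : Fin N → (Fin N → ℝ) → ℝ}
    (hS : IsOpen S)
    (hb : Bornology.IsBounded S)
    (hc : Convex ℝ S)
    (hK : IsCompact K)
    (hKS : K ⊆ S)
    (hU : ∀ x, x ∉ K → U x = 0)
    (hd : ∀ i x t, HasDerivAt (fun s => U (Function.update x i s)) (dU i (Function.update x i t)) t)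
    (hdc : ∀ i, Continuous (dU i))
    {p : ℝ} (hp : 2 ≤ p) (i : Fin N) (x : Fin N → ℝ) :
    ENNReal.ofReal (|U x| ^ p) ≤ ∫⁻ t : ℝ, (fun y => ENNReal.ofReal
      ((2*p+2) * |U y|^(p-1) * √(Qrem S U dU y))) (Function.update x i t) := by
  have hdc' : Continuous fun t => dU i (Function.update x i t) :=
    (hdc i).comp (by fun_prop)
  rcases line_dichotomy hS hb hc hK hKS hU i x with h | ⟨a1, b1, h1, h2, h3, h0⟩
  · have := h (x i)
    rw [Function.update_eq_self] at this
    simp [this, Real.zero_rpow (by linarith : p ≠ 0)]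
  · have h := oneD_sup (hd i x) hdc' h1 h2 h3 h0 hp (x i)
    rw [Function.update_eq_self] at h
    refine h.trans (lintegral_mono fun t => ?_)
    apply ENNReal.ofReal_le_ofReal
    set y := Function.update x i t with hy
    have e1 : hDer S U dU i y = dU i y - (1/(t - loEnd S i x) - 1/(hiEnd S i x - t))/2 * U y := by
      simp [hDer, hy, loEnd_update, hiEnd_update]
    have hQ : hDer S U dU i y ^ 2 + 2 * U y ^ 2 / (hiEnd S i y - loEnd S i y) ^ 2
        ≤ Qrem S U dU y := by
      unfold Qrem
      exact Finset.single_le_sum (f := fun i => hDer S U dU i y ^ 2 + 2 * U y ^ 2 /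
        (hiEnd S i y - loEnd S i y) ^ 2) (fun i _ => by positivity) (Finset.mem_univ i)
    rw [← e1]
    have eL : hiEnd S i y - loEnd S i y = hiEnd S i x - loEnd S i x := by
      simp [hy, loEnd_update, hiEnd_update]
    rw [eL] at hQ
    set L := hiEnd S i x - loEnd S i x with hL
    have hLpos : 0 < L := by linarith
    have q1 : |hDer S U dU i y| ≤ √(Qrem S U dU y) := by
      apply Real.le_sqrt_of_sq_le
      rw [sq_abs]
      have : 0 ≤ 2 * U y ^ 2 / L^2 := by positivity
      linarith
    have q2 : |U y| / L ≤ √(Qrem S U dU y) := by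
      apply Real.le_sqrt_of_sq_le
      rw [div_pow, sq_abs]
      have e : 2 * U y ^ 2 / L^2 = 2 * (U y ^ 2 / L^2) := by ring
      have : 0 ≤ U y ^ 2 / L^2 := by positivity
      nlinarith [sq_nonneg (hDer S U dU i y)]
    have e2 : |U y|^p = |U y|^(p-1) * |U y| := by
      rw [← Real.rpow_add_one' (abs_nonneg _) (by linarith)]; congr 1; ring
    rw [e2]
    have hX : 0 ≤ |U y|^(p-1) := by positivity
    have r1 := mul_le_mul_of_nonneg_left q1 hX
    have r2 := mul_le_mul_of_nonneg_left q2 hX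
    have r3 := mul_le_mul_of_nonneg_left r1 (by linarith : 0 ≤ p)
    have r4 := mul_le_mul_of_nonneg_left r2 (by linarith : 0 ≤ 2+p)
    have e3 : (2+p)/L * (|U y|^(p-1) * |U y|) = (2+p) * (|U y|^(p-1) * (|U y|/L)) := by ring
    rw [e3]
    linarith

lemma measurable_hDer {N : ℕ} {S : Set (Fin N → ℝ)}
    {U : (Fin N → ℝ) → ℝ} {dU : Fin N → (Fin N → ℝ) → ℝ}
    (hS : IsOpen S)
    (hb : Bornology.IsBounded S)
    (hUm : Measurable U) (hdm : ∀ i, Measurable (dU i)) (i : Fin N) :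
    Measurable (hDer S U dU i) := by
  unfold hDer
  have := measurable_loEnd hS hb i
  have := measurable_hiEnd hS hb i
  have h3 : Measurable fun x : Fin N → ℝ => x i := measurable_pi_apply i
  have := hdm i
  fun_prop

lemma measurable_Qrem {N : ℕ} {S : Set (Fin N → ℝ)}
    {U : (Fin N → ℝ) → ℝ} {dU : Fin N → (Fin N → ℝ) → ℝ}
    (hS : IsOpen S)
    (hb : Bornology.IsBounded S)
    (hUm : Measurable U) (hdm : ∀ i, Measurable (dU i)) :
    Measurable (Qrem S U dU) := by
  unfold Qrem
  refine Finset.measurable_sum _ fun i _ => ?_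
  have := measurable_loEnd hS hb i
  have := measurable_hiEnd hS hb i
  have := measurable_hDer hS hb hUm hdm i
  fun_prop

lemma total_hardy {N : ℕ} {S K : Set (Fin N → ℝ)}
    {U : (Fin N → ℝ) → ℝ} {dU : Fin N → (Fin N → ℝ) → ℝ}
    (hS : IsOpen S)
    (hb : Bornology.IsBounded S)
    (hc : Convex ℝ S)
    (hK : IsCompact K)
    (hKS : K ⊆ S)
    (hU : ∀ x, x ∉ K → U x = 0)
    (hd : ∀ i x t, HasDerivAt (fun s => U (Function.update x i s)) (dU i (Function.update x i t)) t)
    (hdc : ∀ i, Continuous (dU i))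
    (hUc : Continuous U) {D : (Fin N → ℝ) → ℝ}
    (hD : ∀ x ∈ S, 1 / D x ^ 2 ≤ ∑ i, ((1/(x i - loEnd S i x) + 1/(hiEnd S i x - x i))^2
      - 8/(hiEnd S i x - loEnd S i x)^2)) :
    (∫⁻ x, ENNReal.ofReal (Qrem S U dU x)) + ∫⁻ x, ENNReal.ofReal (U x ^ 2 / (4 * D x ^ 2)) ≤
      ∫⁻ x, ENNReal.ofReal (∑ i, dU i x ^ 2) := by
  have hUm := hUc.measurable
  have hdm := fun i => (hdc i).measurable
  have mQ := measurable_Qrem hS hb hUm hdm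
  have mF : ∀ i, Measurable fun y => ENNReal.ofReal (hDer S U dU i y ^ 2
        + U y ^ 2 * (1/(y i - loEnd S i y) + 1/(hiEnd S i y - y i))^2/4) := fun i => by
    have := measurable_loEnd hS hb i
    have := measurable_hiEnd hS hb i
    have := measurable_hDer hS hb hUm hdm i
    have h3 : Measurable fun x : Fin N → ℝ => x i := measurable_pi_apply i
    fun_prop
  have mG : ∀ i, Measurable fun y => ENNReal.ofReal (dU i y ^ 2) := fun i => by
    have := hdm i
    fun_prop
  calc _ = ∫⁻ x, (ENNReal.ofReal (Qrem S U dU x) + ENNReal.ofReal (U x ^ 2 / (4 * D x ^ 2))) :=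
        (lintegral_add_left (by fun_prop) _).symm
    _ ≤ ∫⁻ x, ∑ i, ENNReal.ofReal (hDer S U dU i x ^ 2
        + U x ^ 2 * (1/(x i - loEnd S i x) + 1/(hiEnd S i x - x i))^2/4) := by
        refine lintegral_mono fun x => ?_
        have hQ0 : 0 ≤ Qrem S U dU x := Finset.sum_nonneg fun i _ => by positivity
        rw [← ENNReal.ofReal_add hQ0 (by positivity), ← ENNReal.ofReal_sum_of_nonneg
          (fun i _ => by positivity)]
        apply ENNReal.ofReal_le_ofReal
        by_cases hx : x ∈ S
        · have h := mul_le_mul_of_nonneg_left (hD x hx) (by positivity : 0 ≤ U x ^2 / 4)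
          have e : U x ^ 2 / (4 * D x ^ 2) = U x ^ 2/4 * (1 / D x ^2) := by
            rw [div_mul_div_comm, mul_one]
          rw [e]
          refine (add_le_add_right h _).trans (le_of_eq ?_)
          rw [Qrem, Finset.mul_sum, ← Finset.sum_add_distrib]
          refine Finset.sum_congr rfl fun i _ => ?_
          ring
        · have : U x = 0 := hU x fun h => hx (hKS h)
          simp [Qrem, this]
    _ = ∑ i, ∫⁻ x, ENNReal.ofReal (hDer S U dU i x ^ 2
        + U x ^ 2 * (1/(x i - loEnd S i x) + 1/(hiEnd S i x - x i))^2/4) :=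
        lintegral_finsetSum _ fun i _ => mF i
    _ ≤ ∑ i, ∫⁻ x, ENNReal.ofReal (dU i x ^ 2) := by
        refine Finset.sum_le_sum fun i _ => ?_
        refine lintegral_le_of_lmarginal_le (μ := fun _ : Fin N => (volume : Measure ℝ)) {i}
          (mF i) (mG i) fun x => ?_
        rw [lmarginal_singleton, lmarginal_singleton]
        exact line_hardy hS hb hc hK hKS hU hd hdc i x
    _ = ∫⁻ x, ∑ i, ENNReal.ofReal (dU i x ^ 2) := (lintegral_finsetSum _ fun i _ => mG i).symm
    _ = _ := by
        congr 1; ext x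
        rw [ENNReal.ofReal_sum_of_nonneg (fun i _ => by positivity)]



lemma total_moser {N : ℕ} {S K : Set (Fin N → ℝ)}
    {U : (Fin N → ℝ) → ℝ} {dU : Fin N → (Fin N → ℝ) → ℝ}
    (hS : IsOpen S)
    (hb : Bornology.IsBounded S)
    (hc : Convex ℝ S)
    (hK : IsCompact K)
    (hKS : K ⊆ S)
    (hU : ∀ x, x ∉ K → U x = 0)
    (hd : ∀ i x t, HasDerivAt (fun s => U (Function.update x i s)) (dU i (Function.update x i t)) t)
    (hdc : ∀ i, Continuous (dU i))
    (hN : 2 ≤ N) (hUc : Continuous U) {p : ℝ}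
    (hp : p = 2 * (N + 2) * (N - 1) / (N:ℝ)^2)
    (hfin : ∫⁻ x, ENNReal.ofReal (|U x| ^ (2 * (1 + 2 / (N:ℝ)))) ≠ ⊤) :
    ∫⁻ x, ENNReal.ofReal (|U x| ^ (2 * (1 + 2 / (N:ℝ)))) ≤
      ENNReal.ofReal ((2*p+2)^2) * (∫⁻ x, ENNReal.ofReal (Qrem S U dU x)) *
        (∫⁻ x, ENNReal.ofReal (U x ^ 2)) ^ (2 / (N:ℝ)) := by
  have hUm := hUc.measurable
  have hdm := fun i => (hdc i).measurable
  have mQ := measurable_Qrem hS hb hUm hdm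
  have hn : (2:ℝ) ≤ N := by exact_mod_cast hN
  set n : ℝ := (N:ℝ) with hnN
  have hn0 : 0 < n := by linarith
  have hn1 : 0 < n - 1 := by linarith
  have hp2 : 2 ≤ p := by
    rw [hp, le_div_iff₀ (by positivity)]; nlinarith
  have hp0 : 0 < p := by linarith
  set s : ℝ := 2 * (1 + 2/n) with hs
  set I := ∫⁻ x, ENNReal.ofReal (Qrem S U dU x) with hI
  set A := ∫⁻ x, ENNReal.ofReal (|U x| ^ s) with hA
  set M := ∫⁻ x, ENNReal.ofReal (U x ^ 2) with hM
  set T := ∫⁻ x, ENNReal.ofReal (|U x| ^ (2*p-2)) with hT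
  set G : (Fin N → ℝ) → ENNReal := fun y => ENNReal.ofReal
      ((2*p+2) * |U y|^(p-1) * √(Qrem S U dU y)) with hG
  have mG : Measurable G := by
    simp only [hG]; fun_prop
  have hQ0 : ∀ x, 0 ≤ Qrem S U dU x := fun x => Finset.sum_nonneg fun i _ => by positivity
  -- grid lines
  have hcard : ((Fintype.card (Fin N) : ℕ) : ℝ) = n := by simp [hnN]
  have hconj : Real.HolderConjugate ((Fintype.card (Fin N) : ℕ) : ℝ) (n/(n-1)) := by
    rw [hcard, Real.holderConjugate_iff]
    refine ⟨by linarith, ?_⟩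
    field_simp; ring
  have step1 : A ≤ (∫⁻ x, G x) ^ (n/(n-1)) := by
    refine le_trans ?_ (lintegral_prod_lintegral_pow_le (fun _ : Fin N => (volume : Measure ℝ))
      hconj mG)
    refine lintegral_mono fun x => ?_
    rw [hcard]
    calc ENNReal.ofReal (|U x| ^ s)
        = ∏ i : Fin N, (ENNReal.ofReal (|U x| ^ p)) ^ (1 / (n-1)) := by
          rw [Finset.prod_const, Finset.card_univ, Fintype.card_fin,
            ENNReal.ofReal_rpow_of_nonneg (by positivity) (by positivity),
            ← ENNReal.ofReal_pow (by positivity), ← Real.rpow_mul (by positivity),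
            ← Real.rpow_natCast, ← Real.rpow_mul (by positivity)]
          congr 2
          rw [← hnN, hs, hp]
          field_simp
      _ ≤ _ := by
          refine Finset.prod_le_prod' fun i _ => ?_
          exact ENNReal.rpow_le_rpow (line_sup hS hb hc hK hKS hU hd hdc hp2 i x) (by positivity)
  -- Cauchy-Schwarz
  have step2 : ∫⁻ x, G x ≤ ENNReal.ofReal (2*p+2) * (T ^ (1/2:ℝ) * I ^ (1/2:ℝ)) := by
    have e : ∀ x, G x = ENNReal.ofReal (2*p+2) *
        (ENNReal.ofReal (|U x| ^ (2*p-2)) ^ (1/2:ℝ)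
          * ENNReal.ofReal (Qrem S U dU x) ^ (1/2:ℝ)) := fun x => by
      rw [ENNReal.ofReal_rpow_of_nonneg (by positivity) (by positivity),
        ENNReal.ofReal_rpow_of_nonneg (hQ0 x) (by positivity),
        ← ENNReal.ofReal_mul (by positivity), ← ENNReal.ofReal_mul (by positivity),
        ← Real.rpow_mul (by positivity), ← Real.sqrt_eq_rpow, ← mul_assoc]
      simp only [hG]
      congr 4
      ring
    simp_rw [e]
    rw [lintegral_const_mul' _ _ ENNReal.ofReal_ne_top]
    gcongr
    exact ENNReal.lintegral_mul_norm_pow_le (by fun_prop) (by fun_prop) (by norm_num)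
      (by norm_num) (by norm_num)
  -- interpolation
  have h2n : 0 ≤ 1 - 2/n := by
    rw [sub_nonneg, div_le_one hn0]; exact hn
  have step3 : T ≤ A ^ (1 - 2/n) * M ^ (2/n) := by
    have e : ∀ x, ENNReal.ofReal (|U x| ^ (2*p-2)) =
        ENNReal.ofReal (|U x| ^ s) ^ (1-2/n) * ENNReal.ofReal (U x ^ 2) ^ (2/n) := fun x => by
      rw [ENNReal.ofReal_rpow_of_nonneg (by positivity) h2n,
        ENNReal.ofReal_rpow_of_nonneg (by positivity) (by positivity),
        ← ENNReal.ofReal_mul (by positivity), ← Real.rpow_mul (by positivity), ← sq_abs (U x),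
        ← Real.rpow_natCast, ← Real.rpow_mul (by positivity),
        ← Real.rpow_add_of_nonneg (by positivity) (by positivity) (by positivity)]
      congr 2
      rw [hs, hp]
      push_cast
      field_simp
      ring
    rw [hT]
    simp_rw [e]
    exact ENNReal.lintegral_mul_norm_pow_le (by fun_prop) (by fun_prop) h2n
      (by positivity) (by ring)
  -- conclusion
  by_cases hA0 : A = 0
  · rw [hA0]; exact zero_le
  have hpow0 : A ^ (1 - 2/n) ≠ 0 := by
    intro h
    rcases ENNReal.rpow_eq_zero_iff.1 h with h | h
    · exact hA0 h.1
    · exact hfin h.1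
  have hpowT : A ^ (1 - 2/n) ≠ ⊤ := ENNReal.rpow_ne_top_of_nonneg h2n hfin
  rw [← ENNReal.mul_le_mul_iff_right hpow0 hpowT]
  calc A ^ (1 - 2/n) * A = A ^ (2 * ((n-1)/n)) := by
        nth_rewrite 2 [← ENNReal.rpow_one A]
        rw [← ENNReal.rpow_add _ _ hA0 hfin]
        congr 1; field_simp; ring
    _ ≤ ((∫⁻ x, G x) ^ (n/(n-1))) ^ (2 * ((n-1)/n)) :=
        ENNReal.rpow_le_rpow step1 (by positivity)
    _ = (∫⁻ x, G x) ^ (2:ℝ) := by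
        rw [← ENNReal.rpow_mul]; congr 1; field_simp
    _ ≤ (ENNReal.ofReal (2*p+2) * (T ^ (1/2:ℝ) * I ^ (1/2:ℝ))) ^ (2:ℝ) :=
        ENNReal.rpow_le_rpow step2 (by positivity)
    _ = ENNReal.ofReal ((2*p+2)^2) * (T * I) := by
        rw [ENNReal.mul_rpow_of_nonneg _ _ (by norm_num), ENNReal.mul_rpow_of_nonneg _ _ (by norm_num),
          ← ENNReal.rpow_mul, ← ENNReal.rpow_mul,
          ENNReal.ofReal_rpow_of_nonneg (by positivity) (by norm_num)]
        norm_num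
    _ ≤ ENNReal.ofReal ((2*p+2)^2) * (A ^ (1 - 2/n) * M ^ (2/n) * I) := by gcongr
    _ = _ := by ring


lemma dist_bound {N : ℕ} (hN : 2 ≤ N)
    (Ω : Set (EuclideanSpace ℝ (Fin N))) (hΩo : IsOpen Ω)
    (hΩb : Bornology.IsBounded Ω) (hΩcvx : Convex ℝ Ω) {S : Set (Fin N → ℝ)}
    (hS : S = {x | WithLp.toLp 2 x ∈ Ω}) (hSo : IsOpen S) (hSb : Bornology.IsBounded S)
    (hSc : Convex ℝ S) (x : Fin N → ℝ) (hx : x ∈ S) :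
    1 / bdist Ω (WithLp.toLp 2 x) ^ 2 ≤
      ∑ i, ((1/(x i - loEnd S i x) + 1/(hiEnd S i x - x i))^2
      - 8/(hiEnd S i x - loEnd S i x)^2) := by
  have hxΩ : WithLp.toLp 2 x ∈ Ω := by rw [hS] at hx; exact hx
  have : Nontrivial (EuclideanSpace ℝ (Fin N)) := by
    have : Nonempty (Fin N) := ⟨⟨0, by omega⟩⟩
    infer_instance
  have hne : (frontier Ω).Nonempty := by
    rw [nonempty_frontier_iff]
    refine ⟨⟨_, hxΩ⟩, fun h => ?_⟩
    rw [h] at hΩb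
    exact NormedSpace.unbounded_univ ℝ (EuclideanSpace ℝ (Fin N)) hΩb
  have hfc : IsCompact (frontier Ω) :=
    Metric.isCompact_of_isClosed_isBounded isClosed_frontier
      (hΩb.closure.subset frontier_subset_closure)
  obtain ⟨y, hy, hyd⟩ := hfc.exists_infDist_eq_dist hne (WithLp.toLp 2 x)
  have hyΩ : y ∉ Ω := by
    rw [hΩo.frontier_eq] at hy; exact hy.2
  obtain ⟨f, hf⟩ := geometric_hahn_banach_open_point hΩcvx hΩo hyΩ
  set d := bdist Ω (WithLp.toLp 2 x) with hdd
  have hd : d = ‖WithLp.toLp 2 x - y‖ := by rw [hdd, bdist, hyd, dist_eq_norm]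
  set ν := (InnerProductSpace.toDual ℝ (EuclideanSpace ℝ (Fin N))).symm f with hν
  have hfi : ∀ z, f z = inner ℝ ν z := fun z => by
    rw [hν, InnerProductSpace.toDual_symm_apply]
  have hfx := hf _ hxΩ
  have hν0 : ν ≠ 0 := by
    intro h
    rw [hfi, hfi, h] at hfx
    simp at hfx
  have hνpos : 0 < ‖ν‖ := norm_pos_iff.2 hν0
  have hdpos : 0 < d := by
    rw [hd, norm_pos_iff, sub_ne_zero]
    rintro h
    rw [h] at hxΩ; exact hyΩ hxΩ
  have hgap : f y - f (WithLp.toLp 2 x) ≤ ‖ν‖ * d := by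
    rw [← map_sub, hfi, hd, norm_sub_rev]
    exact real_inner_le_norm _ _
  have hsum : ∑ i, (ν i)^2 = ‖ν‖^2 := by
    rw [EuclideanSpace.norm_sq_eq]; simp
  have hterm : ∀ i, (ν i)^2 / (‖ν‖ * d)^2 ≤ (1/(x i - loEnd S i x) + 1/(hiEnd S i x - x i))^2
      - 8/(hiEnd S i x - loEnd S i x)^2 := by
    intro i
    have hsl := slice_eq hSo hSb hSc i x ⟨x i, by simpa using hx⟩
    have hmem : x i ∈ Set.Ioo (loEnd S i x) (hiEnd S i x) := by
      rw [← hsl]; simpa using hx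
    set α := x i - loEnd S i x with hα
    set β := hiEnd S i x - x i with hβ
    have hα0 : 0 < α := by rw [hα]; linarith [hmem.1]
    have hβ0 : 0 < β := by rw [hβ]; linarith [hmem.2]
    have hL : hiEnd S i x - loEnd S i x = α + β := by rw [hα, hβ]; ring
    -- linear bound along the slice
    have hlin : ∀ r, -α < r → r < β → r * ν i ≤ ‖ν‖ * d := by
      intro r h1 h2
      have hm : x i + r ∈ {s : ℝ | Function.update x i s ∈ S} := by
        rw [hsl]; exact ⟨by rw [hα] at h1; linarith, by rw [hβ] at h2; linarith⟩
      have hm' : WithLp.toLp 2 (Function.update x i (x i + r)) ∈ Ω := by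
        have : Function.update x i (x i + r) ∈ S := hm
        rw [hS] at this; exact this
      have e : WithLp.toLp 2 (Function.update x i (x i + r))
          = WithLp.toLp 2 x + r • EuclideanSpace.single i (1:ℝ) := by
        ext j
        by_cases h : j = i
        · subst h; simp
        · simp [h]
      have h3 := hf _ hm'
      rw [e, map_add, map_smul, hfi (EuclideanSpace.single i 1),
        EuclideanSpace.inner_single_right] at h3
      simp at h3
      linarith
    have hB : β * ν i ≤ ‖ν‖ * d := by
      by_contra hcon
      push Not at hcon
      have hνi : 0 < ν i := by
        by_contra h; push Not at h
        have : 0 < ‖ν‖ * d := by positivity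
        nlinarith
      have h0 : ‖ν‖ * d / ν i < β := by rwa [div_lt_iff₀ hνi]
      obtain ⟨r, hr1, hr2⟩ := exists_between h0
      have : 0 < ‖ν‖ * d / ν i := by positivity
      have h4 := hlin r (by linarith) hr2
      rw [div_lt_iff₀ hνi] at hr1
      linarith
    have hA : α * (-ν i) ≤ ‖ν‖ * d := by
      by_contra hcon
      push Not at hcon
      have hνi : 0 < -ν i := by
        by_contra h; push Not at h
        have : 0 < ‖ν‖ * d := by positivity
        nlinarith
      have h0 : ‖ν‖ * d / (-ν i) < α := by rwa [div_lt_iff₀ hνi]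
      obtain ⟨r, hr1, hr2⟩ := exists_between h0
      have : 0 < ‖ν‖ * d / (-ν i) := by positivity
      have h4 := hlin (-r) (by linarith) (by linarith)
      rw [div_lt_iff₀ hνi] at hr1
      linarith
    have hW : 0 < ‖ν‖ * d := by positivity
    have key : (ν i)^2 / (‖ν‖ * d)^2 ≤ (1/α)^2 + (1/β)^2 := by
      rcases le_total 0 (ν i) with h | h
      · have h5 : ν i / (‖ν‖ * d) ≤ 1/β := by
          rw [div_le_div_iff₀ hW hβ0]; linarith
        have h6 : (ν i / (‖ν‖ * d))^2 ≤ (1/β)^2 := pow_le_pow_left₀ (by positivity) h5 2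
        rw [div_pow] at h6
        have : 0 ≤ (1/α)^2 := by positivity
        linarith
      · have h5 : (-ν i) / (‖ν‖ * d) ≤ 1/α := by
          rw [div_le_div_iff₀ hW hα0]; linarith
        have h6 : ((-ν i) / (‖ν‖ * d))^2 ≤ (1/α)^2 :=
          pow_le_pow_left₀ (div_nonneg (by linarith) hW.le) h5 2
        rw [div_pow, neg_sq] at h6
        have : 0 ≤ (1/β)^2 := by positivity
        linarith
    have h8 : 8/(α+β)^2 ≤ 2 * (1/α) * (1/β) := by
      have : 2 * (1/α) * (1/β) = 2/(α*β) := by field_simp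
      rw [this, div_le_div_iff₀ (by positivity) (by positivity)]
      nlinarith [sq_nonneg (α-β)]
    rw [hL]
    nlinarith
  calc 1/d^2 = ∑ i, (ν i)^2 / (‖ν‖ * d)^2 := by
        rw [← Finset.sum_div, hsum]; field_simp
    _ ≤ _ := Finset.sum_le_sum fun i _ => hterm i

/-- Improved Hardy–Moser inequality on smooth bounded convex domains. -/
theorem improved_hardy_moser
    (N : ℕ) (hN : 2 ≤ N)
    (Ω : Set (EuclideanSpace ℝ (Fin N))) (hΩo : IsOpen Ω) (hΩconn : IsConnected Ω)
    (hΩb : Bornology.IsBounded Ω) (hΩsm : IsC2Domain Ω) (hΩcvx : Convex ℝ Ω) :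
    ∃ C : ℝ, 0 < C ∧
      ∀ u : EuclideanSpace ℝ (Fin N) → ℝ,
        ContDiff ℝ (⊤ : ℕ∞) u → HasCompactSupport u → tsupport u ⊆ Ω →
        C * ∫ x in Ω, |u x| ^ (2 * (1 + 2 / (N : ℝ))) ≤
          (∫ x in Ω, (‖gradient u x‖ ^ 2 - u x ^ 2 / (4 * bdist Ω x ^ 2))) *
            (∫ x in Ω, u x ^ 2) ^ (2 / (N : ℝ)) := by
  obtain ⟨p, hp⟩ : ∃ p : ℝ, p = 2 * (N + 2) * (N - 1) / (N:ℝ)^2 := ⟨_, rfl⟩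
  have hn : (2:ℝ) ≤ N := by exact_mod_cast hN
  have hp0 : 0 ≤ p := by
    rw [hp]
    have : (0:ℝ) ≤ N - 1 := by linarith
    positivity
  refine ⟨1/(2*p+2)^2, by positivity, ?_⟩
  intro u hu hucs hsupp
  have hmp : MeasurePreserving (WithLp.toLp 2 : (Fin N → ℝ) → EuclideanSpace ℝ (Fin N)) := PiLp.volume_preserving_toLp (Fin N)
  have hme : MeasurableEmbedding (WithLp.toLp 2 : (Fin N → ℝ) → EuclideanSpace ℝ (Fin N)) :=
    (MeasurableEquiv.toLp 2 (Fin N → ℝ)).measurableEmbedding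
  have hcl : Continuous (WithLp.toLp 2 : (Fin N → ℝ) → EuclideanSpace ℝ (Fin N)) := PiLp.continuous_toLp 2 _
  have hco : Continuous (WithLp.ofLp : EuclideanSpace ℝ (Fin N) → (Fin N → ℝ)) := PiLp.continuous_ofLp 2 _
  set S : Set (Fin N → ℝ) := {x | WithLp.toLp 2 x ∈ Ω} with hS
  set K : Set (Fin N → ℝ) := {x | WithLp.toLp 2 x ∈ tsupport u} with hKdef
  have hSo : IsOpen S := hΩo.preimage hcl
  have hK : IsCompact K := by
    have : K = WithLp.ofLp '' (tsupport u) := by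
      ext x
      constructor
      · intro h; exact ⟨WithLp.toLp 2 x, h, rfl⟩
      · rintro ⟨z, hz, rfl⟩; exact hz
    rw [this]
    exact hucs.isCompact.image hco
  have hSb : Bornology.IsBounded S := by
    have h1 : IsCompact (WithLp.ofLp '' (closure Ω)) := (hΩb.isCompact_closure).image hco
    exact h1.isBounded.subset fun x hx => ⟨WithLp.toLp 2 x, subset_closure hx, rfl⟩
  have hSc : Convex ℝ S := by
    intro x hx y hy a b ha hb hab
    exact hΩcvx hx hy ha hb hab
  have hKS : K ⊆ S := fun x hx => hsupp hx
  set U : (Fin N → ℝ) → ℝ := fun x => u (WithLp.toLp 2 x) with hUdef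
  have hUK : ∀ x, x ∉ K → U x = 0 := fun x hx =>
    image_eq_zero_of_notMem_tsupport (f := u) (x := WithLp.toLp 2 x) hx
  set dU : Fin N → (Fin N → ℝ) → ℝ := fun i x =>
    fderiv ℝ u (WithLp.toLp 2 x) (EuclideanSpace.single i 1) with hdU
  have huc : Continuous u := hu.continuous
  have hUc : Continuous U := huc.comp hcl
  have hud : Differentiable ℝ u := hu.differentiable (by simp)
  have hfd : Continuous (fderiv ℝ u) := hu.continuous_fderiv (by simp)
  have hdc : ∀ i, Continuous (dU i) := fun i => (hfd.comp hcl).clm_apply continuous_const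
  have hd : ∀ i x t, HasDerivAt (fun s => U (Function.update x i s))
      (dU i (Function.update x i t)) t := by
    intro i x t
    have h1 : HasDerivAt (fun s : ℝ => (WithLp.toLp 2 (Function.update x i s) : EuclideanSpace ℝ (Fin N)))
        (EuclideanSpace.single i (1:ℝ)) t := by
      have e : (fun s : ℝ => (WithLp.toLp 2 (Function.update x i s) : EuclideanSpace ℝ (Fin N))) =
          fun s => WithLp.toLp 2 (Function.update x i 0) + s • EuclideanSpace.single i (1:ℝ) := by
        ext s j
        by_cases h : j = i
        · subst h; simp
        · simp [h]
      rw [e]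
      have := ((hasDerivAt_id t).smul_const (EuclideanSpace.single i (1:ℝ) : EuclideanSpace ℝ (Fin N))).const_add
        (WithLp.toLp 2 (Function.update x i 0) : EuclideanSpace ℝ (Fin N))
      simpa using this
    exact (hud _).hasFDerivAt.comp_hasDerivAt t h1
  -- gradient
  have hgrad : ∀ x : Fin N → ℝ, ‖gradient u (WithLp.toLp 2 x)‖ ^ 2 = ∑ i, dU i x ^ 2 := by
    intro x
    rw [EuclideanSpace.norm_sq_eq]
    refine Finset.sum_congr rfl fun i _ => ?_
    have : dU i x = gradient u (WithLp.toLp 2 x) i := by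
      simp only [hdU]
      rw [← toDual_gradient, InnerProductSpace.toDual_apply_apply,
        EuclideanSpace.inner_single_right]
      simp
    rw [this, Real.norm_eq_abs, sq_abs]
  have hUz : ∀ x, x ∉ Ω → u x = 0 := fun x hx =>
    image_eq_zero_of_notMem_tsupport fun h => hx (hsupp h)
  have hgz : ∀ x, x ∉ Ω → gradient u x = 0 := fun x hx => by
    have : fderiv ℝ u x = 0 := by
      by_contra h
      exact hx (hsupp (support_fderiv_subset ℝ h))
    rw [gradient, this, map_zero]
  have hn0 : (0:ℝ) < N := by linarith
  have hs0 : 2 * (1 + 2 / (N:ℝ)) ≠ 0 := by positivity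
  -- transfer of integrals
  have tA : ∫ x in Ω, |u x| ^ (2 * (1 + 2 / (N : ℝ))) = ∫ x, |U x| ^ (2 * (1 + 2 / (N : ℝ))) := by
    rw [setIntegral_eq_integral_of_forall_compl_eq_zero
      (fun x hx => by rw [hUz x hx, abs_zero, Real.zero_rpow hs0])]
    exact (hmp.integral_comp hme _).symm
  have tM : ∫ x in Ω, u x ^ 2 = ∫ x, U x ^ 2 := by
    rw [setIntegral_eq_integral_of_forall_compl_eq_zero
      (fun x hx => by rw [hUz x hx]; simp)]
    exact (hmp.integral_comp hme _).symm
  set D : (Fin N → ℝ) → ℝ := fun x => bdist Ω (WithLp.toLp 2 x) with hDdef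
  have hDc : Continuous D := (Metric.continuous_infDist_pt _).comp hcl
  have tH : ∫ x in Ω, (‖gradient u x‖ ^ 2 - u x ^ 2 / (4 * bdist Ω x ^ 2))
      = ∫ x, ((∑ i, dU i x ^ 2) - U x ^ 2 / (4 * D x ^ 2)) := by
    rw [setIntegral_eq_integral_of_forall_compl_eq_zero
      (fun x hx => by rw [hUz x hx, hgz x hx]; simp)]
    rw [← hmp.integral_comp hme]
    simp only [hgrad, hUdef, hDdef]
  -- compact supports and integrability
  have csU : HasCompactSupport U := HasCompactSupport.intro hK hUK
  have iA : Integrable (fun x => |U x| ^ (2 * (1 + 2 / (N : ℝ)))) := by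
    apply Continuous.integrable_of_hasCompactSupport
    · exact hUc.abs.rpow_const fun _ => Or.inr (by positivity)
    · exact HasCompactSupport.intro hK fun x hx => by rw [hUK x hx, abs_zero, Real.zero_rpow hs0]
  have iM : Integrable (fun x => U x ^ 2) := by
    apply Continuous.integrable_of_hasCompactSupport (by fun_prop)
    exact HasCompactSupport.intro hK fun x hx => by rw [hUK x hx]; simp
  have iG : Integrable (fun x => ∑ i, dU i x ^ 2) := by
    apply Continuous.integrable_of_hasCompactSupport
    · exact continuous_finsetSum _ fun i _ => (hdc i).pow 2
    · refine HasCompactSupport.intro hK fun x hx => ?_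
      refine Finset.sum_eq_zero fun i _ => ?_
      have : fderiv ℝ u (WithLp.toLp 2 x) = 0 := by
        by_contra h
        exact hx (support_fderiv_subset ℝ h)
      simp [hdU, this]
  have hardy := total_hardy hSo hSb hSc hK hKS hUK hd hdc hUc (D := D)
    (fun x hx => dist_bound hN Ω hΩo hΩb hΩcvx hS hSo hSb hSc x hx)
  have eA := ofReal_integral_eq_lintegral_ofReal iA (ae_of_all _ fun x => by positivity)
  have eM := ofReal_integral_eq_lintegral_ofReal iM (ae_of_all _ fun x => by positivity)
  have eG := ofReal_integral_eq_lintegral_ofReal iG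
    (ae_of_all _ fun x => Finset.sum_nonneg fun i _ => by positivity)
  have moser := total_moser hSo hSb hSc hK hKS hUK hd hdc hN hUc hp
    (by rw [← eA]; exact ENNReal.ofReal_ne_top)
  set I := ∫⁻ x, ENNReal.ofReal (Qrem S U dU x) with hI
  set Hd := ∫⁻ x, ENNReal.ofReal (U x ^ 2 / (4 * D x ^ 2)) with hHd
  rw [← eG] at hardy
  have hsumfin : I + Hd ≠ ⊤ := (hardy.trans_lt ENNReal.ofReal_lt_top).ne
  have hIfin : I ≠ ⊤ := fun h => hsumfin (by rw [h]; simp)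
  have hHfin : Hd ≠ ⊤ := fun h => hsumfin (by rw [h]; simp)
  have iH : Integrable (fun x => U x ^ 2 / (4 * D x ^ 2)) := by
    refine ⟨?_, ?_⟩
    · have := hUc.measurable
      have := hDc.measurable
      exact Measurable.aestronglyMeasurable (by fun_prop)
    · rw [hasFiniteIntegral_iff_ofReal (ae_of_all _ fun x => by positivity)]
      exact lt_top_iff_ne_top.2 hHfin
  have eH := ofReal_integral_eq_lintegral_ofReal iH (ae_of_all _ fun x => by positivity)
  have hG0 : 0 ≤ ∫ x, ∑ i, dU i x ^ 2 :=
    integral_nonneg fun x => Finset.sum_nonneg fun i _ => by positivity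
  have hH0 : 0 ≤ ∫ x, U x ^ 2 / (4 * D x ^ 2) := integral_nonneg fun x => by positivity
  have hM0 : 0 ≤ ∫ x, U x ^ 2 := integral_nonneg fun x => by positivity
  have hA0 : 0 ≤ ∫ x, |U x| ^ (2 * (1 + 2 / (N : ℝ))) := integral_nonneg fun x => by positivity
  have hreal : I.toReal + ∫ x, U x ^ 2 / (4 * D x ^ 2) ≤ ∫ x, ∑ i, dU i x ^ 2 := by
    have h1 := ENNReal.toReal_mono ENNReal.ofReal_ne_top hardy
    rw [ENNReal.toReal_add hIfin hHfin, ENNReal.toReal_ofReal hG0, hHd, ← eH,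
      ENNReal.toReal_ofReal hH0] at h1
    exact h1
  have hmreal : ∫ x, |U x| ^ (2 * (1 + 2 / (N : ℝ))) ≤
      (2*p+2)^2 * I.toReal * (∫ x, U x ^ 2) ^ (2 / (N:ℝ)) := by
    rw [← eA, ← eM, ENNReal.ofReal_rpow_of_nonneg hM0 (by positivity)] at moser
    have h1 := ENNReal.toReal_mono (ENNReal.mul_ne_top
      (ENNReal.mul_ne_top ENNReal.ofReal_ne_top hIfin) ENNReal.ofReal_ne_top) moser
    rw [ENNReal.toReal_mul, ENNReal.toReal_mul, ENNReal.toReal_ofReal hA0,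
      ENNReal.toReal_ofReal (by positivity), ENNReal.toReal_ofReal (by positivity)] at h1
    exact h1
  rw [tA, tM, tH, integral_sub iG iH]
  have hc : 0 < (2*p+2)^2 := by positivity
  calc 1/(2*p+2)^2 * ∫ x, |U x| ^ (2 * (1 + 2 / (N : ℝ)))
      ≤ 1/(2*p+2)^2 * ((2*p+2)^2 * I.toReal * (∫ x, U x ^ 2) ^ (2 / (N:ℝ))) := by gcongr
    _ = I.toReal * (∫ x, U x ^ 2) ^ (2 / (N:ℝ)) := by field_simp
    _ ≤ _ := by
      apply mul_le_mul_of_nonneg_right _ (by positivity)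
      linarith
end
end

section
/- Let N ≥ 2 and let Ω ⊂ ℝ^N be a smooth bounded convex domain. Then there exists a constant K > 0 such that for every nonnegative u ∈ C₀^∞(Ω) with u not identically zero and every ε > 0, ∫_Ω u(x)² · log( u(x) / ( ‖u‖₂ · d(x)^{1/2} ) ) dx ≤ ε · ∫_Ω ( |∇u(x)|² − u(x)²/(4 d(x)²) ) dx + ( K − ((N+1)/4) · log ε ) · ‖u‖₂², where ‖u‖₂ := (∫_Ω u² dx)^{1/2}. -/
open MeasureTheory Real

noncomputable section

section Geometry
open Filter Topology

variable {E : Type*} [NormedAddCommGroup E] [InnerProductSpace ℝ E]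

lemma lsb_ball_subset {Ω : Set E} {x : E} (hx : x ∈ Ω) :
    Metric.ball x (Metric.infDist x (frontier Ω)) ⊆ Ω := by
  by_contra hcon
  obtain ⟨y, hy, hyΩ⟩ := Set.not_subset.1 hcon
  have hpos : 0 < Metric.infDist x (frontier Ω) := Metric.pos_of_mem_ball hy
  have hpre : IsPreconnected (Metric.ball x (Metric.infDist x (frontier Ω))) :=
    (convex_ball _ _).isPreconnected
  have hne : (Metric.ball x (Metric.infDist x (frontier Ω)) ∩ frontier Ω).Nonempty := by
    by_contra hem
    rw [Set.not_nonempty_iff_eq_empty] at hem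
    have hno : ∀ z ∈ Metric.ball x (Metric.infDist x (frontier Ω)), z ∉ frontier Ω := by
      intro z hz hzf
      exact (hem ▸ (⟨hz, hzf⟩ : z ∈ Metric.ball x (Metric.infDist x (frontier Ω)) ∩ frontier Ω) :
        z ∈ (∅ : Set E))
    obtain ⟨z, hz, hz1, hz2⟩ := hpre (interior Ω) (closure Ω)ᶜ isOpen_interior
      isClosed_closure.isOpen_compl
      (by
        intro z hz
        by_cases h1 : z ∈ closure Ω
        · left
          by_contra h2
          exact hno z hz ⟨h1, h2⟩
        · exact Or.inr h1)
      ⟨x, Metric.mem_ball_self hpos, by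
        by_contra h2
        exact hno x (Metric.mem_ball_self hpos) ⟨subset_closure hx, h2⟩⟩
      ⟨y, hy, fun h1 => hno y hy ⟨h1, fun h2 => hyΩ (interior_subset h2)⟩⟩
    exact hz2 (subset_closure (interior_subset hz1))
  obtain ⟨z, hz, hzf⟩ := hne
  have := Metric.infDist_le_dist_of_mem (x := x) hzf
  rw [Metric.mem_ball, dist_comm] at hz
  linarith

lemma lsb_le_infDist {Ω : Set E} (hΩ : IsOpen Ω) (hne : (frontier Ω).Nonempty) {z : E} {r : ℝ}
    (h : Metric.ball z r ⊆ Ω) : r ≤ Metric.infDist z (frontier Ω) := by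
  rw [Metric.le_infDist hne]
  intro y hy
  by_contra hlt
  push Not at hlt
  have : y ∈ Ω := h (by rw [Metric.mem_ball, dist_comm]; exact hlt)
  exact (hΩ.inter_frontier_eq ▸ (⟨this, hy⟩ : y ∈ Ω ∩ frontier Ω) : y ∈ (∅ : Set E))

lemma lsb_pos {Ω : Set E} (hΩ : IsOpen Ω) (hne : (frontier Ω).Nonempty) {x : E} (hx : x ∈ Ω) :
    0 < Metric.infDist x (frontier Ω) := by
  obtain ⟨r, hr, h⟩ := Metric.isOpen_iff.1 hΩ x hx
  exact hr.trans_le (lsb_le_infDist hΩ hne h)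

lemma lsb_concave {Ω : Set E} (hΩ : IsOpen Ω) (hc : Convex ℝ Ω) (hne : (frontier Ω).Nonempty) :
    ConcaveOn ℝ Ω (fun x => Metric.infDist x (frontier Ω)) := by
  refine ⟨hc, ?_⟩
  intro x hx y hy a b ha hb hab
  apply lsb_le_infDist hΩ hne
  intro z hz
  set p := Metric.infDist x (frontier Ω)
  set q := Metric.infDist y (frontier Ω)
  have hp : 0 < p := lsb_pos hΩ hne hx
  have hq : 0 < q := lsb_pos hΩ hne hy
  simp only [smul_eq_mul] at hz
  set s := a * p + b * q with hs
  have hspos : 0 < s := Metric.pos_of_mem_ball hz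
  set w := z - (a • x + b • y) with hw
  have hwn : ‖w‖ < s := by
    rw [Metric.mem_ball, dist_eq_norm] at hz; exact hz
  have h1 : x + (p / s) • w ∈ Ω := by
    apply lsb_ball_subset hx
    rw [Metric.mem_ball, dist_eq_norm, add_sub_cancel_left, norm_smul, Real.norm_of_nonneg (by positivity)]
    calc p / s * ‖w‖ < p / s * s := by gcongr
      _ = p := by field_simp
  have h2 : y + (q / s) • w ∈ Ω := by
    apply lsb_ball_subset hy
    rw [Metric.mem_ball, dist_eq_norm, add_sub_cancel_left, norm_smul, Real.norm_of_nonneg (by positivity)]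
    calc q / s * ‖w‖ < q / s * s := by gcongr
      _ = q := by field_simp
  have h3 := hc h1 h2 ha hb hab
  have : a • (x + (p / s) • w) + b • (y + (q / s) • w) = z := by
    have e : a * (p / s) + b * (q / s) = 1 := by field_simp; exact hs.symm
    calc a • (x + (p / s) • w) + b • (y + (q / s) • w)
        = (a • x + b • y) + (a * (p / s) + b * (q / s)) • w := by module
      _ = z := by rw [e, hw]; module
  rwa [this] at h3

lemma lsb_slope_le [CompleteSpace E] {f : E → ℝ} {x v : E} {c : ℝ} (hf : DifferentiableAt ℝ f x)
    (h : ∀ t ∈ Set.Ioo (0 : ℝ) 1, f (x + t • v) - f x ≤ t * c) :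
    inner ℝ (gradient f x) v ≤ c := by
  rw [inner_gradient_left]
  have h1 := (hf.hasFDerivAt.hasLineDerivAt v).tendsto_slope_zero_right
  refine le_of_tendsto h1 ?_
  filter_upwards [Ioo_mem_nhdsGT (show (0 : ℝ) < 1 by norm_num)] with t ht
  have := h t ht
  rw [smul_eq_mul, inv_mul_le_iff₀ ht.1]
  exact this

lemma lsb_le_slope [CompleteSpace E] {f : E → ℝ} {x v : E} {c : ℝ} (hf : DifferentiableAt ℝ f x)
    (h : ∀ t ∈ Set.Ioo (0 : ℝ) 1, t * c ≤ f (x + t • v) - f x) :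
    c ≤ inner ℝ (gradient f x) v := by
  rw [inner_gradient_left]
  have h1 := (hf.hasFDerivAt.hasLineDerivAt v).tendsto_slope_zero_right
  refine ge_of_tendsto h1 ?_
  filter_upwards [Ioo_mem_nhdsGT (show (0 : ℝ) < 1 by norm_num)] with t ht
  have := h t ht
  rw [smul_eq_mul, le_inv_mul_iff₀ ht.1]
  exact this

lemma lsb_grad_concave [CompleteSpace E] {Ω : Set E} (hΩ : IsOpen Ω) (hc : Convex ℝ Ω)
    (hne : (frontier Ω).Nonempty)
    {x x0 : E} (hx : x ∈ Ω) (hx0 : x0 ∈ Ω)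
    (hd : DifferentiableAt ℝ (fun x => Metric.infDist x (frontier Ω)) x) :
    Metric.infDist x0 (frontier Ω) - Metric.infDist x (frontier Ω) ≤
      inner ℝ (gradient (fun x => Metric.infDist x (frontier Ω)) x) (x0 - x) := by
  apply lsb_le_slope hd
  intro t ht
  have := (lsb_concave hΩ hc hne).2 hx hx0 (show 0 ≤ 1 - t by linarith [ht.2]) ht.1.le (by ring)
  simp only [smul_eq_mul] at this
  have e : (1 - t) • x + t • x0 = x + t • (x0 - x) := by module
  rw [e] at this
  linarith

lemma lsb_norm_grad [CompleteSpace E] [ProperSpace E] {Ω : Set E} (hΩ : IsOpen Ω)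
    (hne : (frontier Ω).Nonempty)
    {x : E} (hx : x ∈ Ω)
    (hd : DifferentiableAt ℝ (fun x => Metric.infDist x (frontier Ω)) x) :
    ‖gradient (fun x => Metric.infDist x (frontier Ω)) x‖ = 1 := by
  apply le_antisymm
  · have := norm_fderiv_le_of_lipschitz ℝ (Metric.lipschitz_infDist_pt (frontier Ω)) (x₀ := x)
    rw [← toDual_gradient, LinearIsometryEquiv.norm_map] at this
    simpa using this
  · obtain ⟨y, hy, hxy⟩ := isClosed_frontier.exists_infDist_eq_dist hne x
    have hpos := lsb_pos hΩ hne hx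
    have h := lsb_slope_le (v := y - x) (c := - dist x y) hd (by
      intro t ht
      have h1 := Metric.infDist_le_dist_of_mem (x := x + t • (y - x)) hy
      have h2 : dist (x + t • (y - x)) y = (1 - t) * dist x y := by
        rw [dist_eq_norm, dist_eq_norm, show x + t • (y - x) - y = (1 - t) • (x - y) by module,
          norm_smul, Real.norm_of_nonneg (by linarith [ht.2])]
      rw [hxy]
      linarith)
    have h3 := abs_real_inner_le_norm (gradient (fun x => Metric.infDist x (frontier Ω)) x) (y - x)
    have h4 := (abs_le.1 h3).1
    rw [hxy] at hpos
    rw [← dist_eq_norm, dist_comm] at h4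
    by_contra hlt
    push Not at hlt
    nlinarith
end Geometry


section Super
open Filter Topology

variable {E : Type*} [NormedAddCommGroup E] [InnerProductSpace ℝ E] [FiniteDimensional ℝ E]
  [MeasurableSpace E] [BorelSpace E]

lemma lsb_super_line {φ d : E → ℝ} {C D : NNReal} (hφ : LipschitzWith C φ) (hd : LipschitzWith D d)
    (hs : HasCompactSupport φ) (hnn : ∀ x, 0 ≤ φ x) {ρ : ℝ} (hρ : 0 < ρ)
    (hconc : ∀ x h, φ x ≠ 0 → ‖h‖ < ρ → d (x + h) + d (x - h) ≤ 2 * d x) (v : E) :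
    0 ≤ ∫ x, lineDeriv ℝ φ x v * lineDeriv ℝ d x v := by
  let K := Metric.cthickening (‖v‖) (tsupport φ)
  have hK : IsCompact K := hs.isCompact.cthickening
  have hlim : Tendsto (fun t : ℝ => ∫ x, (t⁻¹ • (φ (x + t • v) - φ x)) * (t⁻¹ • (d (x + t • v) - d x)))
      (𝓝[>] 0) (𝓝 (∫ x, lineDeriv ℝ φ x v * lineDeriv ℝ d x v)) := by
    apply tendsto_integral_filter_of_dominated_convergence
      (K.indicator (fun _ => (C * ‖v‖) * (D * ‖v‖)))
    · filter_upwards with t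
      have := hφ.continuous
      have := hd.continuous
      exact Continuous.aestronglyMeasurable (by fun_prop)
    · filter_upwards [Ioc_mem_nhdsGT (zero_lt_one' ℝ)] with t ht
      filter_upwards with x
      by_cases hx : x ∈ K
      · rw [Set.indicator_of_mem hx, norm_mul]
        have key : ∀ {f : E → ℝ} {c : NNReal}, LipschitzWith c f →
            ‖t⁻¹ • (f (x + t • v) - f x)‖ ≤ c * ‖v‖ := by
          intro f c hf
          rw [norm_smul, norm_inv, Real.norm_of_nonneg ht.1.le, inv_mul_le_iff₀ ht.1]
          calc ‖f (x + t • v) - f x‖ ≤ c * ‖x + t • v - x‖ := hf.norm_sub_le _ _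
            _ = t * (c * ‖v‖) := by
              rw [add_sub_cancel_left, norm_smul, Real.norm_of_nonneg ht.1.le]; ring
        exact mul_le_mul (key hφ) (key hd) (norm_nonneg _) (by positivity)
      · have A : φ x = 0 := by
          rw [← Function.notMem_support]
          contrapose! hx
          exact Metric.self_subset_cthickening _ (subset_tsupport _ hx)
        have B : φ (x + t • v) = 0 := by
          rw [← Function.notMem_support]
          contrapose! hx
          apply Metric.mem_cthickening_of_dist_le _ _ (‖v‖) (tsupport φ) (subset_tsupport _ hx)
          simp only [dist_eq_norm, sub_add_cancel_left, norm_neg, norm_smul, Real.norm_eq_abs,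
            abs_of_pos ht.1]
          exact mul_le_of_le_one_left (norm_nonneg _) ht.2
        simp only [B, A, sub_self, smul_zero, zero_mul, norm_zero]
        exact Set.indicator_nonneg (fun _ _ => by positivity) _
    · rw [integrable_indicator_iff hK.measurableSet]
      exact integrableOn_const hK.measure_lt_top.ne
    · filter_upwards [hφ.ae_lineDifferentiableAt v, hd.ae_lineDifferentiableAt v] with x h1 h2
      exact h1.hasLineDerivAt.tendsto_slope_zero_right.mul h2.hasLineDerivAt.tendsto_slope_zero_right
  refine ge_of_tendsto hlim ?_
  have hev : ∀ᶠ t : ℝ in 𝓝[>] 0, ‖t • v‖ < ρ := by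
    have : Tendsto (fun t : ℝ => ‖t • v‖) (𝓝 0) (𝓝 ‖(0 : ℝ) • v‖) :=
      (Continuous.tendsto (by fun_prop) _)
    rw [zero_smul, norm_zero] at this
    exact (this.mono_left nhdsWithin_le_nhds).eventually (gt_mem_nhds hρ)
  filter_upwards [hev] with t ht
  set h := t • v with hh
  have hφc := hφ.continuous
  have hdc := hd.continuous
  have i1 : Integrable (fun x => φ x * (d x - d (x - h))) :=
    (hφc.mul (by fun_prop)).integrable_of_hasCompactSupport hs.mul_right
  have i2 : Integrable (fun x => φ x * (d (x + h) - d x)) :=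
    (hφc.mul (by fun_prop)).integrable_of_hasCompactSupport hs.mul_right
  have i3 : Integrable (fun x => φ (x + h) * (d (x + h) - d x)) := by
    have := i1.comp_add_right h
    simpa using this
  have e3 : ∫ x, φ (x + h) * (d (x + h) - d x) = ∫ x, φ x * (d x - d (x - h)) := by
    have := integral_add_right_eq_self (μ := volume) (fun x => φ x * (d x - d (x - h))) h
    simpa using this
  have : ∫ x, (t⁻¹ • (φ (x + h) - φ x)) * (t⁻¹ • (d (x + h) - d x)) =
      t⁻¹ ^ 2 * ∫ x, φ x * (2 * d x - d (x - h) - d (x + h)) := by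
    calc _ = ∫ x, t⁻¹ ^ 2 * (φ (x + h) * (d (x + h) - d x) - φ x * (d (x + h) - d x)) := by
          congr 1; ext x; simp only [smul_eq_mul]; ring
      _ = t⁻¹ ^ 2 * ∫ x, (φ x * (d x - d (x - h)) - φ x * (d (x + h) - d x)) := by
          rw [integral_const_mul, integral_sub i3 i2, e3, ← integral_sub i1 i2]
      _ = _ := by congr 2; ext x; ring
  rw [this]
  apply mul_nonneg (by positivity)
  apply integral_nonneg
  intro x
  by_cases hx : φ x = 0
  · simp [hx]
  · apply mul_nonneg (hnn x)
    linarith [hconc x h hx ht]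

lemma lsb_meas_grad (f : E → ℝ) : Measurable (gradient f) := by
  have := measurable_fderiv ℝ f
  exact (InnerProductSpace.toDual ℝ E).symm.continuous.measurable.comp this

lemma lsb_norm_grad_le {f : E → ℝ} {C : NNReal} (hf : LipschitzWith C f) (x : E) :
    ‖gradient f x‖ ≤ C := by
  have := norm_fderiv_le_of_lipschitz ℝ hf (x₀ := x)
  rwa [← toDual_gradient, LinearIsometryEquiv.norm_map] at this

lemma lsb_grad_zero {f : E → ℝ} {x : E} (hx : x ∉ tsupport f) : gradient f x = 0 := by
  have : f =ᶠ[𝓝 x] fun _ => 0 := notMem_tsupport_iff_eventuallyEq.1 hx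
  rw [this.gradient_eq, gradient_fun_const]

lemma lsb_super {φ d : E → ℝ} {C D : NNReal} (hφ : LipschitzWith C φ) (hd : LipschitzWith D d)
    (hs : HasCompactSupport φ) (hnn : ∀ x, 0 ≤ φ x) {ρ : ℝ} (hρ : 0 < ρ)
    (hconc : ∀ x h, φ x ≠ 0 → ‖h‖ < ρ → d (x + h) + d (x - h) ≤ 2 * d x) :
    0 ≤ ∫ x, inner ℝ (gradient φ x) (gradient d x) := by
  let b := stdOrthonormalBasis ℝ E
  have e : ∀ x, inner ℝ (gradient φ x) (gradient d x) =
      ∑ i, inner ℝ (gradient φ x) (b i) * inner ℝ (b i) (gradient d x) :=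
    fun x => (b.sum_inner_mul_inner _ _).symm
  simp_rw [e]
  rw [integral_finsetSum]
  · apply Finset.sum_nonneg
    intro i _
    have := lsb_super_line hφ hd hs hnn hρ hconc (b i)
    convert! this using 1
    apply integral_congr_ae
    filter_upwards [hφ.ae_differentiableAt, hd.ae_differentiableAt] with x h1 h2
    rw [h1.lineDeriv_eq_fderiv, h2.lineDeriv_eq_fderiv, inner_gradient_left,
      real_inner_comm, inner_gradient_left]
  · intro i _
    have m1 := lsb_meas_grad φ
    have m2 := lsb_meas_grad d
    refine Integrable.mono' (g := (tsupport φ).indicator (fun _ => (C : ℝ) * D)) ?_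
      (Measurable.aestronglyMeasurable (by fun_prop)) ?_
    · rw [integrable_indicator_iff hs.isCompact.measurableSet]
      exact integrableOn_const hs.isCompact.measure_lt_top.ne
    · filter_upwards with x
      by_cases hx : x ∈ tsupport φ
      · rw [Set.indicator_of_mem hx, norm_mul]
        have n1 : ‖inner ℝ (gradient φ x) (b i)‖ ≤ C :=
          (norm_inner_le_norm _ _).trans (by simpa using lsb_norm_grad_le hφ x)
        have n2 : ‖inner ℝ (b i) (gradient d x)‖ ≤ D :=
          (norm_inner_le_norm _ _).trans (by simpa using lsb_norm_grad_le hd x)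
        exact mul_le_mul n1 n2 (norm_nonneg _) (by positivity)
      · rw [Set.indicator_of_notMem hx, lsb_grad_zero hx]
        simp
end Super


section Hardy
open Filter Topology

variable {E : Type*} [NormedAddCommGroup E] [InnerProductSpace ℝ E] [FiniteDimensional ℝ E]
  [MeasurableSpace E] [BorelSpace E]

lemma lsb_integrable_mul {Ω : Set E} (hΩ : IsOpen Ω) {f g : E → ℝ} (hf : Continuous f)
    (hs : HasCompactSupport f) (ht : tsupport f ⊆ Ω) (hg : ContinuousOn g Ω) :
    Integrable (fun x => f x * g x) := by
  have hc : Continuous (fun x => f x * g x) := by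
    apply ContinuousOn.continuous_of_tsupport_subset (hf.continuousOn.mul hg) hΩ
    exact (tsupport_mul_subset_left).trans ht
  exact hc.integrable_of_hasCompactSupport hs.mul_right

lemma lsb_lip_mul {f g : E → ℝ} {C D : NNReal} {a b : ℝ} (hf : LipschitzWith C f)
    (hg : LipschitzWith D g) (ha : ∀ x, |f x| ≤ a) (hb : ∀ x, |g x| ≤ b) :
    ∃ L, LipschitzWith L (fun x => f x * g x) := by
  refine ⟨Real.toNNReal (a * D + b * C), LipschitzWith.of_dist_le_mul ?_⟩
  intro x y
  have ha0 : 0 ≤ a := (abs_nonneg _).trans (ha x)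
  have hb0 : 0 ≤ b := (abs_nonneg _).trans (hb x)
  rw [Real.coe_toNNReal _ (by positivity), Real.dist_eq]
  have h1 := hf.dist_le_mul x y
  have h2 := hg.dist_le_mul x y
  rw [Real.dist_eq] at h1 h2
  calc |f x * g x - f y * g y| = |f x * (g x - g y) + g y * (f x - f y)| := by congr 1; ring
    _ ≤ |f x * (g x - g y)| + |g y * (f x - f y)| := abs_add_le _ _
    _ = |f x| * |g x - g y| + |g y| * |f x - f y| := by rw [abs_mul, abs_mul]
    _ ≤ a * (D * dist x y) + b * (C * dist x y) := by
      gcongr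
      · exact ha x
      · exact hb y
    _ = _ := by ring

lemma lsb_hardy {Ω : Set E} (hΩ : IsOpen Ω) (hcv : Convex ℝ Ω) (hne : (frontier Ω).Nonempty)
    {R : ℝ} (hR : 0 < R) (hdR : ∀ x ∈ Ω, Metric.infDist x (frontier Ω) ≤ R)
    {d : E → ℝ} (hd : d = fun x => Metric.infDist x (frontier Ω))
    {u : E → ℝ} (hu : ContDiff ℝ 1 u) (hs : HasCompactSupport u) (ht : tsupport u ⊆ Ω)
    {b : ℝ} (hb : b = 1 / (2 * R)) :
    Measurable (fun x => gradient u x - (u x * (1 / (2 * d x) - b)) • gradient d x) ∧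
    Integrable (fun x => ‖gradient u x - (u x * (1 / (2 * d x) - b)) • gradient d x‖ ^ 2) ∧
    (∫ x, ‖gradient u x - (u x * (1 / (2 * d x) - b)) • gradient d x‖ ^ 2)
      + b / 2 * (∫ x, u x ^ 2 / d x) ≤
      ∫ x, (‖gradient u x‖ ^ 2 - u x ^ 2 / (4 * d x ^ 2)) := by
  have hbpos : 0 < b := by rw [hb]; positivity
  have hdpos : ∀ x ∈ Ω, 0 < d x := fun x hx => by rw [hd]; exact lsb_pos hΩ hne hx
  have hdR' : ∀ x ∈ Ω, d x ≤ R := fun x hx => by rw [hd]; exact hdR x hx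
  have hdL : LipschitzWith 1 d := by rw [hd]; exact Metric.lipschitz_infDist_pt _
  have hdc := hdL.continuous
  have hconc : ConcaveOn ℝ Ω d := by rw [hd]; exact lsb_concave hΩ hcv hne
  have hgrad1 : ∀ x ∈ Ω, DifferentiableAt ℝ d x → ‖gradient d x‖ = 1 := by
    intro x hx hdx
    rw [hd] at hdx ⊢
    exact lsb_norm_grad hΩ hne hx hdx
  have huz : ∀ x, x ∉ tsupport u → u x = 0 := fun x hx => image_eq_zero_of_notMem_tsupport hx
  have hUz : ∀ x, x ∉ tsupport u → gradient u x = 0 := fun x hx => lsb_grad_zero hx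
  have hUc : Continuous (gradient u) := by
    have := hu.continuous_fderiv (by norm_num)
    exact (InnerProductSpace.toDual ℝ E).symm.continuous.comp this
  have huc := hu.continuous
  -- lower bound for the distance on the support
  obtain ⟨δ', hδ'pos, hδ'⟩ := hs.isCompact.exists_forall_le' hdc.continuousOn
    (a := 0) (fun x hx => hdpos x (ht hx))
  obtain ⟨δ, hδpos, hδ⟩ : ∃ δ > 0, ∀ x ∈ tsupport u, δ < d x :=
    ⟨δ' / 2, by positivity, fun x hx => by linarith [hδ' x hx]⟩
  set κ : E → ℝ := fun x => 1 / (2 * max (d x) δ) - b with hκ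
  have hm : ∀ x, δ ≤ max (d x) δ := fun x => le_max_right _ _
  have hκL : LipschitzWith (Real.toNNReal (1 / (2 * δ ^ 2))) κ := by
    apply LipschitzWith.of_dist_le_mul
    intro x y
    rw [Real.coe_toNNReal _ (by positivity), Real.dist_eq]
    have h1 : |max (d x) δ - max (d y) δ| ≤ dist x y := by
      have := (hdL.max_const δ).dist_le_mul x y
      simpa [Real.dist_eq] using this
    have hx := hm x
    have hy := hm y
    set p := max (d x) δ
    set q := max (d y) δ
    have hp : 0 < p := hδpos.trans_le hx
    have hq : 0 < q := hδpos.trans_le hy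
    have : κ x - κ y = (q - p) / (2 * (p * q)) := by
      simp only [hκ]; field_simp; ring
    rw [this, abs_div, abs_sub_comm, abs_of_pos (show 0 < 2 * (p * q) by positivity),
      div_mul_eq_mul_div, one_mul]
    have : δ ^ 2 ≤ p * q := by nlinarith
    gcongr
  have hκb : ∀ x, |κ x| ≤ 1 / (2 * δ) + b := by
    intro x
    have h1 : 0 ≤ 1 / (2 * max (d x) δ) := by have := hδpos.trans_le (hm x); positivity
    have h2 : 1 / (2 * max (d x) δ) ≤ 1 / (2 * δ) := by
      have := hm x
      gcongr
    rw [abs_le]; constructor <;> simp only [hκ] <;> linarith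
  have hu2 : ContDiff ℝ 1 (fun x => u x ^ 2) := hu.pow 2
  have hu2s : HasCompactSupport (fun x => u x ^ 2) := by
    simp_rw [pow_two]; exact hs.mul_right
  have hu2t : tsupport (fun x => u x ^ 2) ⊆ Ω := by
    refine subset_trans ?_ ht
    simp_rw [pow_two]; exact tsupport_mul_subset_left
  obtain ⟨Cu, hCu⟩ := ContDiff.lipschitzWith_of_hasCompactSupport hu2s hu2 (by norm_num)
  obtain ⟨au, hau⟩ := hu2s.exists_bound_of_continuous hu2.continuous
  obtain ⟨Lφ, hLφ⟩ := lsb_lip_mul hCu hκL hau hκb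
  set φ : E → ℝ := fun x => u x ^ 2 * κ x with hφ
  have hφs : HasCompactSupport φ := hu2s.mul_right
  have hκeq : ∀ x ∈ tsupport u, κ x = 1 / (2 * d x) - b := by
    intro x hx
    simp only [hκ]
    rw [max_eq_left (hδ x hx).le]
  have hknn : ∀ x ∈ Ω, 0 ≤ 1 / (2 * d x) - b := by
    intro x hx
    have h1 := hdpos x hx
    have h2 := hdR' x hx
    rw [hb, sub_nonneg]
    gcongr
  have hφnn : ∀ x, 0 ≤ φ x := by
    intro x
    by_cases hx : x ∈ tsupport u
    · simp only [hφ]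
      rw [hκeq x hx]
      exact mul_nonneg (sq_nonneg _) (hknn x (ht hx))
    · simp [hφ, huz x hx]
  obtain ⟨ρ, hρ, hρΩ⟩ := hs.isCompact.exists_thickening_subset_open hΩ ht
  have hI := lsb_super hLφ hdL hφs hφnn hρ (by
    intro x h hx hh
    have hxs : x ∈ tsupport u := by
      by_contra hxs
      exact hx (by simp [hφ, huz x hxs])
    have hmem : ∀ h : E, ‖h‖ < ρ → x + h ∈ Ω := by
      intro h hh
      apply hρΩ
      rw [Metric.mem_thickening_iff]
      exact ⟨x, hxs, by simpa [dist_eq_norm] using hh⟩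
    have h1 := hmem h hh
    have h2 := hmem (-h) (by simpa using hh)
    have := hconc.2 h1 h2 (show (0 : ℝ) ≤ 1 / 2 by norm_num) (show (0 : ℝ) ≤ 1 / 2 by norm_num)
      (by norm_num)
    have e : (1 / 2 : ℝ) • (x + h) + (1 / 2 : ℝ) • (x + -h) = x := by module
    rw [e, ← sub_eq_add_neg] at this
    simp only [smul_eq_mul] at this
    linarith)
  have hIeq : (fun x => inner ℝ (gradient φ x) (gradient d x)) =ᵐ[volume] fun x =>
      2 * (u x * (1 / (2 * d x) - b)) * inner ℝ (gradient u x) (gradient d x)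
        - u x ^ 2 / (2 * d x ^ 2) := by
    filter_upwards [hdL.ae_differentiableAt] with x hdx
    by_cases hx : x ∈ tsupport u
    · have hxd := hdpos x (ht hx)
      have hev : φ =ᶠ[𝓝 x] fun y => u y ^ 2 * ((2 * d y)⁻¹ - b) := by
        have : ∀ᶠ y in 𝓝 x, δ < d y := hdc.continuousAt.eventually (lt_mem_nhds (hδ x hx))
        filter_upwards [this] with y hy
        simp only [hφ, hκ]
        rw [max_eq_left hy.le, one_div]
      have hux : DifferentiableAt ℝ u x := hu.differentiable (by norm_num) x
      have hfd := (hux.hasFDerivAt.pow 2).mul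
        (((hasFDerivAt_inv (show 2 * d x ≠ 0 by positivity)).comp x
          (hdx.hasFDerivAt.const_mul 2)).sub_const b)
      have hfd' := hfd.congr_of_eventuallyEq hev
      have hG : fderiv ℝ d x (gradient d x) = 1 := by
        rw [← inner_gradient_left, real_inner_self_eq_norm_sq, hgrad1 x (ht hx) hdx]; norm_num
      rw [inner_gradient_left, hfd'.fderiv, inner_gradient_left]
      simp [hG]
      field_simp
      ring
    · rw [show gradient φ x = 0 from lsb_grad_zero fun h => hx ?_]
      · simp [huz x hx]
      · have : tsupport φ ⊆ tsupport u := by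
          have h1 : tsupport φ ⊆ tsupport (fun x => u x ^ 2) := tsupport_mul_subset_left
          refine h1.trans ?_
          simp_rw [pow_two]; exact tsupport_mul_subset_left
        exact this h
  have hinvc : ContinuousOn (fun x => (d x)⁻¹) Ω :=
    hdc.continuousOn.inv₀ (fun x hx => (hdpos x hx).ne')
  have mG := lsb_meas_grad d
  have hGle : ∀ x, ‖gradient d x‖ ≤ 1 := fun x => by simpa using lsb_norm_grad_le hdL x
  -- integrability
  have i1 : Integrable (fun x => u x ^ 2 / (4 * d x ^ 2)) := by
    have := lsb_integrable_mul hΩ hu2.continuous hu2s hu2t (g := fun x => (1 / 4) * ((d x)⁻¹) ^ 2)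
      (by fun_prop)
    refine this.congr (.of_forall fun x => ?_)
    simp only; rw [div_eq_mul_inv (u x ^ 2), mul_inv]; ring
  have i2 : Integrable (fun x => u x ^ 2 / d x) := by
    have := lsb_integrable_mul hΩ hu2.continuous hu2s hu2t (g := fun x => ((d x)⁻¹))
      (by fun_prop)
    refine this.congr (.of_forall fun x => ?_)
    simp only; rw [div_eq_mul_inv]
  have iU : Integrable (fun x => ‖gradient u x‖ ^ 2) := by
    apply Continuous.integrable_of_hasCompactSupport (by fun_prop)
    apply HasCompactSupport.intro hs.isCompact
    intro x hx
    simp [hUz x hx]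
  have hukc : Continuous (fun x => u x * (1 / (2 * d x) - b)) := by
    apply ContinuousOn.continuous_of_tsupport_subset _ hΩ ((tsupport_mul_subset_left).trans ht)
    refine huc.continuousOn.mul (ContinuousOn.congr (f := fun x => (1 / 2) * (d x)⁻¹ - b)
      (by fun_prop) ?_)
    intro x hx
    simp only; rw [one_div, mul_inv]; norm_num
  have iq : Integrable (fun x => 2 * (u x * (1 / (2 * d x) - b)) *
      inner ℝ (gradient u x) (gradient d x)) := by
    refine Integrable.mono' (g := fun x => 2 * |u x * (1 / (2 * d x) - b)| * ‖gradient u x‖) ?_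
      ?_ ?_
    · apply Continuous.integrable_of_hasCompactSupport (by fun_prop)
      apply HasCompactSupport.intro hs.isCompact
      intro x hx
      simp [hUz x hx]
    · have m1 := hukc.measurable
      have m2 := hUc.measurable
      exact ((m1.const_mul 2).mul (m2.inner mG)).aestronglyMeasurable
    · filter_upwards with x
      rw [norm_mul, norm_mul, Real.norm_eq_abs, Real.norm_eq_abs, abs_two]
      gcongr
      calc ‖inner ℝ (gradient u x) (gradient d x)‖ ≤ ‖gradient u x‖ * ‖gradient d x‖ :=
            norm_inner_le_norm _ _
        _ ≤ ‖gradient u x‖ * 1 := by gcongr; exact hGle x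
        _ = _ := mul_one _
  have iY : Integrable
      (fun x => ‖gradient u x - (u x * (1 / (2 * d x) - b)) • gradient d x‖ ^ 2) := by
    refine Integrable.mono' (g := fun x => (‖gradient u x‖ + |u x * (1 / (2 * d x) - b)|) ^ 2) ?_
      ?_ ?_
    · apply Continuous.integrable_of_hasCompactSupport (by fun_prop)
      apply HasCompactSupport.intro hs.isCompact
      intro x hx
      simp [hUz x hx, huz x hx]
    · have m1 := hukc.measurable
      have m2 := hUc.measurable
      exact ((m2.sub (m1.smul mG)).norm.pow_const 2).aestronglyMeasurable
    · filter_upwards with x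
      rw [norm_pow, norm_norm]
      gcongr
      calc ‖gradient u x - (u x * (1 / (2 * d x) - b)) • gradient d x‖
          ≤ ‖gradient u x‖ + ‖(u x * (1 / (2 * d x) - b)) • gradient d x‖ := norm_sub_le _ _
        _ ≤ _ := by
          rw [norm_smul, Real.norm_eq_abs]
          gcongr
          exact mul_le_of_le_one_right (abs_nonneg _) (hGle x)
  refine ⟨hUc.measurable.sub (hukc.measurable.smul mG), iY, ?_⟩
  have i3 : Integrable (fun x => u x ^ 2 / (2 * d x ^ 2)) := by
    refine (i1.const_mul 2).congr (.of_forall fun x => ?_)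
    simp only; rw [div_eq_mul_inv, div_eq_mul_inv, mul_inv, mul_inv]; ring
  rw [integral_congr_ae hIeq] at hI
  rw [← integral_const_mul, ← integral_add iY (i2.const_mul _)]
  have j0 : Integrable (fun x => ‖gradient u x - (u x * (1 / (2 * d x) - b)) • gradient d x‖ ^ 2
      + b / 2 * (u x ^ 2 / d x)) := iY.add (i2.const_mul _)
  have j1 : Integrable (fun x => ‖gradient u x‖ ^ 2 - u x ^ 2 / (4 * d x ^ 2)) := iU.sub i1
  have j2 : Integrable (fun x =>
      2 * (u x * (1 / (2 * d x) - b)) * inner ℝ (gradient u x) (gradient d x)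
        - u x ^ 2 / (2 * d x ^ 2)) := iq.sub i3
  have key : ∫ x, (‖gradient u x - (u x * (1 / (2 * d x) - b)) • gradient d x‖ ^ 2
      + b / 2 * (u x ^ 2 / d x)) ≤
      ∫ x, ((‖gradient u x‖ ^ 2 - u x ^ 2 / (4 * d x ^ 2)) -
        (2 * (u x * (1 / (2 * d x) - b)) * inner ℝ (gradient u x) (gradient d x)
        - u x ^ 2 / (2 * d x ^ 2))) := by
    refine integral_mono_ae j0 (j1.sub j2) ?_
    filter_upwards [hdL.ae_differentiableAt] with x hdx
    by_cases hx : x ∈ tsupport u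
    · have hxd := hdpos x (ht hx)
      have hxR := hdR' x (ht hx)
      have hbd : b ≤ 1 / (2 * d x) := by linarith [hknn x (ht hx)]
      rw [norm_sub_sq_real, norm_smul, inner_smul_right, hgrad1 x (ht hx) hdx, mul_one,
        Real.norm_eq_abs, sq_abs]
      have e : ‖gradient u x‖ ^ 2 - u x ^ 2 / (4 * d x ^ 2) -
        (2 * (u x * (1 / (2 * d x) - b)) * inner ℝ (gradient u x) (gradient d x)
          - u x ^ 2 / (2 * d x ^ 2)) - (‖gradient u x‖ ^ 2
        - 2 * (u x * (1 / (2 * d x) - b) * inner ℝ (gradient u x) (gradient d x))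
        + (u x * (1 / (2 * d x) - b)) ^ 2 + b / 2 * (u x ^ 2 / d x)) =
          u x ^ 2 * b * (1 / (2 * d x) - b) := by
        field_simp
        ring
      have : 0 ≤ u x ^ 2 * b * (1 / (2 * d x) - b) :=
        mul_nonneg (by positivity) (by linarith)
      linarith
    · simp [hUz x hx, huz x hx]
  rw [integral_sub j1 j2] at key
  linarith
end Hardy


section Estimates
open Filter Topology

variable {E : Type*} [NormedAddCommGroup E] [InnerProductSpace ℝ E] [FiniteDimensional ℝ E]
  [MeasurableSpace E] [BorelSpace E]

lemma lsb_field {u : E → ℝ} (hu : ContDiff ℝ 1 u) (hs : HasCompactSupport u) (x0 : E) :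
    ∫ x, u x * inner ℝ (gradient u x) (x0 - x) = (Module.finrank ℝ E : ℝ) / 2 * ∫ x, u x ^ 2 := by
  let b := stdOrthonormalBasis ℝ E
  have hUc : Continuous (gradient u) := by
    have := hu.continuous_fderiv (by norm_num)
    exact (InnerProductSpace.toDual ℝ E).symm.continuous.comp this
  have huc := hu.continuous
  have hud : Differentiable ℝ u := hu.differentiable (by norm_num)
  have hz : ∀ x, x ∉ tsupport u → u x = 0 := fun x hx => image_eq_zero_of_notMem_tsupport hx
  have hintg : ∀ g : E → ℝ, Continuous g → Integrable (fun x => u x * g x) := fun g hg =>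
    (huc.mul hg).integrable_of_hasCompactSupport hs.mul_right
  have e : ∀ x, u x * inner ℝ (gradient u x) (x0 - x) =
      ∑ i, u x * (inner ℝ (gradient u x) (b i) * inner ℝ (b i) (x0 - x)) := by
    intro x
    rw [← Finset.mul_sum, b.sum_inner_mul_inner]
  simp_rw [e]
  rw [integral_finsetSum _ (fun i _ => hintg _ (by fun_prop))]
  have h1 : ∀ i, ∫ x, u x * (inner ℝ (gradient u x) (b i) * inner ℝ (b i) (x0 - x)) =
      1 / 2 * ∫ x, u x ^ 2 := by
    intro i
    have fd1 : ∀ x, fderiv ℝ (fun x => u x ^ 2) x (b i) = 2 * u x * inner ℝ (gradient u x) (b i) := by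
      intro x
      have := ((hud x).hasFDerivAt.pow 2).fderiv
      rw [inner_gradient_left]
      rw [this]; simp
    have fd2 : ∀ x, fderiv ℝ (fun x => (inner ℝ (b i) (x0 - x) : ℝ)) x (b i) = -1 := by
      intro x
      have h : HasFDerivAt (fun x => (inner ℝ (b i) (x0 - x) : ℝ)) (-(innerSL ℝ (b i))) x := by
        have := (innerSL ℝ (b i)).hasFDerivAt.comp x ((hasFDerivAt_id x).const_sub x0)
        simpa [Function.comp_def, ContinuousLinearMap.comp_neg] using this
      rw [h.fderiv]; simp
    have ibp := integral_mul_fderiv_eq_neg_fderiv_mul_of_integrable (μ := (volume : Measure E))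
      (f := fun x => u x ^ 2) (g := fun x => (inner ℝ (b i) (x0 - x) : ℝ)) (v := b i)
      (by
        simp_rw [fd1]
        refine (hintg (fun x => 2 * inner ℝ (gradient u x) (b i) * inner ℝ (b i) (x0 - x))
          (by fun_prop)).congr (.of_forall fun x => ?_)
        simp only; ring)
      (by
        simp_rw [fd2]
        refine (hintg (fun x => u x * (-1)) (by fun_prop)).congr (.of_forall fun x => ?_)
        simp only; ring)
      (by
        refine (hintg (fun x => u x * inner ℝ (b i) (x0 - x)) (by fun_prop)).congr
          (.of_forall fun x => ?_)
        simp only; ring)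
      (fun x _ => (hud x).pow 2)
      (fun x _ => ((differentiableAt_const _).inner ℝ ((differentiableAt_const x0).sub differentiableAt_id)))
    simp_rw [fd1, fd2] at ibp
    rw [integral_mul_const] at ibp
    have : ∫ x, 2 * u x * inner ℝ (gradient u x) (b i) * inner ℝ (b i) (x0 - x) =
        2 * ∫ x, u x * (inner ℝ (gradient u x) (b i) * inner ℝ (b i) (x0 - x)) := by
      rw [← integral_const_mul]; congr 1; ext x; ring
    rw [this] at ibp
    linarith
  simp_rw [h1]
  simp
  ring

set_option maxHeartbeats 1000000 in
lemma lsb_estimates {Ω : Set E} (hΩ : IsOpen Ω) (hcv : Convex ℝ Ω) (hne : (frontier Ω).Nonempty)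
    (hbd : Bornology.IsBounded Ω) {x0 : E} (hx0 : x0 ∈ Ω)
    {d : E → ℝ} (hd : d = fun x => Metric.infDist x (frontier Ω)) :
    ∃ C : ℝ, 0 < C ∧ ∀ u : E → ℝ, ContDiff ℝ 1 u → HasCompactSupport u → tsupport u ⊆ Ω →
      (∀ x, 0 ≤ u x) → 0 < ∫ x, u x ^ 2 →
      0 < (∫ x, (‖gradient u x‖ ^ 2 - u x ^ 2 / (4 * d x ^ 2))) ∧
      (∫ x, u x ^ 2 / d x) ≤
        C * √((∫ x, (‖gradient u x‖ ^ 2 - u x ^ 2 / (4 * d x ^ 2))) * ∫ x, u x ^ 2) ∧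
      (∫ x, u x * ‖gradient u x‖) ≤
        C * √((∫ x, (‖gradient u x‖ ^ 2 - u x ^ 2 / (4 * d x ^ 2))) * ∫ x, u x ^ 2) := by
  obtain ⟨R, hRpos, hRb⟩ := hbd.exists_pos_norm_le
  obtain ⟨z, hz⟩ := hne
  have hne : (frontier Ω).Nonempty := ⟨z, hz⟩
  have hzR : ‖z‖ ≤ R := by
    have : closure Ω ⊆ Metric.closedBall 0 R :=
      closure_minimal (fun x hx => by simpa using hRb x hx) Metric.isClosed_closedBall
    simpa using this (frontier_subset_closure hz)
  set D := 2 * R with hD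
  have hDpos : 0 < D := by positivity
  have hdD : ∀ x ∈ Ω, Metric.infDist x (frontier Ω) ≤ D := by
    intro x hx
    refine (Metric.infDist_le_dist_of_mem hz).trans ?_
    rw [dist_eq_norm]
    linarith [norm_sub_le x z, hRb x hx]
  have hxD : ∀ x ∈ Ω, ‖x0 - x‖ ≤ D := by
    intro x hx
    linarith [norm_sub_le x0 x, hRb x hx, hRb x0 hx0]
  have hdD' : ∀ x ∈ Ω, d x ≤ D := fun x hx => by rw [hd]; exact hdD x hx
  have hdpos : ∀ x ∈ Ω, 0 < d x := fun x hx => by rw [hd]; exact lsb_pos hΩ hne hx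
  have hdL : LipschitzWith 1 d := by rw [hd]; exact Metric.lipschitz_infDist_pt _
  have hdc := hdL.continuous
  set n := (Module.finrank ℝ E : ℝ) with hn
  have hn0 : 0 ≤ n := by positivity
  set r := d x0 with hr
  have hrpos : 0 < r := hdpos x0 hx0
  obtain ⟨b, hb⟩ : ∃ b : ℝ, b = 1 / (2 * D) := ⟨_, rfl⟩
  have hbpos : 0 < b := by rw [hb]; positivity
  set C2 := (2 / r) * ((n / 2 + 1 / 2 + b * r) * (2 * D) + D) with hC2
  have hC2pos : 0 < C2 := by positivity
  refine ⟨1 + C2, by positivity, ?_⟩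
  intro u hu hs ht hu0 hBpos
  obtain ⟨mY, iY, hH⟩ := lsb_hardy hΩ hcv hne hDpos hdD hd hu hs ht hb
  have hF := lsb_field hu hs x0
  have hUc : Continuous (gradient u) := by
    have := hu.continuous_fderiv (by norm_num)
    exact (InnerProductSpace.toDual ℝ E).symm.continuous.comp this
  have huc := hu.continuous
  have huz : ∀ x, x ∉ tsupport u → u x = 0 := fun x hx => image_eq_zero_of_notMem_tsupport hx
  have hUz : ∀ x, x ∉ tsupport u → gradient u x = 0 := fun x hx => lsb_grad_zero hx
  set Y : E → E := fun x => gradient u x - (u x * (1 / (2 * d x) - b)) • gradient d x with hY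
  set A := ∫ x, (‖gradient u x‖ ^ 2 - u x ^ 2 / (4 * d x ^ 2)) with hA
  set B := ∫ x, u x ^ 2 with hB
  set Q := ∫ x, u x ^ 2 / d x with hQ
  have hintg : ∀ g : E → ℝ, ContinuousOn g Ω → Integrable (fun x => u x * g x) := fun g hg =>
    lsb_integrable_mul hΩ huc hs ht hg
  have hinvc : ContinuousOn (fun x => (d x)⁻¹) Ω :=
    hdc.continuousOn.inv₀ (fun x hx => (hdpos x hx).ne')
  have iB : Integrable (fun x => u x ^ 2) :=
    (hintg u (by fun_prop)).congr (.of_forall fun x => by simp only; ring)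
  have iQ : Integrable (fun x => u x ^ 2 / d x) :=
    (hintg (fun x => u x * (d x)⁻¹) (by fun_prop)).congr (.of_forall fun x => by simp only; ring)
  have iF : Integrable (fun x => u x * inner ℝ (gradient u x) (x0 - x)) :=
    hintg _ (by fun_prop)
  have iM : Integrable (fun x => u x * ‖gradient u x‖) := hintg _ (by fun_prop)
  have iT : Integrable (fun x => u x * ‖Y x‖) := by
    refine (iB.add iY).mono' (huc.measurable.mul mY.norm).aestronglyMeasurable ?_
    filter_upwards with x
    rw [norm_mul, norm_norm, Real.norm_of_nonneg (hu0 x), Pi.add_apply]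
    nlinarith [sq_nonneg (u x - ‖Y x‖), sq_nonneg (u x), sq_nonneg (‖Y x‖)]
  have hY0 : 0 ≤ ∫ x, ‖Y x‖ ^ 2 := integral_nonneg fun x => by positivity
  have hBQ : B ≤ D * Q := by
    rw [hQ, ← integral_const_mul]
    refine integral_mono iB (iQ.const_mul _) fun x => ?_
    by_cases hx : x ∈ tsupport u
    · have h1 := hdpos x (ht hx)
      have h2 := hdD' x (ht hx)
      simp only
      rw [← mul_div_assoc, le_div_iff₀ h1, mul_comm]
      gcongr
    · simp [huz x hx]
  have hQpos : 0 < Q := by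
    by_contra h
    nlinarith
  have hApos : 0 < A := by
    have : 0 < b / 2 * Q := by positivity
    linarith
  refine ⟨hApos, ?_⟩
  set S := √(A * B) with hS
  have hSsq : S ^ 2 = A * B := Real.sq_sqrt (by positivity)
  have hSpos : 0 < S := Real.sqrt_pos.2 (by positivity)
  have hBS : B ≤ 2 * D * S := by
    have h1 : B ≤ 4 * D ^ 2 * A := by
      have h2 : b / 2 * Q ≤ A := by linarith
      have h3 : D * Q = 4 * D ^ 2 * (b / 2 * Q) := by rw [hb]; field_simp; norm_num
      rw [h3] at hBQ
      have : 4 * D ^ 2 * (b / 2 * Q) ≤ 4 * D ^ 2 * A := by gcongr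
      linarith
    apply le_of_sq_le_sq _ (by positivity)
    rw [mul_pow, hSsq]
    nlinarith
  have hT : ∫ x, u x * ‖Y x‖ ≤ S := by
    have : ∫ x, u x * ‖Y x‖ ≤ ∫ x, (S / (2 * B) * u x ^ 2 + B / (2 * S) * ‖Y x‖ ^ 2) := by
      refine integral_mono iT ((iB.const_mul _).add (iY.const_mul _)) fun x => ?_
      have : S / (2 * B) * u x ^ 2 + B / (2 * S) * ‖Y x‖ ^ 2 - u x * ‖Y x‖ =
          (S * u x - B * ‖Y x‖) ^ 2 / (2 * B * S) := by
        field_simp; ring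
      have h2 : 0 ≤ (S * u x - B * ‖Y x‖) ^ 2 / (2 * B * S) := by positivity
      simp only
      linarith
    rw [integral_add (iB.const_mul _) (iY.const_mul _), integral_const_mul, integral_const_mul] at this
    have h3 : B / (2 * S) * ∫ x, ‖Y x‖ ^ 2 ≤ B / (2 * S) * A := by
      gcongr
      have : 0 ≤ b / 2 * Q := by positivity
      linarith
    have h4 : B / (2 * S) * A = S / 2 := by
      field_simp; linarith
    have h5 : S / (2 * B) * B = S / 2 := by field_simp
    linarith
  have hQS : Q ≤ C2 * S := by
    have h1 : ∫ x, (r / 2 * (u x ^ 2 / d x) - (1 / 2 + b * r) * u x ^ 2) ≤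
        ∫ x, (u x * inner ℝ (gradient u x) (x0 - x) + D * (u x * ‖Y x‖)) := by
      refine integral_mono_ae ((iQ.const_mul _).sub (iB.const_mul _)) (iF.add (iT.const_mul _)) ?_
      filter_upwards [hdL.ae_differentiableAt] with x hdx
      by_cases hx : x ∈ tsupport u
      · have hxd := hdpos x (ht hx)
        have hxR := hdD' x (ht hx)
        have hk : 0 ≤ 1 / (2 * d x) - b := by
          rw [hb, sub_nonneg]
          gcongr
        have hcc : r - d x ≤ inner ℝ (gradient d x) (x0 - x) := by
          rw [hr]
          rw [hd] at hdx ⊢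
          exact lsb_grad_concave hΩ hcv hne (ht hx) hx0 hdx
        have hUY : gradient u x = Y x + (u x * (1 / (2 * d x) - b)) • gradient d x := by
          simp [hY]
        have hcs : -(‖Y x‖ * D) ≤ inner ℝ (Y x) (x0 - x) := by
          have h1 := (abs_le.1 (abs_real_inner_le_norm (Y x) (x0 - x))).1
          have h2 : ‖Y x‖ * ‖x0 - x‖ ≤ ‖Y x‖ * D := by
            gcongr; exact hxD x (ht hx)
          linarith
        have e1 : inner ℝ (gradient u x) (x0 - x) = inner ℝ (Y x) (x0 - x) +
            (u x * (1 / (2 * d x) - b)) * inner ℝ (gradient d x) (x0 - x) := by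
          conv_lhs => rw [hUY]
          rw [inner_add_left, real_inner_smul_left]
        rw [e1]
        have h5 : u x * -(‖Y x‖ * D) ≤ u x * inner ℝ (Y x) (x0 - x) :=
          mul_le_mul_of_nonneg_left hcs (hu0 x)
        have h6 : u x ^ 2 * (1 / (2 * d x) - b) * (r - d x) ≤
            u x ^ 2 * (1 / (2 * d x) - b) * inner ℝ (gradient d x) (x0 - x) :=
          mul_le_mul_of_nonneg_left hcc (by positivity)
        have h7 : u x ^ 2 * (1 / (2 * d x) - b) * (r - d x) =
            r / 2 * (u x ^ 2 / d x) - (1 / 2 + b * r) * u x ^ 2 + u x ^ 2 * b * d x := by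
          field_simp; ring
        have h8 : 0 ≤ u x ^ 2 * b * d x := by positivity
        linarith
      · simp [huz x hx]
    rw [integral_sub (iQ.const_mul _) (iB.const_mul _), integral_add iF (iT.const_mul _),
      integral_const_mul, integral_const_mul, integral_const_mul, hF] at h1
    have h2 : D * ∫ x, u x * ‖Y x‖ ≤ D * S := by gcongr
    have h3 : (n / 2 + 1 / 2 + b * r) * B ≤ (n / 2 + 1 / 2 + b * r) * (2 * D * S) := by gcongr
    have h4 : r / 2 * Q ≤ ((n / 2 + 1 / 2 + b * r) * (2 * D) + D) * S := by linarith
    calc Q = (2 / r) * (r / 2 * Q) := by field_simp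
      _ ≤ (2 / r) * (((n / 2 + 1 / 2 + b * r) * (2 * D) + D) * S) := by gcongr
      _ = C2 * S := by rw [hC2]; ring
  constructor
  · nlinarith
  · have h1 : ∫ x, u x * ‖gradient u x‖ ≤ ∫ x, (u x * ‖Y x‖ + 1 / 2 * (u x ^ 2 / d x)) := by
      refine integral_mono iM (iT.add (iQ.const_mul _)) fun x => ?_
      simp only
      by_cases hx : x ∈ tsupport u
      · have hxd := hdpos x (ht hx)
        have hxR := hdD' x (ht hx)
        have hk : 0 ≤ 1 / (2 * d x) - b := by
          rw [hb, sub_nonneg]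
          gcongr
        have hUY : gradient u x = Y x + (u x * (1 / (2 * d x) - b)) • gradient d x := by
          simp [hY]
        have h3 : ‖gradient u x‖ ≤ ‖Y x‖ + u x * (1 / (2 * d x)) := by
          conv_lhs => rw [hUY]
          refine (norm_add_le _ _).trans ?_
          rw [norm_smul, Real.norm_of_nonneg (mul_nonneg (hu0 x) hk)]
          have h4 : ‖gradient d x‖ ≤ 1 := by simpa using lsb_norm_grad_le hdL x
          have h5 : u x * (1 / (2 * d x) - b) * ‖gradient d x‖ ≤ u x * (1 / (2 * d x) - b) * 1 :=
            mul_le_mul_of_nonneg_left h4 (mul_nonneg (hu0 x) hk)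
          nlinarith [hu0 x, mul_nonneg (hu0 x) hbpos.le]
        calc u x * ‖gradient u x‖ ≤ u x * (‖Y x‖ + u x * (1 / (2 * d x))) :=
              mul_le_mul_of_nonneg_left h3 (hu0 x)
          _ = _ := by field_simp
      · simp [huz x hx]
    rw [integral_add iT (iQ.const_mul _), integral_const_mul] at h1
    nlinarith
end Estimates


section Final
open Filter Topology

variable {E : Type*} [NormedAddCommGroup E] [InnerProductSpace ℝ E] [FiniteDimensional ℝ E]
  [MeasurableSpace E] [BorelSpace E]

lemma lsb_gns {p : ℝ} (hp : Real.HolderConjugate (Module.finrank ℝ E) p) :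
    ∃ C : ℝ, 0 < C ∧ ∀ u : E → ℝ, ContDiff ℝ 1 u → HasCompactSupport u → (∀ x, 0 ≤ u x) →
      Integrable (fun x => (u x ^ 2) ^ p) ∧
      (∫ x, (u x ^ 2) ^ p) ≤ C * (2 * ∫ x, u x * ‖gradient u x‖) ^ p := by
  refine ⟨lintegralPowLePowLIntegralFDerivConst (volume : Measure E) p + 1, by positivity, ?_⟩
  intro u hu hs hu0
  have hppos : 0 < p := hp.symm.pos
  have hu2s : HasCompactSupport (fun x => u x ^ 2) := by
    simp_rw [pow_two]; exact hs.mul_right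
  have hu2 : ContDiff ℝ 1 (fun x => u x ^ 2) := hu.pow 2
  have hUc : Continuous (gradient u) := by
    have := hu.continuous_fderiv (by norm_num)
    exact (InnerProductSpace.toDual ℝ E).symm.continuous.comp this
  have huc := hu.continuous
  have huz : ∀ x, x ∉ tsupport u → u x = 0 := fun x hx => image_eq_zero_of_notMem_tsupport hx
  have ip : Integrable (fun x => (u x ^ 2) ^ p) := by
    apply Continuous.integrable_of_hasCompactSupport
    · exact hu2.continuous.rpow_const (fun x => Or.inr hppos.le)
    · apply HasCompactSupport.intro hs.isCompact
      intro x hx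
      simp [huz x hx, hppos.ne']
  refine ⟨ip, ?_⟩
  have iM : Integrable (fun x => 2 * (u x * ‖gradient u x‖)) := by
    apply Continuous.integrable_of_hasCompactSupport (by fun_prop)
    apply HasCompactSupport.intro hs.isCompact
    intro x hx
    simp [huz x hx]
  have h := lintegral_pow_le_pow_lintegral_fderiv (volume : Measure E) hu2 hu2s hp
  have e1 : ∫⁻ x, ‖u x ^ 2‖ₑ ^ p = ENNReal.ofReal (∫ x, (u x ^ 2) ^ p) := by
    rw [ofReal_integral_eq_lintegral_ofReal ip (.of_forall fun x => by positivity)]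
    congr 1; ext x
    rw [Real.enorm_eq_ofReal (sq_nonneg _), ENNReal.ofReal_rpow_of_nonneg (sq_nonneg _) hppos.le]
  have e2 : ∫⁻ x, ‖fderiv ℝ (fun x => u x ^ 2) x‖ₑ =
      ENNReal.ofReal (2 * ∫ x, u x * ‖gradient u x‖) := by
    rw [← integral_const_mul, ofReal_integral_eq_lintegral_ofReal iM
      (.of_forall fun x => mul_nonneg (by norm_num) (mul_nonneg (hu0 x) (norm_nonneg _)))]
    congr 1; ext x
    have := ((hu.differentiable (by norm_num) x).hasFDerivAt.pow 2).fderiv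
    rw [← ofReal_norm_eq_enorm, this, norm_smul, ← toDual_gradient, LinearIsometryEquiv.norm_map]
    congr 1
    simp [abs_of_nonneg (hu0 x)]
    ring
  have hM0 : 0 ≤ 2 * ∫ x, u x * ‖gradient u x‖ :=
    mul_nonneg (by norm_num) (integral_nonneg fun x => mul_nonneg (hu0 x) (norm_nonneg _))
  rw [e1, e2, ENNReal.ofReal_rpow_of_nonneg hM0 hppos.le, ← ENNReal.ofReal_coe_nnreal,
    ← ENNReal.ofReal_mul (by positivity), ENNReal.ofReal_le_ofReal_iff (by positivity)] at h
  refine h.trans ?_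
  gcongr
  linarith

lemma lsb_log_le {t s : ℝ} (ht : 0 < t) (hs : 0 < s) : Real.log t ≤ t / s - 1 + Real.log s := by
  have := Real.log_le_sub_one_of_pos (div_pos ht hs)
  rw [Real.log_div ht.ne' hs.ne'] at this
  linarith

lemma lsb_algebra {n p A B C G ε : ℝ} (hn : 1 < n) (hp : (n - 1) * p = n)
    (hA : 0 < A) (hB : 0 < B) (hC : 0 < C) (hG : 0 < G) (hε : 0 < ε) :
    B * ((n - 1) / 2 * Real.log (G * (2 * (C * √(A * B))) ^ p / B)
      + 1 / 2 * Real.log (C * √(A * B) / B) - 1 / 2 * Real.log B) ≤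
    ε * A + ((n - 1) / 2 * Real.log G + n / 2 * Real.log (2 * C) + 1 / 2 * Real.log C
      + (n + 1) / 4 * (Real.log ((n + 1) / 4) - 1) - (n + 1) / 4 * Real.log ε) * B := by
  have hS : 0 < √(A * B) := Real.sqrt_pos.2 (by positivity)
  have hlS : Real.log (√(A * B)) = (Real.log A + Real.log B) / 2 := by
    rw [Real.log_sqrt (by positivity), Real.log_mul hA.ne' hB.ne']
  have h1 : Real.log (G * (2 * (C * √(A * B))) ^ p / B) =
      Real.log G + p * (Real.log (2 * C) + (Real.log A + Real.log B) / 2) - Real.log B := by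
    rw [Real.log_div (by positivity) hB.ne', Real.log_mul hG.ne' (by positivity),
      Real.log_rpow (by positivity), ← mul_assoc, Real.log_mul (by positivity) hS.ne', hlS]
  have h2 : Real.log (C * √(A * B) / B) = Real.log C + (Real.log A + Real.log B) / 2 - Real.log B := by
    rw [Real.log_div (by positivity) hB.ne', Real.log_mul hC.ne' hS.ne', hlS]
  rw [h1, h2]
  set c := (n + 1) / 4 with hc
  have hcpos : 0 < c := by rw [hc]; linarith
  have h3 := Real.log_le_sub_one_of_pos (show 0 < ε * A / (c * B) by positivity)
  rw [Real.log_div (by positivity) (by positivity), Real.log_mul hε.ne' hA.ne',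
    Real.log_mul hcpos.ne' hB.ne'] at h3
  have h4 : c * B * (Real.log ε + Real.log A - (Real.log c + Real.log B)) ≤ ε * A - c * B := by
    calc _ ≤ c * B * (ε * A / (c * B) - 1) := by gcongr
      _ = _ := by field_simp
  have h5 : (n - 1) / 2 * (Real.log G + p * (Real.log (2 * C) + (Real.log A + Real.log B) / 2)
      - Real.log B) = (n - 1) / 2 * Real.log G + n / 2 * (Real.log (2 * C)
        + (Real.log A + Real.log B) / 2) - (n - 1) / 2 * Real.log B := by
    linear_combination ((Real.log (2 * C) + (Real.log A + Real.log B) / 2) / 2) * hp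
  rw [h5]
  have hn' : n = 4 * c - 1 := by rw [hc]; ring
  rw [hn']
  nlinarith

set_option maxHeartbeats 1000000 in
lemma lsb_main (hN : 2 ≤ Module.finrank ℝ E)
    {Ω : Set E} (hΩ : IsOpen Ω) (hcv : Convex ℝ Ω) (hne : (frontier Ω).Nonempty)
    (hbd : Bornology.IsBounded Ω) {x0 : E} (hx0 : x0 ∈ Ω)
    {d : E → ℝ} (hd : d = fun x => Metric.infDist x (frontier Ω)) :
    ∃ K : ℝ, 0 < K ∧ ∀ u : E → ℝ, ContDiff ℝ 1 u → HasCompactSupport u → tsupport u ⊆ Ω →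
      (∀ x, 0 ≤ u x) → u ≠ 0 → ∀ ε : ℝ, 0 < ε →
      (∫ x, u x ^ 2 * Real.log (u x / ((∫ y, u y ^ 2) ^ ((1 : ℝ) / 2) * d x ^ ((1 : ℝ) / 2)))) ≤
        ε * (∫ x, (‖gradient u x‖ ^ 2 - u x ^ 2 / (4 * d x ^ 2))) +
        (K - ((Module.finrank ℝ E : ℝ) + 1) / 4 * Real.log ε) * ∫ x, u x ^ 2 := by
  obtain ⟨C, hC, hest⟩ := lsb_estimates hΩ hcv hne hbd hx0 hd
  set n := (Module.finrank ℝ E : ℝ) with hn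
  have hn2 : 2 ≤ n := by rw [hn]; exact_mod_cast hN
  have hn1 : 1 < n := by linarith
  obtain ⟨p, hpdef⟩ : ∃ p : ℝ, p = 1 + 1 / (n - 1) := ⟨_, rfl⟩
  have hn1' : 0 < n - 1 := by linarith
  have hp : (n - 1) * p = n := by rw [hpdef]; field_simp; ring
  have hconj : Real.HolderConjugate n p := by
    rw [Real.holderConjugate_iff]
    refine ⟨hn1, ?_⟩
    have : p = n / (n - 1) := by rw [eq_div_iff hn1'.ne']; linarith
    rw [this]
    field_simp
    ring
  have hppos : 0 < p := hconj.symm.pos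
  obtain ⟨G, hG, hgns⟩ := lsb_gns (E := E) hconj
  refine ⟨|(n - 1) / 2 * Real.log G + n / 2 * Real.log (2 * C) + 1 / 2 * Real.log C
      + (n + 1) / 4 * (Real.log ((n + 1) / 4) - 1)| + 1, by positivity, ?_⟩
  intro u hu hs ht hu0 hune ε hε
  have huc := hu.continuous
  have huz : ∀ x, x ∉ tsupport u → u x = 0 := fun x hx => image_eq_zero_of_notMem_tsupport hx
  have hdpos : ∀ x ∈ Ω, 0 < d x := fun x hx => by rw [hd]; exact lsb_pos hΩ hne hx
  have hdL : LipschitzWith 1 d := by rw [hd]; exact Metric.lipschitz_infDist_pt _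
  have hdc := hdL.continuous
  have hu2s : HasCompactSupport (fun x => u x ^ 2) := by
    simp_rw [pow_two]; exact hs.mul_right
  have hBpos : 0 < ∫ x, u x ^ 2 := by
    obtain ⟨z, hz⟩ := Function.ne_iff.1 hune
    exact (huc.pow 2).integral_pos_of_hasCompactSupport_nonneg_nonzero hu2s
      (fun x => sq_nonneg _) (x := z) (pow_ne_zero 2 hz)
  obtain ⟨hApos, hQ, hM⟩ := hest u hu hs ht hu0 hBpos
  obtain ⟨iP, hP⟩ := hgns u hu hs hu0
  have hM0 : 0 ≤ ∫ x, u x * ‖gradient u x‖ :=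
    integral_nonneg fun x => mul_nonneg (hu0 x) (norm_nonneg _)
  set A := ∫ x, (‖gradient u x‖ ^ 2 - u x ^ 2 / (4 * d x ^ 2)) with hA
  set B := ∫ x, u x ^ 2 with hB
  have hSpos : 0 < √(A * B) := Real.sqrt_pos.2 (by positivity)
  set Q' := C * √(A * B) with hQ'
  have hQ'pos : 0 < Q' := by positivity
  set P' := G * (2 * Q') ^ p with hP'
  have hP'pos : 0 < P' := by positivity
  have hPP : ∫ x, (u x ^ 2) ^ p ≤ P' := by
    refine hP.trans ?_
    rw [hP']
    gcongr
  have hintg : ∀ g : E → ℝ, ContinuousOn g Ω → Integrable (fun x => u x * g x) := fun g hg =>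
    lsb_integrable_mul hΩ huc hs ht hg
  have hinvc : ContinuousOn (fun x => (d x)⁻¹) Ω :=
    hdc.continuousOn.inv₀ (fun x hx => (hdpos x hx).ne')
  have hlogc : ContinuousOn (fun x => Real.log (d x)) Ω :=
    hdc.continuousOn.log (fun x hx => (hdpos x hx).ne')
  have hulog : Continuous (fun x => u x * Real.log (u x)) := Real.continuous_mul_log.comp huc
  have iB : Integrable (fun x => u x ^ 2) :=
    (hintg u (by fun_prop)).congr (.of_forall fun x => by simp only; ring)
  have iQ : Integrable (fun x => u x ^ 2 / d x) :=
    (hintg (fun x => u x * (d x)⁻¹) (by fun_prop)).congr (.of_forall fun x => by simp only; ring)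
  have hsplit : ∀ x, u x ^ 2 * Real.log (u x / (B ^ ((1 : ℝ) / 2) * d x ^ ((1 : ℝ) / 2))) =
      u x * (u x * Real.log (u x) - u x * (1 / 2 * Real.log B) - u x * (1 / 2 * Real.log (d x))) := by
    intro x
    by_cases hx : u x = 0
    · simp [hx]
    · have hxΩ : x ∈ Ω := ht (subset_tsupport _ hx)
      have h1 := hdpos x hxΩ
      rw [Real.log_div hx (by positivity), Real.log_mul (by positivity) (by positivity),
        Real.log_rpow hBpos, Real.log_rpow h1]
      ring
  have iL : Integrable (fun x => u x *
      (u x * Real.log (u x) - u x * (1 / 2 * Real.log B) - u x * (1 / 2 * Real.log (d x)))) := by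
    apply hintg
    exact (hulog.continuousOn.sub (by fun_prop)).sub (by fun_prop)
  simp_rw [hsplit]
  have hmono : ∫ x, u x *
      (u x * Real.log (u x) - u x * (1 / 2 * Real.log B) - u x * (1 / 2 * Real.log (d x))) ≤
      ∫ x, ((n - 1) / 2 * (B / P') * (u x ^ 2) ^ p + 1 / 2 * (B / Q') * (u x ^ 2 / d x)
        + ((n - 1) / 2 * (Real.log (P' / B) - 1) + 1 / 2 * (Real.log (Q' / B) - 1)
          - 1 / 2 * Real.log B) * u x ^ 2) := by
    refine integral_mono iL (((iP.const_mul _).add (iQ.const_mul _)).add (iB.const_mul _)) ?_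
    intro x
    simp only [Pi.add_apply]
    by_cases hx : u x = 0
    · simp [hx, hppos.ne']
    · have hxΩ : x ∈ Ω := ht (subset_tsupport _ hx)
      have h1 := hdpos x hxΩ
      have hux : 0 < u x := lt_of_le_of_ne (hu0 x) (Ne.symm hx)
      have hu2 : 0 < u x ^ 2 := by positivity
      have l1 := lsb_log_le (t := (u x ^ 2) ^ (1 / (n - 1))) (s := P' / B) (by positivity) (by positivity)
      rw [Real.log_rpow hu2, Real.log_pow] at l1
      have l2 := lsb_log_le (t := (d x)⁻¹) (s := Q' / B) (by positivity) (by positivity)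
      rw [Real.log_inv] at l2
      have e1 : (u x ^ 2) ^ p = u x ^ 2 * (u x ^ 2) ^ (1 / (n - 1)) := by
        rw [hpdef, Real.rpow_add hu2, Real.rpow_one]
      rw [e1]
      set w := (u x ^ 2) ^ (1 / (n - 1))
      have l1' : Real.log (u x) ≤ (n - 1) / 2 * (w / (P' / B) - 1 + Real.log (P' / B)) := by
        calc Real.log (u x) = (n - 1) / 2 * (1 / (n - 1) * (((2 : ℕ) : ℝ) * Real.log (u x))) := by
              push_cast; field_simp
          _ ≤ _ := by gcongr
      have m1 := mul_le_mul_of_nonneg_left l1' hu2.le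
      have m2 := mul_le_mul_of_nonneg_left l2 (show 0 ≤ 1 / 2 * u x ^ 2 by positivity)
      have e2 : w / (P' / B) = B / P' * w := by field_simp
      have e3 : (d x)⁻¹ / (Q' / B) = B / Q' * (d x)⁻¹ := by field_simp
      rw [e2] at m1
      rw [e3] at m2
      rw [div_eq_mul_inv (u x ^ 2) (d x)]
      linarith
  have iPQ : Integrable (fun x => (n - 1) / 2 * (B / P') * (u x ^ 2) ^ p
      + 1 / 2 * (B / Q') * (u x ^ 2 / d x)) := (iP.const_mul _).add (iQ.const_mul _)
  rw [integral_add iPQ (iB.const_mul _),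
    integral_add (iP.const_mul _) (iQ.const_mul _), integral_const_mul, integral_const_mul,
    integral_const_mul] at hmono
  have f1 : (n - 1) / 2 * (B / P') * ∫ x, (u x ^ 2) ^ p ≤ (n - 1) / 2 * (B / P') * P' := by gcongr
  have f2 : 1 / 2 * (B / Q') * ∫ x, u x ^ 2 / d x ≤ 1 / 2 * (B / Q') * Q' := by gcongr
  have f3 : (n - 1) / 2 * (B / P') * P' = (n - 1) / 2 * B := by field_simp
  have f4 : 1 / 2 * (B / Q') * Q' = 1 / 2 * B := by field_simp
  have halg := lsb_algebra hn1 hp hApos hBpos hC hG hε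
  rw [← hQ', ← hP'] at halg
  have habs := le_abs_self ((n - 1) / 2 * Real.log G + n / 2 * Real.log (2 * C)
    + 1 / 2 * Real.log C + (n + 1) / 4 * (Real.log ((n + 1) / 4) - 1))
  set K0 := (n - 1) / 2 * Real.log G + n / 2 * Real.log (2 * C)
    + 1 / 2 * Real.log C + (n + 1) / 4 * (Real.log ((n + 1) / 4) - 1)
  have hK : K0 * B ≤ (|K0| + 1) * B := by gcongr; linarith
  linarith
end Final


/-- Logarithmic Sobolev inequality for the Schrödinger operator with critical boundary
singularity, on smooth bounded convex domains. -/
theorem log_sobolev_boundary_critical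
    (N : ℕ) (hN : 2 ≤ N)
    (Ω : Set (EuclideanSpace ℝ (Fin N))) (hΩo : IsOpen Ω) (hΩconn : IsConnected Ω)
    (hΩb : Bornology.IsBounded Ω) (hΩsm : IsC2Domain Ω) (hΩcvx : Convex ℝ Ω) :
    ∃ K : ℝ, 0 < K ∧
      ∀ u : EuclideanSpace ℝ (Fin N) → ℝ,
        ContDiff ℝ (⊤ : ℕ∞) u → HasCompactSupport u → tsupport u ⊆ Ω →
        (∀ x, 0 ≤ u x) → u ≠ 0 →
        ∀ ε : ℝ, 0 < ε →
        (∫ x in Ω, u x ^ 2 *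
            Real.log (u x / ((∫ y in Ω, u y ^ 2) ^ ((1 : ℝ) / 2) *
              bdist Ω x ^ ((1 : ℝ) / 2)))) ≤
          ε * (∫ x in Ω, (‖gradient u x‖ ^ 2 - u x ^ 2 / (4 * bdist Ω x ^ 2))) +
            (K - ((N : ℝ) + 1) / 4 * Real.log ε) * ∫ x in Ω, u x ^ 2 := by
  haveI : Nonempty (Fin N) := ⟨⟨0, by omega⟩⟩
  obtain ⟨x0, hx0⟩ := hΩconn.nonempty
  have hne : (frontier Ω).Nonempty := by
    rw [nonempty_frontier_iff]
    refine ⟨⟨x0, hx0⟩, ?_⟩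
    rintro rfl
    exact NormedSpace.unbounded_univ ℝ (EuclideanSpace ℝ (Fin N)) hΩb
  obtain ⟨K, hK, h⟩ := lsb_main (E := EuclideanSpace ℝ (Fin N)) (by simpa using hN) hΩo hΩcvx hne
    hΩb hx0 rfl
  refine ⟨K, hK, ?_⟩
  intro u hu hc ht hu0 hune ε hε
  have h1 := h u (hu.of_le (by exact_mod_cast le_top)) hc ht hu0 hune ε hε
  have hz : ∀ x, x ∉ Ω → u x = 0 := fun x hx => image_eq_zero_of_notMem_tsupport (fun h => hx (ht h))
  have hg : ∀ x, x ∉ Ω → gradient u x = 0 := fun x hx => lsb_grad_zero (fun h => hx (ht h))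
  have e1 : ∫ y in Ω, u y ^ 2 = ∫ y, u y ^ 2 :=
    setIntegral_eq_integral_of_forall_compl_eq_zero (fun x hx => by simp [hz x hx])
  have e2 : (∫ x in Ω, u x ^ 2 *
            Real.log (u x / ((∫ y, u y ^ 2) ^ ((1 : ℝ) / 2) *
              bdist Ω x ^ ((1 : ℝ) / 2)))) = ∫ x, u x ^ 2 *
            Real.log (u x / ((∫ y, u y ^ 2) ^ ((1 : ℝ) / 2) *
              bdist Ω x ^ ((1 : ℝ) / 2))) :=
    setIntegral_eq_integral_of_forall_compl_eq_zero (fun x hx => by simp [hz x hx])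
  have e3 : (∫ x in Ω, (‖gradient u x‖ ^ 2 - u x ^ 2 / (4 * bdist Ω x ^ 2))) =
      ∫ x, (‖gradient u x‖ ^ 2 - u x ^ 2 / (4 * bdist Ω x ^ 2)) :=
    setIntegral_eq_integral_of_forall_compl_eq_zero (fun x hx => by simp [hz x hx, hg x hx])
  rw [e1, e2, e3]
  simp only [finrank_euclideanSpace_fin] at h1
  exact h1
end
end
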